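/- arXiv:1507.05459 — 3 statements merged into one kernel-verified Lean document; each statement's English description precedes it below -/
import Mathlib

section
/- Let (R,m,K) be a standard graded K-algebra of characteristic p > 0 which is F-finite and F-pure. Then fpt(R) ≤ -a_i(R) for every natural number i, where a_i(R) is the i-th a-invariant of R (with the convention a_i(R) = -∞ if H^i_m(R) = 0). -/
/-!
Core definitions: standard graded algebras, Koszul-colimit model of graded local
cohomology nonvanishing, Frobenius splittings, F-purity, F-thresholds.
-/

open Filter

namespace FT

variable {R : Type*}

/-- Component of the (cochain) Koszul complex on `n` elements with values in `M`. -/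
abbrev KC (n : ℕ) (M : Type*) (k : ℕ) : Type _ :=
  {s : Finset (Fin n) // s.card = k} → M

/-- The Koszul cochain differential on the complex `K^•(f₁,…,fₙ; M)`. -/
def kd [CommRing R] {n : ℕ} (M : Type*) [AddCommGroup M] [Module R M]
    (f : Fin n → R) (k : ℕ) : KC n M k →ₗ[R] KC n M (k + 1) where
  toFun ω s := ∑ i ∈ s.1.attach,
    ((-1 : ℤ) ^ (s.1.filter (fun j => j < i.1)).card) •
      (f i.1 • ω ⟨s.1.erase i.1, by simp [Finset.card_erase_of_mem i.2, s.2]⟩)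
  map_add' a b := by
    funext s
    simp [smul_add, Finset.sum_add_distrib]
  map_smul' r a := by
    funext s
    simp only [Pi.smul_apply, RingHom.id_apply, Finset.smul_sum]
    refine Finset.sum_congr rfl fun i _ => ?_
    rw [smul_comm (f i.1) r, smul_comm ((-1 : ℤ) ^ (s.1.filter (fun j => j < i.1)).card) r]

/-- Transition maps of the direct system of Koszul complexes,
`K^•(f₁ᵗ,…,fₙᵗ; M) → K^•(f₁^{t+c},…,fₙ^{t+c}; M)`: on the component indexed by `s`
it is multiplication by `(∏_{i ∈ s} f i)^c`. -/
def ktr [CommRing R] {n : ℕ} (M : Type*) [AddCommGroup M] [Module R M]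
    (f : Fin n → R) (c k : ℕ) : KC n M k →ₗ[R] KC n M k where
  toFun ω s := (∏ i ∈ s.1, f i) ^ c • ω s
  map_add' a b := by funext s; simp
  map_smul' r a := by
    funext s
    simp only [Pi.smul_apply, RingHom.id_apply]
    rw [smul_comm]

/-- Koszul cocycles. -/
def koszulZ [CommRing R] {n : ℕ} (M : Type*) [AddCommGroup M] [Module R M]
    (f : Fin n → R) (i : ℕ) : Submodule R (KC n M i) :=
  LinearMap.ker (kd M f i)

/-- Koszul coboundaries. -/
def koszulB [CommRing R] {n : ℕ} (M : Type*) [AddCommGroup M] [Module R M]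
    (f : Fin n → R) : (i : ℕ) → Submodule R (KC n M i)
  | 0 => ⊥
  | (i + 1) => LinearMap.range (kd M f i)

end FT

namespace FT

variable {K R : Type*}

section Graded

variable [Field K] [CommRing R] [Algebra K R]

/-- Extension of a grading `𝒜 : ℕ → Submodule K R` to integer degrees (zero in
negative degrees). -/
def zdeg (𝒜 : ℕ → Submodule K R) (j : ℤ) : Submodule K R :=
  if 0 ≤ j then 𝒜 j.toNat else ⊥

/-- `ω` is a homogeneous element of (internal) degree `j` of the `k`-th component of the
Koszul complex `K^•(x₁ᵗ,…,xₙᵗ; R)`, where the `xᵢ` have degree one; the component of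
`K^k` indexed by a subset `s` is `R(-t·k)`, so it consists of elements of `R` of degree
`j + t·k`. -/
def KCdeg (𝒜 : ℕ → Submodule K R) (t k : ℕ) (j : ℤ) {n : ℕ} (ω : KC n R k) : Prop :=
  ∀ s, ω s ∈ zdeg 𝒜 (j + t * k)

/-- `lcNonzero K R 𝒜 i j` says that the degree-`j` graded piece of the `i`-th local
cohomology module `H^i_m(R)` (with support in the irrelevant maximal ideal
`m = (𝒜 1)·R`) is nonzero.  Local cohomology is computed here as the direct limit over
`t` of the cohomology of the Koszul complexes `K^•(x₁ᵗ,…,xₙᵗ; R)` on a family of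
degree-one generators of `m`; a class of degree `j` is nonzero in the limit iff it is
represented by a homogeneous cocycle of degree `j` at some stage `t` whose image at
every later stage is not a coboundary. -/
def lcNonzero (K : Type*) (R : Type*) [Field K] [CommRing R] [Algebra K R]
    (𝒜 : ℕ → Submodule K R) (i : ℕ) (j : ℤ) : Prop :=
  ∃ (n : ℕ) (x : Fin n → R), (∀ l, x l ∈ 𝒜 1) ∧
    Ideal.span (Set.range x) = Ideal.span ((𝒜 1 : Submodule K R) : Set R) ∧
    ∃ (t : ℕ) (ω : KC n R i), 0 < t ∧
      ω ∈ koszulZ R (fun l => x l ^ t) i ∧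
      KCdeg 𝒜 t i j ω ∧
      ∀ c : ℕ, ktr R x c i ω ∉ koszulB R (fun l => x l ^ (t + c)) i

/-- A standard graded `K`-algebra: `R = ⊕ 𝒜 i` with `𝒜 0 = K` and `R` generated over
`K` by the finite-dimensional piece `𝒜 1`. -/
structure IsStandardGraded (K : Type*) (R : Type*) [Field K] [CommRing R] [Algebra K R]
    (𝒜 : ℕ → Submodule K R) : Prop where
  internal : DirectSum.IsInternal 𝒜
  mul_le : ∀ i j, 𝒜 i * 𝒜 j ≤ 𝒜 (i + j)
  deg0 : 𝒜 0 = 1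
  gen1 : Algebra.adjoin K ((𝒜 1 : Submodule K R) : Set R) = ⊤
  fg1 : (𝒜 1).FG

/-- The irrelevant maximal ideal of a standard graded algebra, generated by the
degree-one piece. -/
def irrIdeal (𝒜 : ℕ → Submodule K R) : Ideal R :=
  Ideal.span ((𝒜 1 : Submodule K R) : Set R)

/-- A homogeneous ideal: an ideal generated by homogeneous elements. -/
def IsHomogIdeal (𝒜 : ℕ → Submodule K R) (J : Ideal R) : Prop :=
  ∃ S : Set R, (∀ s ∈ S, ∃ d, s ∈ 𝒜 d) ∧ J = Ideal.span S

end Graded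

section Frobenius

variable [CommRing R]

/-- Under the identification of `R`-linear maps `R^{1/p^e} → R` with additive maps
`φ : R → R` satisfying `φ(r^{p^e}·x) = r·φ(x)`, the statement `FSplitsAt R p e f` says
that the inclusion of `R`-modules `f^{1/p^e}·R ⊆ R^{1/p^e}` splits, i.e. there is an
`R`-linear map `R^{1/p^e} → R` sending `f^{1/p^e}` to `1`. -/
def FSplitsAt (R : Type*) [CommRing R] (p e : ℕ) (f : R) : Prop :=
  ∃ φ : R →+ R, (∀ r x : R, φ (r ^ p ^ e * x) = r * φ x) ∧ φ f = 1

/-- `R` is `F`-pure (equivalently, for `F`-finite rings, `F`-split): the Frobenius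
`R → R^{1/p}` splits as a map of `R`-modules. -/
def IsFPureRing (R : Type*) [CommRing R] (p : ℕ) : Prop :=
  FSplitsAt R p 1 1

/-- `R` is `F`-finite: `R` is a finitely generated module over itself via the Frobenius
endomorphism, i.e. `R^{1/p}` is a finitely generated `R`-module. -/
def IsFFinite (R : Type*) [CommRing R] (p : ℕ) : Prop :=
  ∃ s : Finset R, ∀ x : R, ∃ c : R → R, x = ∑ y ∈ s, c y ^ p * y

/-- `R` is strongly `F`-regular: for every nonzero `f` there is `e` such that
`f^{1/p^e}·R → R^{1/p^e}` splits. -/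
def IsStronglyFRegular (R : Type*) [CommRing R] (p : ℕ) : Prop :=
  ∀ f : R, f ≠ 0 → ∃ e : ℕ, FSplitsAt R p e f

/-- The set of nonnegative reals `λ` such that the pair `(R, I^λ)` is `F`-pure. -/
def fptSet (R : Type*) [CommRing R] (p : ℕ) (I : Ideal R) : Set ℝ :=
  {lam : ℝ | 0 ≤ lam ∧
    ∀ᶠ e in atTop, ∃ f ∈ I ^ ⌊((p : ℝ) ^ e - 1) * lam⌋₊, FSplitsAt R p e f}

/-- The `F`-pure threshold of an ideal `I` (for `I` the irrelevant/maximal ideal this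
is the `F`-pure threshold of `R`). -/
noncomputable def fpt (R : Type*) [CommRing R] (p : ℕ) (I : Ideal R) : ℝ :=
  sSup (fptSet R p I)

/-- The set of `R`-linear maps `R^{1/p^e} → R`, identified with additive maps
`φ : R → R` satisfying `φ(r^{p^e}·x) = r·φ(x)`. -/
def frobHoms (R : Type*) [CommRing R] (p e : ℕ) : Set (R →+ R) :=
  {φ | ∀ r x : R, φ (r ^ p ^ e * x) = r * φ x}

/-- The ideal `I_e(R) = {r ∈ R | φ(r^{1/p^e}) ∈ m for all φ ∈ Hom_R(R^{1/p^e}, R)}`. -/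
def Ie (R : Type*) [CommRing R] (p : ℕ) (m : Ideal R) (e : ℕ) : Ideal R where
  carrier := {r : R | ∀ φ ∈ frobHoms R p e, φ r ∈ m}
  zero_mem' := by
    intro φ _
    simp
  add_mem' := by
    intro a b ha hb φ hφ
    rw [map_add]
    exact m.add_mem (ha φ hφ) (hb φ hφ)
  smul_mem' := by
    intro r x hx φ hφ
    have hψ : (φ.comp (AddMonoidHom.mulLeft r)) ∈ frobHoms R p e := by
      intro c y
      simp only [AddMonoidHom.coe_comp, AddMonoidHom.coe_mulLeft, Function.comp_apply]
      rw [mul_left_comm, hφ]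
    simpa using hx _ hψ

/-- The splitting prime `𝒫(R) = ⋂ₑ I_e(R)`. -/
def splittingPrime (R : Type*) [CommRing R] (p : ℕ) (m : Ideal R) : Ideal R :=
  ⨅ e : ℕ, Ie R p m e

/-- `b_J(p^e) = max{r | J^r ⊄ I_e(R)}`. -/
noncomputable def bJ (R : Type*) [CommRing R] (p : ℕ) (m J : Ideal R) (e : ℕ) : ℕ :=
  sSup {r : ℕ | ¬ J ^ r ≤ Ie R p m e}

/-- The Frobenius power `I^{[q]}`, generated by the `q`-th powers of the elements
of `I`. -/
def frobeniusPower (I : Ideal R) (q : ℕ) : Ideal R :=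
  Ideal.span ((fun x : R => x ^ q) '' (I : Set R))

/-- `ν_I(q) = max{r | I^r ⊄ m^{[q]}}`. -/
noncomputable def nu (m : Ideal R) (I : Ideal R) (q : ℕ) : ℕ :=
  sSup {r : ℕ | ¬ I ^ r ≤ frobeniusPower m q}

/-- An ideal `J` is compatible if `φ(J^{1/p^e}) ⊆ J` for every `e` and every
`φ ∈ Hom_R(R^{1/p^e}, R)`. -/
def IsCompatibleIdeal (R : Type*) [CommRing R] (p : ℕ) (J : Ideal R) : Prop :=
  ∀ e : ℕ, ∀ φ ∈ frobHoms R p e, ∀ x ∈ J, φ x ∈ J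

end Frobenius

section RegSeq

variable [CommRing R]

/-- `f 0, …, f (r-1)` is a regular sequence on `R`. -/
def IsRegularSeq (R : Type*) [CommRing R] {r : ℕ} (f : Fin r → R) : Prop :=
  (∀ (k : Fin r) (x : R), f k * x ∈ Ideal.span (f '' {j | j < k}) →
      x ∈ Ideal.span (f '' {j | j < k})) ∧
    Ideal.span (Set.range f) ≠ ⊤

/-- An `F`-pure regular sequence: a regular sequence such that each successive quotient
`R/(f 0, …, f k)` is `F`-pure. -/
def IsFPureRegSeq (R : Type*) [CommRing R] (p : ℕ) {r : ℕ} (f : Fin r → R) : Prop :=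
  IsRegularSeq R f ∧
    ∀ k : Fin r, IsFPureRing (R ⧸ Ideal.span (f '' {j | j ≤ k})) p

end RegSeq

end FT

namespace FT

section Aux
variable {R : Type*} [CommRing R] {n : ℕ}

/-- sign -/
def sg (R : Type*) [CommRing R] {n : ℕ} (l : Fin n) (s : Finset (Fin n)) : R :=
  (-1) ^ (s.filter (fun j => j < l)).card

theorem sg_mul_self (l : Fin n) (s : Finset (Fin n)) : sg R l s * sg R l s = 1 := by
  unfold sg
  rw [← mul_pow]; simp

/-- exterior multiplication -/
def E (R : Type*) [CommRing R] {n : ℕ} (l : Fin n) :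
    (Finset (Fin n) → R) →ₗ[R] (Finset (Fin n) → R) where
  toFun ω s := if l ∈ s then sg R l s * ω (s.erase l) else 0
  map_add' a b := by
    funext s; by_cases h : l ∈ s <;> simp [h, mul_add]
  map_smul' r a := by
    funext s; by_cases h : l ∈ s <;> simp [h, mul_left_comm]

theorem E_apply (l : Fin n) (ω : Finset (Fin n) → R) (s) :
    E R l ω s = if l ∈ s then sg R l s * ω (s.erase l) else 0 := rfl

/-- total Koszul differential -/
def D (f : Fin n → R) : (Finset (Fin n) → R) →ₗ[R] (Finset (Fin n) → R) :=
  ∑ i, f i • E R i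

theorem D_apply (f : Fin n → R) (ω : Finset (Fin n) → R) :
    D f ω = ∑ i, f i • E R i ω := by
  simp [D, LinearMap.sum_apply]

theorem D_apply' (f : Fin n → R) (ω : Finset (Fin n) → R) (s) :
    D f ω s = ∑ i ∈ s, f i * (sg R i s * ω (s.erase i)) := by
  rw [D_apply, Finset.sum_apply]
  simp only [Pi.smul_apply, E_apply, smul_eq_mul, mul_ite, mul_zero]
  rw [← Finset.sum_filter]
  simp

theorem sg_aux (i j : Fin n) (hij : i < j) (s : Finset (Fin n)) (hi : i ∈ s) :
    sg R i s * sg R j (s.erase i) = - (sg R j s * sg R i (s.erase j)) := by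
  have h1 : sg R i (s.erase j) = sg R i s := by
    unfold sg
    congr 2
    ext k; simp only [Finset.mem_filter, Finset.mem_erase]
    constructor
    · rintro ⟨⟨_, h⟩, h'⟩; exact ⟨h, h'⟩
    · rintro ⟨h, h'⟩; exact ⟨⟨(h'.trans hij).ne, h⟩, h'⟩
  have h2 : sg R j s = - sg R j (s.erase i) := by
    unfold sg
    have : (s.erase i).filter (fun k => k < j) = (s.filter (fun k => k < j)).erase i := by
      ext k; simp only [Finset.mem_filter, Finset.mem_erase]; tauto
    have hm : i ∈ s.filter (fun k => k < j) := by simp [hi, hij]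
    rw [this, ← Finset.card_erase_add_one hm, pow_succ]; ring
  rw [h1, h2]; ring

theorem E_sq (i : Fin n) (ω : Finset (Fin n) → R) : E R i (E R i ω) = 0 := by
  funext s; simp [E_apply]

theorem E_anti (i j : Fin n) (hij : i ≠ j) (ω : Finset (Fin n) → R) :
    E R i (E R j ω) = - E R j (E R i ω) := by
  funext s
  simp only [E_apply, Pi.neg_apply, Finset.mem_erase]
  by_cases hi : i ∈ s <;> by_cases hj : j ∈ s <;> simp [hi, hj, hij, hij.symm]
  rw [← mul_assoc, ← mul_assoc, Finset.erase_right_comm (a := j)]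
  rcases lt_or_gt_of_ne hij with h | h
  · rw [sg_aux i j h s hi]; ring
  · rw [sg_aux j i h s hj]; ring

/-- supported on subsets not containing l -/
def Off (l : Fin n) (ω : Finset (Fin n) → R) : Prop := ∀ s, l ∈ s → ω s = 0

theorem D_split (f g : Fin n → R) (l : Fin n) (hg : g l = 0) (hfg : ∀ i, i ≠ l → f i = g i)
    (ω : Finset (Fin n) → R) : D f ω = D g ω + f l • E R l ω := by
  rw [D_apply, D_apply, ← Finset.add_sum_erase _ _ (Finset.mem_univ l),
    ← Finset.add_sum_erase (a := l) (f := fun i => g i • E R i ω) _ (Finset.mem_univ l), hg,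
    Finset.sum_congr rfl (fun i hi => by rw [hfg i (Finset.ne_of_mem_erase hi)])]
  simp [add_comm]

theorem D_E (g : Fin n → R) (l : Fin n) (hg : g l = 0) (ω : Finset (Fin n) → R) :
    D g (E R l ω) = - E R l (D g ω) := by
  rw [D_apply, D_apply, map_sum, ← Finset.sum_neg_distrib]
  refine Finset.sum_congr rfl fun i _ => ?_
  by_cases h : i = l
  · subst h; simp [hg]
  · rw [E_anti i l h, map_smul, smul_neg]

theorem D_off (g : Fin n → R) (l : Fin n) (hg : g l = 0) (ω : Finset (Fin n) → R)
    (h : Off l ω) : Off l (D g ω) := by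
  intro s hs
  rw [D_apply']
  refine Finset.sum_eq_zero fun i hi => ?_
  by_cases hil : i = l
  · subst hil; simp [hg]
  · rw [h (s.erase i) (by simp [hs, Ne.symm hil])]; simp

theorem Off.smul {l : Fin n} {ω : Finset (Fin n) → R} (h : Off l ω) (r : R) : Off l (r • ω) := by
  intro s hs; simp [h s hs]
theorem Off.add {l : Fin n} {ω η : Finset (Fin n) → R} (h : Off l ω) (h' : Off l η) :
    Off l (ω + η) := by
  intro s hs; simp [h s hs, h' s hs]
theorem Off.sub {l : Fin n} {ω η : Finset (Fin n) → R} (h : Off l ω) (h' : Off l η) :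
    Off l (ω - η) := by
  intro s hs; simp [h s hs, h' s hs]

theorem off_unique {l : Fin n} {a b a' b' : Finset (Fin n) → R} (ha : Off l a) (hb : Off l b)
    (ha' : Off l a') (hb' : Off l b') (h : a + E R l b = a' + E R l b') : a = a' ∧ b = b' := by
  have h1 : a = a' := by
    funext s
    by_cases hs : l ∈ s
    · rw [ha s hs, ha' s hs]
    · have := congrFun h s
      simpa [E_apply, hs] using this
  refine ⟨h1, ?_⟩
  subst h1
  have h := add_left_cancel h
  funext s
  by_cases hs : l ∈ s
  · rw [hb s hs, hb' s hs]
  · have := congrFun h (insert l s)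
    simp only [E_apply, Finset.mem_insert_self, if_true, Finset.erase_insert hs] at this
    have h3 := congrArg (fun r => sg R l (insert l s) * r) this
    simpa [← mul_assoc, sg_mul_self] using h3

/-- first part -/
def pa (l : Fin n) (ω : Finset (Fin n) → R) : Finset (Fin n) → R :=
  fun s => if l ∈ s then 0 else ω s
/-- second part -/
def pb (l : Fin n) (ω : Finset (Fin n) → R) : Finset (Fin n) → R :=
  fun s => if l ∈ s then 0 else sg R l (insert l s) * ω (insert l s)

theorem pa_off (l : Fin n) (ω : Finset (Fin n) → R) : Off l (pa l ω) := by
  intro s hs; simp [pa, hs]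
theorem pb_off (l : Fin n) (ω : Finset (Fin n) → R) : Off l (pb l ω) := by
  intro s hs; simp [pb, hs]
theorem p_eq (l : Fin n) (ω : Finset (Fin n) → R) : ω = pa l ω + E R l (pb l ω) := by
  funext s
  by_cases hs : l ∈ s
  · simp [pa, pb, E_apply, hs, Finset.insert_erase, ← mul_assoc, sg_mul_self]
  · simp [pa, E_apply, hs]

theorem D_pair (f g : Fin n → R) (l : Fin n) (hg : g l = 0) (hfg : ∀ i, i ≠ l → f i = g i)
    (a b : Finset (Fin n) → R) :
    D f (a + E R l b) = D g a + E R l (f l • a - D g b) := by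
  rw [D_split f g l hg hfg, map_add, D_E g l hg, map_add, E_sq, map_sub, map_smul]
  simp only [add_zero]; abel

theorem D_pair_zero (f g : Fin n → R) (l : Fin n) (hg : g l = 0) (hfg : ∀ i, i ≠ l → f i = g i)
    {a b : Finset (Fin n) → R} (ha : Off l a) (hb : Off l b)
    (h : D f (a + E R l b) = 0) : D g a = 0 ∧ f l • a = D g b := by
  rw [D_pair f g l hg hfg] at h
  have := off_unique (D_off g l hg a ha) ((ha.smul (f l)).sub (D_off g l hg b hb))
    (a' := 0) (b' := 0) (fun _ _ => rfl) (fun _ _ => rfl) (by simpa using h)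
  exact ⟨this.1, sub_eq_zero.1 this.2⟩

/-- `f l` kills Koszul cohomology -/
theorem kill (f : Fin n → R) (l : Fin n) (ω : Finset (Fin n) → R) (h : D f ω = 0) :
    f l • ω ∈ LinearMap.range (D f) := by
  have hg : Function.update f l 0 l = 0 := by simp
  have hfg : ∀ i, i ≠ l → f i = Function.update f l 0 i := fun i hi => by simp [hi]
  rw [p_eq l ω] at h
  have := D_pair_zero f _ l hg hfg (pa_off l ω) (pb_off l ω) h
  refine ⟨pb l ω, ?_⟩
  rw [D_split f _ l hg hfg, ← this.2, ← smul_add, ← p_eq]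

end Aux

section GradedAux
variable {K R : Type*} [Field K] [CommRing R] [Algebra K R] {n : ℕ}
variable (𝒜 : ℕ → Submodule K R)

/-- homogeneous cochains -/
def Hom (t : Fin n → ℕ) (d : ℕ) (ω : Finset (Fin n) → R) : Prop :=
  ∀ s, ω s ∈ 𝒜 (d + ∑ i ∈ s, t i)

variable {𝒜}

theorem sg_mul_mem (l : Fin n) (s : Finset (Fin n)) {k : ℕ} {r : R} (h : r ∈ 𝒜 k) :
    sg R l s * r ∈ 𝒜 k := by
  unfold sg
  rcases neg_one_pow_eq_or R (s.filter (fun j => j < l)).card with h' | h' <;> rw [h'] <;> simpa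

theorem Hom.add {t : Fin n → ℕ} {d : ℕ} {ω η : Finset (Fin n) → R} (h : Hom 𝒜 t d ω)
    (h' : Hom 𝒜 t d η) : Hom 𝒜 t d (ω + η) := fun s => add_mem (h s) (h' s)

theorem Hom.smul (hm : ∀ i j, 𝒜 i * 𝒜 j ≤ 𝒜 (i + j)) {t : Fin n → ℕ} {d k d' : ℕ}
    {ω : Finset (Fin n) → R} (h : Hom 𝒜 t d ω) {r : R} (hr : r ∈ 𝒜 k) (hd : d' = d + k) :
    Hom 𝒜 t d' (r • ω) := fun s => by
  have := hm _ _ (Submodule.mul_mem_mul hr (h s))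
  rw [show d' + ∑ i ∈ s, t i = k + (d + ∑ i ∈ s, t i) by omega]
  exact this

theorem Hom.pa {t : Fin n → ℕ} {d : ℕ} {ω : Finset (Fin n) → R} (h : Hom 𝒜 t d ω) (l : Fin n) :
    Hom 𝒜 t d (FT.pa l ω) := fun s => by
  unfold FT.pa; split_ifs
  · exact zero_mem _
  · exact h s

theorem Hom.pb {t : Fin n → ℕ} {d d' : ℕ} {ω : Finset (Fin n) → R} (h : Hom 𝒜 t d ω) (l : Fin n)
    (hd : d' = d + t l) :
    Hom 𝒜 t d' (FT.pb l ω) := fun s => by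
  unfold FT.pb; split_ifs with hs
  · exact zero_mem _
  · have := h (insert l s)
    rw [Finset.sum_insert hs, ← add_assoc, ← hd] at this
    exact sg_mul_mem _ _ this

theorem Hom.E {t : Fin n → ℕ} {d d' : ℕ} {ω : Finset (Fin n) → R} (l : Fin n)
    (h : Hom 𝒜 t d' ω) (hd : d' = d + t l) : Hom 𝒜 t d (FT.E R l ω) := fun s => by
  rw [E_apply]; split_ifs with hs
  · have := h (s.erase l)
    rw [← Finset.add_sum_erase _ _ hs, ← add_assoc, ← hd]
    exact sg_mul_mem _ _ this
  · exact zero_mem _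

theorem Hom.upd {t t' : Fin n → ℕ} {d : ℕ} {ω : Finset (Fin n) → R} {l : Fin n}
    (h : Hom 𝒜 t d ω) (ho : Off l ω) (ht : ∀ i, i ≠ l → t i = t' i) : Hom 𝒜 t' d ω := fun s => by
  by_cases hs : l ∈ s
  · rw [ho s hs]; exact zero_mem _
  · rw [← Finset.sum_congr rfl (fun i hi => ht i (fun e => hs (e ▸ hi)))]
    exact h s

variable (𝒜) in
/-- acyclicity in degrees at least B -/
def Acyc (x : Fin n → R) (B : ℕ) (t : Fin n → ℕ) : Prop :=
  ∀ d, B ≤ d → ∀ ω, Hom 𝒜 t d ω → D (fun i => x i ^ t i) ω = 0 →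
    ∃ η, Hom 𝒜 t d η ∧ D (fun i => x i ^ t i) η = ω

theorem pow_mem_gr (h0 : 𝒜 0 = 1) (hm : ∀ i j, 𝒜 i * 𝒜 j ≤ 𝒜 (i + j)) {y : R} {k : ℕ}
    (hy : y ∈ 𝒜 k) (a : ℕ) : y ^ a ∈ 𝒜 (a * k) := by
  induction a with
  | zero => rw [pow_zero, Nat.zero_mul, h0]; exact Submodule.one_le.mp le_rfl
  | succ a ih =>
    rw [pow_succ, Nat.succ_mul]; exact hm _ _ (Submodule.mul_mem_mul ih hy)

theorem acyc_step (h0 : 𝒜 0 = 1) (hm : ∀ i j, 𝒜 i * 𝒜 j ≤ 𝒜 (i + j)) (x : Fin n → R)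
    (hx : ∀ l, x l ∈ 𝒜 1) (B : ℕ) (t : Fin n → ℕ) (l : Fin n) (a : ℕ)
    (h1 : Acyc 𝒜 x B (Function.update t l 1)) (h2 : Acyc 𝒜 x B (Function.update t l a)) :
    Acyc 𝒜 x B (Function.update t l (a + 1)) := by
  intro d hd ω hω hz
  set g : Fin n → R := Function.update (fun i => x i ^ t i) l 0 with hgdef
  have hg : g l = 0 := by simp [g]
  have hfg : ∀ b i, i ≠ l → (fun i => x i ^ (Function.update t l b i)) i = g i := by
    intro b i hi; simp [g, hi]
  have htt : ∀ b b' i, i ≠ l → Function.update t l b i = Function.update t l b' i := by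
    intro b b' i hi; simp [hi]
  have hfl : ∀ b, x l ^ (Function.update t l b l) = x l ^ b := by
    intro b; simp
  have hxa : x l ^ a ∈ 𝒜 a := by simpa using pow_mem_gr h0 hm (hx l) a
  obtain ⟨α, β, hα, hβ, oα, oβ, rfl⟩ : ∃ α β, Hom 𝒜 (Function.update t l (a+1)) d α ∧
      Hom 𝒜 (Function.update t l (a+1)) (d + a + 1) β ∧ Off l α ∧ Off l β ∧ ω = α + E R l β :=
    ⟨pa l ω, pb l ω, hω.pa l, hω.pb l (by simp; ring), pa_off _ _, pb_off _ _, p_eq _ _⟩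
  obtain ⟨e1, e2⟩ := D_pair_zero _ g l hg (hfg _) oα oβ hz
  rw [hfl] at e2
  obtain ⟨η1, hη1, q1⟩ := h1 (d + a) (by omega) (x l ^ a • α + E R l β)
    (((hα.smul hm hxa rfl).upd (oα.smul _) (htt _ _)).add
      ((hβ.upd oβ (htt _ _)).E l (by simp))) (by
      rw [D_pair _ g l hg (hfg _), hfl, map_smul, e1, ← e2, smul_smul]
      simp [pow_succ, mul_comm])
  obtain ⟨α', β', hα', hβ', oα', oβ', rfl⟩ : ∃ α β, Hom 𝒜 (Function.update t l 1) (d + a) α ∧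
      Hom 𝒜 (Function.update t l 1) (d + a + 1) β ∧ Off l α ∧ Off l β ∧ η1 = α + E R l β :=
    ⟨pa l η1, pb l η1, hη1.pa l, hη1.pb l (by simp), pa_off _ _, pb_off _ _, p_eq _ _⟩
  rw [D_pair _ g l hg (hfg _), hfl, pow_one] at q1
  obtain ⟨e3, e4⟩ := off_unique (D_off g l hg _ oα') ((oα'.smul _).sub (D_off g l hg _ oβ'))
    (oα.smul _) oβ q1
  obtain ⟨η2, hη2, q2⟩ := h2 d hd (α + E R l α')
    ((hα.upd oα (htt _ _)).add ((hα'.upd oα' (htt _ _)).E l (by simp))) (by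
      rw [D_pair _ g l hg (hfg _), hfl, e1, e3]; simp)
  obtain ⟨α2, β2, hα2, hβ2, oα2, oβ2, rfl⟩ : ∃ α β, Hom 𝒜 (Function.update t l a) d α ∧
      Hom 𝒜 (Function.update t l a) (d + a) β ∧ Off l α ∧ Off l β ∧ η2 = α + E R l β :=
    ⟨pa l η2, pb l η2, hη2.pa l, hη2.pb l (by simp), pa_off _ _, pb_off _ _, p_eq _ _⟩
  rw [D_pair _ g l hg (hfg _), hfl] at q2
  obtain ⟨e5, e6⟩ := off_unique (D_off g l hg _ oα2) ((oα2.smul _).sub (D_off g l hg _ oβ2))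
    oα oα' q2
  refine ⟨α2 + E R l (x l • β2 + β'), (hα2.upd oα2 (htt _ _)).add
    (Hom.E (d' := d + a + 1) l (((hβ2.smul hm (hx l) rfl).upd (oβ2.smul _) (htt _ _)).add
      (hβ'.upd oβ' (htt _ _))) (by simp; ring)), ?_⟩
  rw [D_pair _ g l hg (hfg _), hfl, e5, ← e4, ← e6, smul_sub, smul_smul, map_add, map_smul,
    ← pow_succ', sub_sub]

theorem acyc_all (h0 : 𝒜 0 = 1) (hm : ∀ i j, 𝒜 i * 𝒜 j ≤ 𝒜 (i + j)) (x : Fin n → R)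
    (hx : ∀ l, x l ∈ 𝒜 1) (B : ℕ) (h1 : Acyc 𝒜 x B (fun _ => 1)) (S : Finset (Fin n)) :
    ∀ t : Fin n → ℕ, (∀ i, 1 ≤ t i) → (∀ i, i ∉ S → t i = 1) → Acyc 𝒜 x B t := by
  induction S using Finset.induction_on with
  | empty =>
    intro t _ ht
    have : t = fun _ => 1 := funext fun i => ht i (by simp)
    rw [this]; exact h1
  | insert l S hl ih =>
    intro t ht ht'
    have hb : Acyc 𝒜 x B (Function.update t l 1) := by
      refine ih _ (fun i => ?_) (fun i hi => ?_)
      · by_cases h : i = l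
        · subst h; simp
        · simp [h, ht]
      · by_cases h : i = l
        · subst h; simp
        · simp [h, ht' i (by simp [h, hi])]
    have key : ∀ a, 1 ≤ a → Acyc 𝒜 x B (Function.update t l a) := by
      intro a ha
      induction a, ha using Nat.le_induction with
      | base => exact hb
      | succ a _ iha => exact acyc_step h0 hm x hx B t l a hb iha
    have := key (t l) (ht l)
    rwa [Function.update_eq_self] at this

end GradedAux

section Serre
variable {K R : Type*} [Field K] [CommRing R] [Algebra K R] {n : ℕ}
variable (𝒜 : ℕ → Submodule K R) [GradedAlgebra 𝒜]

/-- degree d projection for the all-ones exponent vector -/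
noncomputable def pr (d : ℕ) (ω : Finset (Fin n) → R) : Finset (Fin n) → R :=
  fun s => GradedRing.proj 𝒜 (d + ∑ _i ∈ s, 1) (ω s)

theorem pr_hom (d : ℕ) (ω : Finset (Fin n) → R) : Hom 𝒜 (fun _ => 1) d (pr 𝒜 d ω) := fun s => by
  simp [pr, GradedRing.proj_apply]

theorem pr_add (d : ℕ) (ω η : Finset (Fin n) → R) : pr 𝒜 d (ω + η) = pr 𝒜 d ω + pr 𝒜 d η := by
  funext s; simp [pr]

theorem pr_of_hom (d : ℕ) (ω : Finset (Fin n) → R) (h : Hom 𝒜 (fun _ => 1) d ω) :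
    pr 𝒜 d ω = ω := by
  funext s
  rw [pr, GradedRing.proj_apply, DirectSum.decompose_of_mem_same _ (h s)]

theorem pr_smul (d d' : ℕ) (hd : d' ≤ d) (r : R) (ω : Finset (Fin n) → R)
    (h : Hom 𝒜 (fun _ => 1) d' ω) :
    pr 𝒜 d (r • ω) = GradedRing.proj 𝒜 (d - d') r • ω := by
  funext s
  simp only [pr, GradedRing.proj_apply, Pi.smul_apply, smul_eq_mul]
  rw [DirectSum.coe_decompose_mul_of_right_mem_of_le 𝒜 (h s) (by dsimp only; omega)]
  have h3 : d + ∑ _i ∈ s, 1 - (d' + ∑ i ∈ s, (fun _ => 1) i) = d - d' := by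
    dsimp only; omega
  rw [h3]

theorem pr_D (d : ℕ) (x : Fin n → R) (hx : ∀ l, x l ∈ 𝒜 1) (ω : Finset (Fin n) → R) :
    pr 𝒜 d (D x ω) = D x (pr 𝒜 d ω) := by
  funext s
  rw [D_apply']
  simp only [pr, D_apply', map_sum, GradedRing.proj_apply]
  refine Finset.sum_congr rfl fun i hi => ?_
  rw [DirectSum.coe_decompose_mul_of_left_mem_of_le 𝒜 (hx i) (by
    rw [← Finset.add_sum_erase _ _ hi]; omega)]
  congr 1
  rw [← Finset.add_sum_erase _ _ hi, show d + (1 + ∑ _x ∈ s.erase i, 1) - 1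
    = d + ∑ _x ∈ s.erase i, 1 by omega]
  unfold sg
  rw [← GradedRing.proj_apply, ← GradedRing.proj_apply]
  rcases neg_one_pow_eq_or R (s.filter (fun j => j < i)).card with h' | h' <;> rw [h'] <;>
    simp only [neg_mul, one_mul, map_neg]

theorem mem_irr (hdeg0 : 𝒜 0 = 1) (hgen : Algebra.adjoin K ((𝒜 1 : Submodule K R) : Set R) = ⊤)
    (k : ℕ) (hk : 0 < k) (r : R) (hr : r ∈ 𝒜 k) : r ∈ irrIdeal 𝒜 := by
  have h1 : ∀ r : R, ∃ c : K, r - algebraMap K R c ∈ irrIdeal 𝒜 := by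
    intro r
    have hr : r ∈ Algebra.adjoin K ((𝒜 1 : Submodule K R) : Set R) := hgen ▸ Algebra.mem_top
    induction hr using Algebra.adjoin_induction with
    | mem y hy => exact ⟨0, by rw [map_zero, sub_zero]; exact Ideal.subset_span hy⟩
    | algebraMap c => exact ⟨c, by simp⟩
    | add y z _ _ hy hz =>
      obtain ⟨a, ha⟩ := hy
      obtain ⟨b, hb⟩ := hz
      refine ⟨a + b, ?_⟩
      have := add_mem ha hb
      rw [map_add]; convert this using 1; ring
    | mul y z _ _ hy hz =>
      obtain ⟨a, ha⟩ := hy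
      obtain ⟨b, hb⟩ := hz
      refine ⟨a * b, ?_⟩
      have := add_mem (Ideal.mul_mem_right z _ ha) (Ideal.mul_mem_left _ (algebraMap K R a) hb)
      rw [map_mul]; convert this using 1; ring
  have h2 : ∀ y ∈ irrIdeal 𝒜, GradedRing.proj 𝒜 0 y = 0 := by
    intro y hy
    unfold irrIdeal at hy
    have key : ∀ r : R, GradedRing.proj 𝒜 0 (r * y) = 0 := by
      induction hy using Submodule.span_induction with
      | zero => simp
      | add a b _ _ ha hb => intro r; rw [mul_add, map_add, ha, hb, add_zero]
      | mem y hy =>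
        intro r
        rw [GradedRing.proj_apply,
          DirectSum.coe_decompose_mul_of_right_mem_of_not_le 𝒜 hy (by norm_num)]
      | smul a b _ hb => intro r; rw [smul_eq_mul, ← mul_assoc]; exact hb _
    simpa using key 1
  obtain ⟨c, hc⟩ := h1 r
  have h3 := h2 _ hc
  rw [map_sub, GradedRing.proj_apply, GradedRing.proj_apply,
    DirectSum.decompose_of_mem_ne 𝒜 hr (by omega),
    DirectSum.decompose_of_mem_same 𝒜 (SetLike.algebraMap_mem_graded 𝒜 c)] at h3
  rw [zero_sub, neg_eq_zero] at h3
  rwa [h3, sub_zero] at hc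

theorem irr_pow_le (N : ℕ) :
    irrIdeal 𝒜 ^ N ≤ Ideal.span ((𝒜 N : Submodule K R) : Set R) := by
  induction N with
  | zero =>
    rw [pow_zero, Ideal.one_eq_top, top_le_iff, Ideal.eq_top_iff_one]
    refine Ideal.subset_span ?_
    exact SetLike.GradedOne.one_mem
  | succ N ih =>
    rw [pow_succ]
    refine (Ideal.mul_mono_left ih).trans ?_
    unfold irrIdeal
    rw [Ideal.span_mul_span', Ideal.span_le]
    rintro _ ⟨a, ha, b, hb, rfl⟩
    exact Ideal.subset_span (SetLike.GradedMul.mul_mem ha hb)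

theorem base_acyc [IsNoetherianRing R] (hdeg0 : 𝒜 0 = 1)
    (hgen : Algebra.adjoin K ((𝒜 1 : Submodule K R) : Set R) = ⊤)
    (x : Fin n → R) (hx : ∀ l, x l ∈ 𝒜 1)
    (hs : Ideal.span (Set.range x) = irrIdeal 𝒜) :
    ∃ B, Acyc 𝒜 x B (fun _ => 1) := by
  let N : ℕ →o Submodule R (Finset (Fin n) → R) :=
    { toFun := fun d => Submodule.span R {ω | D x ω = 0 ∧ ∃ d' ≤ d, Hom 𝒜 (fun _ => 1) d' ω}
      monotone' := by
        intro a b hab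
        refine Submodule.span_mono ?_
        rintro ω ⟨h, d', hd', h'⟩
        exact ⟨h, d', hd'.trans hab, h'⟩ }
  obtain ⟨B, hB⟩ := monotone_stabilizes_iff_noetherian.mpr
    (inferInstance : IsNoetherian R (Finset (Fin n) → R)) N
  have kill' : ∀ ω : Finset (Fin n) → R, D x ω = 0 → ∀ r ∈ irrIdeal 𝒜,
      r • ω ∈ LinearMap.range (D x) := by
    intro ω hω r hr
    rw [← hs] at hr
    induction hr using Submodule.span_induction with
    | zero => simp
    | add a b _ _ ha hb => rw [add_smul]; exact add_mem ha hb
    | mem y hy =>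
      obtain ⟨l, rfl⟩ := hy
      exact kill x l ω hω
    | smul a b _ hb => rw [smul_assoc]; exact Submodule.smul_mem _ _ hb
  refine ⟨B + 1, ?_⟩
  intro d hd ω hω hz
  simp only [pow_one] at hz ⊢
  have hmem : ω ∈ N B := by
    rw [hB d (by omega)]
    exact Submodule.subset_span ⟨hz, d, le_rfl, hω⟩
  have key : ∀ η ∈ N B, ∀ r : R, pr 𝒜 d (r • η) ∈ LinearMap.range (D x) := by
    intro η hη
    change η ∈ Submodule.span R _ at hη
    induction hη using Submodule.span_induction with
    | zero => 
      intro r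
      rw [smul_zero, pr_of_hom 𝒜 d 0 (fun _ => zero_mem _)]
      exact zero_mem _
    | add a b _ _ ha hb =>
      intro r
      rw [smul_add, pr_add]; exact add_mem (ha r) (hb r)
    | mem y hy =>
      intro r
      obtain ⟨h, d', hd', h'⟩ := hy
      rw [pr_smul 𝒜 d d' (by omega) r y h']
      refine kill' y h _ (mem_irr 𝒜 hdeg0 hgen (d - d') (by omega) _ ?_)
      simp [GradedRing.proj_apply]
    | smul a b _ hb =>
      intro r
      rw [smul_smul]; exact hb _
  obtain ⟨η, hη⟩ := key ω hmem 1
  rw [one_smul, pr_of_hom 𝒜 d ω hω] at hη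
  refine ⟨pr 𝒜 d η, pr_hom 𝒜 d η, ?_⟩
  rw [← pr_D 𝒜 d x hx, hη, pr_of_hom 𝒜 d ω hω]

end Serre

section Final
variable {R : Type*} [CommRing R] {n : ℕ}

/-- extension by zero -/
def ext0 (i : ℕ) (ω : KC n R i) : Finset (Fin n) → R :=
  fun s => if h : s.card = i then ω ⟨s, h⟩ else 0

theorem kd_eq (f : Fin n → R) (i : ℕ) (ω : KC n R i) (η : Finset (Fin n) → R)
    (h : ∀ s : {s : Finset (Fin n) // s.card = i}, ω s = η s.1) (s) :
    kd R f i ω s = D f η s.1 := by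
  rw [D_apply', ← Finset.sum_attach]
  simp only [kd, LinearMap.coe_mk, AddHom.coe_mk, h, sg]
  refine Finset.sum_congr rfl fun a _ => ?_
  simp only [zsmul_eq_mul, smul_eq_mul]
  push_cast
  ring

theorem D_ext0 (f : Fin n → R) (i : ℕ) (ω : KC n R i) (h : ω ∈ koszulZ R f i) :
    D f (ext0 i ω) = 0 := by
  funext s
  by_cases hs : s.card = i + 1
  · have := kd_eq f i ω (ext0 i ω) (fun s => by simp [ext0, s.2]) ⟨s, hs⟩
    rw [← this]
    have h' : kd R f i ω = 0 := h
    rw [h']; rfl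
  · rw [D_apply']
    refine Finset.sum_eq_zero fun a ha => ?_
    have : (s.erase a).card ≠ i := by
      have := Finset.card_erase_add_one ha
      omega
    simp [ext0, this]

theorem mem_koszulB (f : Fin n → R) (i : ℕ) (ω : KC n R i) (η : Finset (Fin n) → R)
    (h : D f η = ext0 i ω) : ω ∈ koszulB R f i := by
  cases i with
  | zero =>
    change ω = 0
    funext s
    obtain ⟨s, hs⟩ := s
    have := congrFun h s
    rw [D_apply'] at this
    obtain rfl := Finset.card_eq_zero.1 hs
    simpa [ext0] using this.symm
  | succ i =>
    refine ⟨fun s => η s.1, ?_⟩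
    funext s
    rw [kd_eq f i _ η (fun _ => rfl), h]
    simp [ext0, s.2]

theorem D_map (φ : R →+ R) (f : Fin n → R) (q : ℕ) (hφ : ∀ r x : R, φ (r ^ q * x) = r * φ x)
    (η : Finset (Fin n) → R) :
    D f (fun s => φ (η s)) = fun s => φ (D (fun i => f i ^ q) η s) := by
  funext s
  rw [D_apply', D_apply', map_sum]
  refine Finset.sum_congr rfl fun i _ => ?_
  rw [hφ]
  unfold sg
  rcases neg_one_pow_eq_or R (s.filter (fun j => j < i)).card with h' | h' <;> rw [h'] <;> simp

theorem D_frob (p : ℕ) [Fact p.Prime] [CharP R p] (e : ℕ) (f : Fin n → R)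
    (η : Finset (Fin n) → R) :
    D (fun i => f i ^ p ^ e) (fun s => η s ^ p ^ e) = fun s => (D f η s) ^ p ^ e := by
  funext s
  rw [D_apply', D_apply', ← iterateFrobenius_def, map_sum]
  refine Finset.sum_congr rfl fun i _ => ?_
  unfold sg
  simp [iterateFrobenius_def, mul_pow]
  congr 2
  rw [← iterateFrobenius_def]; simp

theorem fsplit_one (p : ℕ) (h : FSplitsAt R p 1 1) (e : ℕ) : FSplitsAt R p e 1 := by
  induction e with
  | zero => exact ⟨AddMonoidHom.id R, by simp, rfl⟩
  | succ e ih =>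
    obtain ⟨φ, h1, h2⟩ := h
    obtain ⟨ψ, h3, h4⟩ := ih
    refine ⟨φ.comp ψ, fun r x => ?_, by simp [h4, h2]⟩
    simp only [AddMonoidHom.comp_apply]
    rw [pow_succ', pow_mul, h3, ← h1, pow_one]

end Final
end FT

open FT in
/-- Let `(R, m, K)` be a standard graded `K`-algebra of prime
characteristic `p` which is `F`-finite and `F`-pure.  Then `fpt(R) ≤ -a_i(R)` for every
`i ∈ ℕ`, where `a_i(R) = max{j | H^i_m(R)_j ≠ 0}` (with `a_i(R) = -∞` when
`H^i_m(R) = 0`).  Equivalently (as formalized): for every `i` and every degree `j`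
with `H^i_m(R)_j ≠ 0`, one has `fpt(R) ≤ -j`. -/
theorem fpt_le_neg_aInv
    (K R : Type*) [Field K] [CommRing R] [Algebra K R]
    (𝒜 : ℕ → Submodule K R) (hSG : IsStandardGraded K R 𝒜)
    (p : ℕ) (hp : p.Prime) [CharP R p]
    (hFF : IsFFinite R p) (hFP : IsFPureRing R p)
    (i : ℕ) (j : ℤ) (hj : lcNonzero K R 𝒜 i j) :
    fpt R p (irrIdeal 𝒜) ≤ (-j : ℤ) := by
  classical
  have : Fact p.Prime := ⟨hp⟩
  have : SetLike.GradedMonoid 𝒜 :=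
    { one_mem := by rw [hSG.deg0]; exact Submodule.one_le.mp le_rfl
      mul_mem := fun a b _ _ ha hb => hSG.mul_le a b (Submodule.mul_mem_mul ha hb) }
  let : DirectSum.Decomposition 𝒜 := hSG.internal.chooseDecomposition
  let : GradedAlgebra 𝒜 := { }
  have : IsNoetherianRing R := by
    obtain ⟨S, hS⟩ := hSG.fg1
    have : Algebra.FiniteType K R := ⟨S, by rw [← hSG.gen1, ← hS, Algebra.adjoin_span]⟩
    exact Algebra.FiniteType.isNoetherianRing K R
  obtain ⟨n, x, hx, hspan, t, ω, ht, hωZ, hωd, hω⟩ := hj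
  obtain ⟨B, hB⟩ := base_acyc 𝒜 hSG.deg0 hSG.gen1 x hx hspan
  refine csSup_le ⟨0, le_rfl, Eventually.of_forall fun e => ⟨1, by simp, fsplit_one p hFP e⟩⟩ ?_
  rintro lam ⟨h0, hlam⟩
  by_contra hlt
  push Not at hlt
  push_cast at hlt
  have hpos : 0 < lam + j := by linarith
  have hT : Tendsto (fun e : ℕ => (p : ℝ) ^ e * (lam + j)) atTop atTop :=
    (tendsto_pow_atTop_atTop_of_one_lt (by exact_mod_cast hp.one_lt)).atTop_mul_const hpos
  obtain ⟨e, ⟨f, hf, φ, hφ, hφf⟩, he⟩ :=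
    (hlam.and (hT.eventually_ge_atTop (B + lam + 1))).exists
  set q := p ^ e with hq
  set N := ⌊((p : ℝ) ^ e - 1) * lam⌋₊ with hN
  have hq0 : 0 < q := pow_pos hp.pos e
  have hNB : (B : ℤ) ≤ q * j + N := by
    have h1 := Nat.lt_floor_add_one (((p : ℝ) ^ e - 1) * lam)
    rw [← hN] at h1
    have : (B : ℝ) ≤ (p : ℝ) ^ e * j + N := by nlinarith
    have h2 : ((B : ℤ) : ℝ) ≤ ((q * j + N : ℤ) : ℝ) := by push_cast [hq]; exact this
    exact_mod_cast h2
  obtain ⟨d, hd⟩ := Int.eq_ofNat_of_zero_le (show 0 ≤ (q : ℤ) * j + N by omega)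
  have hA : Acyc 𝒜 x B (fun _ => t * q) :=
    acyc_all hSG.deg0 hSG.mul_le x hx B hB Finset.univ _
      (fun _ => Nat.mul_pos ht hq0) (fun i hi => absurd (Finset.mem_univ i) hi)
  have hcoc : D (fun l => x l ^ (t * q)) (fun s => ext0 i ω s ^ q) = 0 := by
    have h1 := D_frob p e (fun l => x l ^ t) (ext0 i ω)
    rw [D_ext0 _ i ω hωZ] at h1
    simp only [← pow_mul, ← hq] at h1
    rw [h1]
    funext s
    simp [hq0.ne']
  have hrange : f • (fun s => ext0 i ω s ^ q) ∈ LinearMap.range (D (fun l => x l ^ (t * q))) := by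
    replace hf := irr_pow_le 𝒜 N hf
    clear hφf
    induction hf using Submodule.span_induction with
    | zero => simp
    | add a b _ _ ha hb => rw [add_smul]; exact add_mem ha hb
    | smul a b _ hb => rw [smul_assoc]; exact Submodule.smul_mem _ _ hb
    | mem g hgN =>
      obtain ⟨η, -, hη⟩ := hA d (by omega) (g • (fun s => ext0 i ω s ^ q)) (by
        intro s
        by_cases hs : s.card = i
        · have h1 := hωd ⟨s, hs⟩
          simp only [Pi.smul_apply, smul_eq_mul, ext0, hs, dif_pos, Finset.sum_const]
          unfold zdeg at h1
          split_ifs at h1 with hz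
          · have h2 := pow_mem_gr hSG.deg0 hSG.mul_le h1 q
            have h3 := hSG.mul_le _ _ (Submodule.mul_mem_mul hgN h2)
            convert h3 using 2
            zify
            rw [Int.toNat_of_nonneg hz, ← hd]
            ring
          · rw [(Submodule.mem_bot K).1 h1, zero_pow hq0.ne', mul_zero]; exact zero_mem _
        · simp [ext0, hs, hq0.ne']) (by rw [map_smul, hcoc, smul_zero])
      exact ⟨η, hη⟩
  obtain ⟨η, hη⟩ := hrange
  refine hω 0 ?_
  have hk : ktr R x 0 i ω = ω := by
    funext s; simp [ktr]
  rw [hk]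
  refine mem_koszulB _ i ω (fun s => φ (η s)) ?_
  rw [D_map φ _ q hφ]
  simp only [← pow_mul, add_zero]
  rw [hη]
  funext s
  simp only [Pi.smul_apply, smul_eq_mul]
  rw [mul_comm, hφ, hφf, mul_one]
end

section
/- Let (R,m,K) be an F-finite standard graded K-algebra of characteristic p > 0 and dimension d. Then -a_d(R) ≤ c^m_-(R), where c^m_-(R) = liminf_{e→∞} ν_m(p^e)/p^e and ν_m(p^e) = max{r ∈ N : m^r ⊄ m^{[p^e]}}. -/
/-!
Core definitions: standard graded algebras, Koszul-colimit model of graded local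
cohomology nonvanishing, Frobenius splittings, F-purity, F-thresholds.
-/

open Filter

namespace FT
namespace Aux

variable {R : Type*} [CommRing R] {M : Type*} [AddCommGroup M] [Module R M]

def eps (i : ℕ) (s : Finset ℕ) : ℤ := (-1) ^ (s.filter (fun j => j < i)).card

lemma eps_mul_self (i : ℕ) (s : Finset ℕ) : eps i s * eps i s = 1 := by
  unfold eps
  rw [← mul_pow]; simp

lemma eps_smul_smul (i : ℕ) (s : Finset ℕ) (m : M) : eps i s • eps i s • m = m := by
  rw [smul_smul, eps_mul_self, one_smul]

lemma eps_insert_self (g : ℕ) (s : Finset ℕ) : eps g (insert g s) = eps g s := by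
  unfold eps
  rw [Finset.filter_insert]; simp

lemma eps_swap {g i : ℕ} {s : Finset ℕ} (hg : g ∉ s) (hi : i ∈ s) :
    eps i (insert g s) = - (eps g s * eps i s * eps g (s.erase i)) := by
  have hne : g ≠ i := fun h => hg (h ▸ hi)
  have h1 : eps i (insert g s) = (if g < i then -1 else 1) * eps i s := by
    unfold eps
    rw [Finset.filter_insert]
    split_ifs with h
    · rw [Finset.card_insert_of_notMem (by simp [hg]), pow_succ]; ring
    · ring
  have h2 : eps g s = (if i < g then -1 else 1) * eps g (s.erase i) := by
    conv_lhs => rw [← Finset.insert_erase hi]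
    unfold eps
    rw [Finset.filter_insert]
    split_ifs with h
    · rw [Finset.card_insert_of_notMem (by simp), pow_succ]; ring
    · ring
  have h3 := eps_mul_self g (s.erase i)
  rw [h1, h2]
  rcases lt_or_gt_of_ne hne with h | h
  · rw [if_pos h, if_neg (by omega)]
    linear_combination (-eps i s) * (-h3)
  · rw [if_neg (by omega), if_pos h]
    linear_combination (eps i s) * (-h3)

/-- Koszul differential on functions on finite sets. -/
def D (f : ℕ → R) : (Finset ℕ → M) →ₗ[R] (Finset ℕ → M) where
  toFun Ω s := ∑ i ∈ s, eps i s • (f i • Ω (s.erase i))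
  map_add' a b := by
    funext s
    simp [smul_add, Finset.sum_add_distrib]
  map_smul' r a := by
    funext s
    simp only [Pi.smul_apply, RingHom.id_apply, Finset.smul_sum]
    refine Finset.sum_congr rfl fun i _ => ?_
    rw [smul_comm (f i) r, smul_comm (eps i s) r]

lemma D_apply (f : ℕ → R) (Ω : Finset ℕ → M) (s : Finset ℕ) :
    D f Ω s = ∑ i ∈ s, eps i s • (f i • Ω (s.erase i)) := rfl

def tr (f : ℕ → R) (c : ℕ) : (Finset ℕ → M) →ₗ[R] (Finset ℕ → M) where
  toFun Ω s := (∏ i ∈ s, f i) ^ c • Ω s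
  map_add' a b := by funext s; simp
  map_smul' r a := by
    funext s
    simp only [Pi.smul_apply, RingHom.id_apply]
    rw [smul_comm]

lemma tr_apply (f : ℕ → R) (c : ℕ) (Ω : Finset ℕ → M) (s : Finset ℕ) :
    tr f c Ω s = (∏ i ∈ s, f i) ^ c • Ω s := rfl

lemma tr_tr (f : ℕ → R) (c c' : ℕ) (Ω : Finset ℕ → M) :
    tr f c (tr f c' Ω) = tr f (c' + c) Ω := by
  funext s
  simp only [tr_apply, smul_smul]
  congr 1; ring

lemma D_congr (f : ℕ → R) {Ω Ω' : Finset ℕ → M} {s : Finset ℕ}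
    (h : ∀ i ∈ s, Ω (s.erase i) = Ω' (s.erase i)) : D f Ω s = D f Ω' s := by
  rw [D_apply, D_apply]
  exact Finset.sum_congr rfl fun i hi => by rw [h i hi]

lemma D_tr (f : ℕ → R) (t c : ℕ) (Ω : Finset ℕ → M) :
    D (fun i => f i ^ (t + c)) (tr f c Ω) = tr f c (D (fun i => f i ^ t) Ω) := by
  funext s
  rw [D_apply, tr_apply, D_apply, Finset.smul_sum]
  refine Finset.sum_congr rfl fun i hi => ?_
  rw [tr_apply, smul_comm _ (eps i s), smul_smul, smul_smul, ← Finset.mul_prod_erase s f hi]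
  congr 2
  ring

def kap (g : ℕ) (Ω : Finset ℕ → M) : Finset ℕ → M := fun s => eps g s • Ω (insert g s)

lemma D_insert (f : ℕ → R) (Ω : Finset ℕ → M) {g : ℕ} {s : Finset ℕ} (hg : g ∉ s) :
    D f Ω (insert g s) = eps g s • (f g • Ω s - D f (kap g Ω) s) := by
  rw [D_apply, Finset.sum_insert hg, eps_insert_self, Finset.erase_insert hg, smul_sub,
    sub_eq_add_neg, D_apply, Finset.smul_sum, ← Finset.sum_neg_distrib]
  congr 1
  refine Finset.sum_congr rfl fun i hi => ?_
  have hne : g ≠ i := fun h => hg (h ▸ hi)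
  rw [eps_swap hg hi, Finset.erase_insert_of_ne hne, kap]
  rw [smul_comm (f i) (eps g (s.erase i)), smul_smul, smul_smul, neg_smul, mul_assoc]

lemma D_D (f : ℕ → R) (s : Finset ℕ) : ∀ Ω : Finset ℕ → M, D f (D f Ω) s = 0 := by
  induction s using Finset.induction_on with
  | empty => intro Ω; simp [D_apply]
  | insert g s hg ih =>
    intro Ω
    rw [D_insert _ _ hg]
    have : D f (kap g (D f Ω)) s = D f (f g • Ω - D f (kap g Ω)) s := by
      apply D_congr
      intro i hi
      rw [kap, D_insert _ _ (fun h => hg (Finset.mem_of_mem_erase h)), eps_smul_smul]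
      rfl
    rw [this, map_sub, map_smul, Pi.sub_apply, ih]
    simp

/-- cocycle condition over `S` in degree `k` -/
def Cyc (f : ℕ → R) (S : Finset ℕ) (k : ℕ) (Ω : Finset ℕ → M) : Prop :=
  ∀ s ⊆ S, s.card = k + 1 → D f Ω s = 0

lemma torsion_gen (f : ℕ → R) (S : Finset ℕ) (k : ℕ) (Ω : Finset ℕ → M) (hΩ : Cyc f S k Ω)
    (g : ℕ) (hg : g ∈ S) :
    ∃ η : Finset ℕ → M, ∀ s ⊆ S, s.card = k → f g • Ω s = D f η s := by
  refine ⟨fun s => if g ∈ s then 0 else kap g Ω s, fun s hs hk => ?_⟩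
  by_cases h : g ∈ s
  · obtain ⟨s', hs', rfl⟩ : ∃ s', g ∉ s' ∧ s = insert g s' :=
      ⟨s.erase g, by simp, (Finset.insert_erase h).symm⟩
    rw [D_insert _ _ hs']
    have : D f (kap g (fun s => if g ∈ s then 0 else kap g Ω s)) s' = D f (0 : Finset ℕ → M) s' := by
      apply D_congr
      intro i _
      simp [kap]
    rw [this]
    simp only [hs', if_false, map_zero, Pi.zero_apply, sub_zero, kap]
    rw [smul_comm (f g), eps_smul_smul]
  · have h1 := hΩ (insert g s) (Finset.insert_subset hg hs)
      (by rw [Finset.card_insert_of_notMem h, hk])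
    rw [D_insert _ _ h] at h1
    have h2 : f g • Ω s - D f (kap g Ω) s = 0 := by
      rw [← eps_smul_smul g s (_ - _), h1, smul_zero]
    rw [sub_eq_zero.mp h2]
    apply D_congr
    intro i _
    have : g ∉ s.erase i := fun h' => h (Finset.mem_of_mem_erase h')
    simp only [this, if_false]

lemma torsion (f : ℕ → R) (S : Finset ℕ) (k : ℕ) (Ω : Finset ℕ → M) (hΩ : Cyc f S k Ω)
    (r : R) (hr : r ∈ Ideal.span (f '' (S : Set ℕ))) :
    ∃ η : Finset ℕ → M, ∀ s ⊆ S, s.card = k → r • Ω s = D f η s := by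
  induction hr using Submodule.span_induction with
  | mem x hx =>
    obtain ⟨g, hg, rfl⟩ := hx
    exact torsion_gen f S k Ω hΩ g hg
  | zero => exact ⟨0, by simp⟩
  | add x y _ _ hx hy =>
    obtain ⟨a, ha⟩ := hx
    obtain ⟨b, hb⟩ := hy
    exact ⟨a + b, fun s hs hk => by rw [add_smul, ha s hs hk, hb s hs hk, map_add]; rfl⟩
  | smul c x _ hx =>
    obtain ⟨a, ha⟩ := hx
    exact ⟨c • a, fun s hs hk => by rw [smul_assoc, ha s hs hk, map_smul]; rfl⟩

def V (M : Type*) [AddCommGroup M] [Module R M] (h : R) (f : ℕ → R) (S : Finset ℕ) (k : ℕ) : Prop :=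
  ∀ (t : ℕ) (Ω : Finset ℕ → M), Cyc (fun i => f i ^ t) S k Ω →
    ∃ (c N : ℕ) (η : Finset ℕ → M), ∀ s ⊆ S, s.card = k →
      h ^ N • tr f c Ω s = D (fun i => f i ^ (t + c)) η s

lemma V_triv (h : R) (f : ℕ → R) (S : Finset ℕ) (k : ℕ) (hk : S.card < k) : V M h f S k := by
  intro t Ω _
  refine ⟨0, 0, 0, fun s hs hk' => ?_⟩
  have := Finset.card_le_card hs
  omega

def join (g : ℕ) (α Γ : Finset ℕ → M) : Finset ℕ → M := fun s =>
  if g ∈ s then eps g (s.erase g) • Γ (s.erase g) else α s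

lemma D_join_insert (f : ℕ → R) (g : ℕ) (α Γ : Finset ℕ → M) {s : Finset ℕ} (hg : g ∉ s) :
    D f (join g α Γ) (insert g s) = eps g s • (f g • α s - D f Γ s) := by
  rw [D_insert _ _ hg]
  congr 2
  · simp [join, hg]
  · apply D_congr
    intro i _
    have : g ∉ s.erase i := fun h' => hg (Finset.mem_of_mem_erase h')
    simp only [kap, join, Finset.mem_insert_self, if_true, Finset.erase_insert this, eps_smul_smul]

lemma D_join_of_notMem (f : ℕ → R) (g : ℕ) (α Γ : Finset ℕ → M) {s : Finset ℕ} (hg : g ∉ s) :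
    D f (join g α Γ) s = D f α s := by
  apply D_congr
  intro i _
  have : g ∉ s.erase i := fun h' => hg (Finset.mem_of_mem_erase h')
  simp [join, this]

lemma cases_insert {g : ℕ} {S s : Finset ℕ} (hs : s ⊆ insert g S) :
    (g ∉ s ∧ s ⊆ S) ∨ ∃ s', g ∉ s' ∧ s' ⊆ S ∧ s = insert g s' := by
  by_cases h : g ∈ s
  · right
    refine ⟨s.erase g, by simp, ?_, (Finset.insert_erase h).symm⟩
    intro i hi
    have := hs (Finset.mem_of_mem_erase hi)
    rw [Finset.mem_insert] at this
    exact this.resolve_left (Finset.ne_of_mem_erase hi)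
  · left
    refine ⟨h, fun i hi => ?_⟩
    have := hs hi
    rw [Finset.mem_insert] at this
    exact this.resolve_left (fun h' => h (h' ▸ hi))

lemma V_remove (h : R) (f : ℕ → R) (S : Finset ℕ) (k g : ℕ) (hg : g ∉ S)
    (hrad : ∀ t, ∃ N, f g ^ N ∈ Ideal.span ((fun i => f i ^ t) '' (S : Set ℕ)))
    (hV : V M h f (insert g S) k) : V M h f S k := by
  intro t Ω hΩ
  obtain ⟨N, hN⟩ := hrad t
  obtain ⟨η, hη⟩ := torsion _ S k Ω hΩ (f g ^ (t + N))
    (by rw [pow_add]; exact Ideal.mul_mem_left _ _ hN)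
  have hcyc : Cyc (fun i => f i ^ (t + N)) (insert g S) k (join g (tr f N Ω) (tr f N η)) := by
    intro s hs hk
    rcases cases_insert hs with ⟨h1, h2⟩ | ⟨s', h1, h2, rfl⟩
    · rw [D_join_of_notMem _ _ _ _ h1, D_tr, tr_apply, hΩ s h2 hk, smul_zero]
    · rw [Finset.card_insert_of_notMem h1] at hk
      rw [D_join_insert _ _ _ _ h1, D_tr, tr_apply, tr_apply, ← hη s' h2 (by omega),
        smul_comm, sub_self, smul_zero]
  obtain ⟨c, N', θ, hθ⟩ := hV (t + N) _ hcyc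
  refine ⟨N + c, N', θ, fun s hs hk => ?_⟩
  have hgs : g ∉ s := fun h' => hg (hs h')
  have := hθ s (hs.trans (Finset.subset_insert _ _)) hk
  rw [← add_assoc, ← this, ← tr_tr]
  congr 1
  simp [tr_apply, join, hgs]

lemma V_add (h : R) (f : ℕ → R) (S : Finset ℕ) (k g : ℕ) (hg : g ∉ S)
    (hrad : ∀ t, ∃ A B, h ^ A * f g ^ B ∈ Ideal.span ((fun i => f i ^ t) '' (S : Set ℕ)))
    (hV : V M h f S (k + 1)) : V M h f (insert g S) (k + 1) := by
  intro t Ω hΩ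
  obtain ⟨c, N, η, hη⟩ := hV t Ω (fun s hs hk => hΩ s (hs.trans (Finset.subset_insert _ _)) hk)
  set Ω1 : Finset ℕ → M := h ^ N • tr f c Ω - D (fun i => f i ^ (t + c)) η with hΩ1
  have hz : ∀ s ⊆ S, s.card = k + 1 → Ω1 s = 0 := by
    intro s hs hk
    rw [hΩ1, Pi.sub_apply, Pi.smul_apply, hη s hs hk, sub_self]
  have hc1 : Cyc (fun i => f i ^ (t + c)) (insert g S) (k + 1) Ω1 := by
    intro s hs hk
    rw [hΩ1, map_sub, map_smul, Pi.sub_apply, D_D, Pi.smul_apply, D_tr, tr_apply, hΩ s hs hk]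
    simp
  have hc2 : Cyc (fun i => f i ^ (t + c)) S k (kap g Ω1) := by
    intro s hs hk
    have hgs : g ∉ s := fun h' => hg (hs h')
    have h1 := hc1 (insert g s) (Finset.insert_subset_insert _ hs)
      (by rw [Finset.card_insert_of_notMem hgs, hk])
    rw [D_insert _ _ hgs, hz s hs hk, smul_zero, zero_sub] at h1
    have h2 : - D (fun i => f i ^ (t + c)) (kap g Ω1) s = 0 := by
      rw [← eps_smul_smul g s (- _), h1, smul_zero]
    exact neg_eq_zero.mp h2
  obtain ⟨A, B, hAB⟩ := hrad (t + c)
  obtain ⟨γ, hγ⟩ := torsion _ S k _ hc2 _ hAB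
  refine ⟨c + B, A + N, h ^ A • tr f B η - join g 0 (tr f B γ), fun s hs hk => ?_⟩
  have key : h ^ A • tr f B Ω1 s = - D (fun i => f i ^ (t + c + B)) (join g 0 (tr f B γ)) s := by
    rcases cases_insert hs with ⟨h1, h2⟩ | ⟨s', h1, h2, rfl⟩
    · rw [D_join_of_notMem _ _ _ _ h1, tr_apply, hz s h2 hk]; simp
    · rw [Finset.card_insert_of_notMem h1] at hk
      rw [D_join_insert _ _ _ _ h1, D_tr, tr_apply, tr_apply, ← hγ s' h2 (by omega), kap]
      simp only [Pi.zero_apply, smul_zero, zero_sub, smul_neg, neg_neg]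
      rw [smul_comm _ (eps g s'), smul_comm _ (eps g s'), eps_smul_smul, Finset.prod_insert h1,
        smul_smul, smul_smul]
      congr 1
      ring
  rw [← add_assoc, map_sub, map_smul, Pi.sub_apply, sub_eq_add_neg, ← key, hΩ1, map_sub, map_smul,
    tr_tr, D_tr]
  simp only [Pi.sub_apply, Pi.smul_apply, smul_sub, smul_smul, pow_add]
  abel

end Aux
end FT
namespace FT
namespace Aux

section bridge
variable {R : Type*} [CommRing R] {M : Type*} [AddCommGroup M] [Module R M]

abbrev up {n : ℕ} (s : Finset (Fin n)) : Finset ℕ := s.map Fin.valEmbedding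

def res (n k : ℕ) (Ω : Finset ℕ → M) : KC n M k := fun s => Ω (up s.1)

open Classical in
noncomputable def lift {n k : ℕ} (ω : KC n M k) : Finset ℕ → M := fun S =>
  if h : ((Finset.univ : Finset (Fin n)).filter (fun l : Fin n => (l : ℕ) ∈ S)).card = k
  then ω ⟨_, h⟩ else 0

lemma filter_up {n : ℕ} (s : Finset (Fin n)) :
    ((Finset.univ : Finset (Fin n)).filter (fun l : Fin n => (l : ℕ) ∈ up s)) = s := by
  ext l
  simp [up, Fin.val_inj]

lemma res_lift {n k : ℕ} (ω : KC n M k) : res n k (lift ω) = ω := by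
  funext s
  obtain ⟨s, hs⟩ := s
  unfold res lift
  have h := filter_up s
  have h2 : ((Finset.univ : Finset (Fin n)).filter (fun l : Fin n => (l : ℕ) ∈ up s)).card = k := by
    rw [h]; exact hs
  have h3 : (⟨_, h2⟩ : {s : Finset (Fin n) // s.card = k}) = ⟨s, hs⟩ := Subtype.ext h
  rw [dif_pos h2]
  exact congrArg ω h3

lemma exists_up {n : ℕ} {S : Finset ℕ} (hS : S ⊆ Finset.range n) :
    ∃ s : Finset (Fin n), S = up s := by
  refine ⟨Finset.univ.filter (fun l : Fin n => (l : ℕ) ∈ S), ?_⟩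
  ext i
  simp only [up, Finset.mem_map, Finset.mem_filter, Finset.mem_univ, true_and,
    Fin.valEmbedding_apply]
  constructor
  · intro hi
    exact ⟨⟨i, Finset.mem_range.mp (hS hi)⟩, hi, rfl⟩
  · rintro ⟨l, hl, rfl⟩; exact hl

lemma up_subset {n : ℕ} (s : Finset (Fin n)) : up s ⊆ Finset.range n := by
  intro i hi
  simp only [up, Finset.mem_map, Fin.valEmbedding_apply] at hi
  obtain ⟨l, _, rfl⟩ := hi
  simp

lemma up_erase {n : ℕ} (s : Finset (Fin n)) (i : Fin n) : up (s.erase i) = (up s).erase i := by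
  simp [up, Finset.map_erase]

lemma eps_up {n : ℕ} (s : Finset (Fin n)) (i : Fin n) :
    eps i (up s) = (-1) ^ (s.filter (fun j => j < i)).card := by
  unfold eps up
  rw [Finset.filter_map, Finset.card_map]
  rfl

lemma kd_apply {n : ℕ} (f : Fin n → R) (k : ℕ) (ω : KC n M k) (s) :
    kd M f k ω s = ∑ i ∈ s.1.attach,
    ((-1 : ℤ) ^ (s.1.filter (fun j => j < i.1)).card) •
      (f i.1 • ω ⟨s.1.erase i.1, by simp [Finset.card_erase_of_mem i.2, s.2]⟩) := rfl

lemma kd_res {n : ℕ} (F : ℕ → R) (k : ℕ) (Ω : Finset ℕ → M) :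
    kd M (fun l : Fin n => F l) k (res n k Ω) = res n (k + 1) (D F Ω) := by
  funext s
  rw [kd_apply, res, D_apply, up, Finset.sum_map, ← Finset.sum_attach s.1]
  refine Finset.sum_congr rfl fun i _ => ?_
  simp only [Fin.valEmbedding_apply]
  rw [← up, eps_up, ← up_erase]
  rfl

lemma ktr_res {n : ℕ} (F : ℕ → R) (c k : ℕ) (Ω : Finset ℕ → M) :
    ktr M (fun l : Fin n => F l) c k (res n k Ω) = res n k (tr F c Ω) := by
  funext s
  simp [ktr, res, tr_apply, up, Finset.prod_map]

def ext0 {n : ℕ} (x : Fin n → R) (y : ℕ → R) : ℕ → R :=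
  fun i => if h : i < n then x ⟨i, h⟩ else y (i - n)

lemma ext0_val {n : ℕ} (x : Fin n → R) (y : ℕ → R) (l : Fin n) : ext0 x y l = x l := by
  simp [ext0]

lemma ext0_comp {n : ℕ} (x : Fin n → R) (y : ℕ → R) : (fun l : Fin n => ext0 x y l) = x :=
  funext fun l => ext0_val x y l

lemma ext0_pow {n : ℕ} (x : Fin n → R) (y : ℕ → R) (t : ℕ) :
    (fun l : Fin n => ext0 x y l ^ t) = fun l => x l ^ t := by
  funext l; rw [ext0_val]

lemma kd_kd {n : ℕ} (x : Fin n → R) (k : ℕ) (ω : KC n M k) :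
    kd M x (k + 1) (kd M x k ω) = 0 := by
  rw [← res_lift ω, ← ext0_comp x 0, kd_res, kd_res]
  funext s
  simp [res, D_D]

lemma kd_ktr {n : ℕ} (x : Fin n → R) (t c k : ℕ) (ω : KC n M k) :
    kd M (fun l => x l ^ (t + c)) k (ktr M x c k ω) =
      ktr M x c (k + 1) (kd M (fun l => x l ^ t) k ω) := by
  rw [← res_lift ω, ← ext0_comp x 0, ktr_res, kd_res (fun i => ext0 x 0 i ^ (t + c)),
    kd_res (fun i => ext0 x 0 i ^ t), ktr_res, D_tr]

lemma mem_pow_span_of {f : ℕ → R} {S : Finset ℕ} {r : R}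
    (hr : r ∈ (Ideal.span (f '' (S : Set ℕ))).radical) (t : ℕ) :
    ∃ N, r ^ N ∈ Ideal.span ((fun i => f i ^ t) '' (S : Set ℕ)) := by
  have h : Ideal.span (f '' (S : Set ℕ)) ≤
      (Ideal.span ((fun i => f i ^ t) '' (S : Set ℕ))).radical := by
    rw [Ideal.span_le]
    rintro _ ⟨i, hi, rfl⟩
    exact ⟨t, Ideal.subset_span ⟨i, hi, rfl⟩⟩
  exact (Ideal.radical_le_radical_iff.mpr h) hr

lemma exists_params [IsNoetherianRing R] (m : Ideal R) [m.IsPrime] (d : ℕ) (hd : m.height ≤ d)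
    {n : ℕ} (x : Fin n → R) (hx : ∀ l, x l ∈ m) :
    ∃ (r : ℕ) (y : ℕ → R) (h : R), r ≤ d ∧ h ∉ m ∧ (∀ i < r, y i ∈ m) ∧
      ∀ l, h * x l ∈ (Ideal.span (y '' (Finset.range r : Set ℕ))).radical := by
  obtain ⟨Y, hY, hcard⟩ := Ideal.exists_finset_card_eq_height_of_isNoetherianRing m
  have hr : Y.card ≤ d := by
    rw [← hcard] at hd
    exact_mod_cast hd
  let y : ℕ → R := fun i => if h : i < Y.card then (Y.equivFin.symm ⟨i, h⟩ : R) else 0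
  have hy : y '' (Finset.range Y.card : Set ℕ) = Y := by
    ext r
    constructor
    · rintro ⟨i, hi, rfl⟩
      simp only [Finset.coe_range, Set.mem_Iio] at hi
      simp [y, hi]
    · intro hr
      refine ⟨Y.equivFin ⟨r, hr⟩, by simp, ?_⟩
      simp [y]
  have key : ∀ l, ∃ h : R, h ∉ m ∧ h * x l ∈ (Ideal.span (Y : Set R)).radical := by
    intro l
    have hnd : ¬ Disjoint ((Ideal.span (Y : Set R) : Ideal R) : Set R)
        ((m.primeCompl ⊔ Submonoid.powers (x l) : Submonoid R) : Set R) := by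
      intro hdis
      obtain ⟨P, hP, hIP, hPd⟩ := Ideal.exists_le_prime_disjoint _ _ hdis
      have hPm : P ≤ m := by
        intro z hz
        by_contra hzm
        exact Set.disjoint_left.mp hPd hz (Submonoid.mem_sup_left (S := m.primeCompl) hzm)
      have hmP : m ≤ P := hY.2 ⟨hP, hIP⟩ hPm
      exact Set.disjoint_left.mp hPd (hmP (hx l))
        (Submonoid.mem_sup_right (Submonoid.mem_powers (x l)))
    obtain ⟨z, hz1, hz2⟩ := Set.not_disjoint_iff.mp hnd
    obtain ⟨h, hh, w, ⟨N, rfl⟩, rfl⟩ := Submonoid.mem_sup.mp hz2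
    refine ⟨h, hh, N + 1, ?_⟩
    have e : (h * x l) ^ (N + 1) = (h ^ N * x l) * (h * x l ^ N) := by ring
    rw [e]
    exact Ideal.mul_mem_left _ _ hz1
  choose h hh1 hh2 using key
  refine ⟨Y.card, y, ∏ l, h l, hr, ?_, ?_, ?_⟩
  · rw [Ideal.IsPrime.prod_mem_iff]
    rintro ⟨l, _, hl⟩
    exact hh1 l hl
  · intro i hi
    apply hY.1.2
    apply Ideal.subset_span
    rw [← hy]
    exact ⟨i, by simpa using hi, rfl⟩
  · intro l
    rw [hy, ← Finset.mul_prod_erase _ _ (Finset.mem_univ l), mul_right_comm]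
    exact Ideal.mul_mem_right _ _ (hh2 l)

lemma vanish [IsNoetherianRing R] (m : Ideal R) [m.IsMaximal] (d : ℕ) (hd : m.height ≤ d)
    {n : ℕ} (x : Fin n → R) (hx : Ideal.span (Set.range x) = m) (t : ℕ)
    (ξ : KC n M (d + 1)) (hξ : kd M (fun l => x l ^ t) (d + 1) ξ = 0) :
    ∃ (c : ℕ) (η : KC n M d), ktr M x c (d + 1) ξ = kd M (fun l => x l ^ (t + c)) d η := by
  have hxm : ∀ l, x l ∈ m := fun l => hx ▸ Ideal.subset_span ⟨l, rfl⟩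
  obtain ⟨r, y, h, hr, hhm, hym, hrad⟩ := exists_params m d hd x hxm
  set f := ext0 x y with hf
  have fx : ∀ (i : ℕ) (hi : i < n), f i = x ⟨i, hi⟩ := fun i hi => by simp [hf, ext0, hi]
  have fy : ∀ i, f (n + i) = y i := fun i => by simp [hf, ext0]
  -- step 1
  have s1 : ∀ k ≤ n, V M h f (Finset.range k ∪ Finset.Ico n (n + r)) (d + 1) := by
    intro k
    induction k with
    | zero => intro _; exact V_triv _ _ _ _ (by simp; omega)
    | succ k ih =>
      intro hk
      rw [Finset.range_add_one, Finset.insert_union]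
      refine V_add h f _ d k ?_ ?_ (ih (by omega))
      · simp; omega
      · intro t
        have : h * f k ∈ (Ideal.span (f '' ((Finset.range k ∪ Finset.Ico n (n + r) :
            Finset ℕ) : Set ℕ))).radical := by
          rw [fx k (by omega)]
          refine Ideal.radical_mono ?_ (hrad ⟨k, by omega⟩)
          apply Ideal.span_mono
          rintro _ ⟨i, hi, rfl⟩
          rw [← fy]
          refine ⟨n + i, ?_, rfl⟩
          simp at hi ⊢
          omega
        obtain ⟨N, hN⟩ := mem_pow_span_of this t
        exact ⟨N, N, by rwa [mul_pow] at hN⟩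
  have himg : f '' (Finset.range n : Set ℕ) = Set.range x := by
    ext z
    constructor
    · rintro ⟨i, hi, rfl⟩
      have hi : i < n := by simpa using hi
      exact ⟨⟨i, hi⟩, (fx i hi).symm⟩
    · rintro ⟨l, rfl⟩
      exact ⟨l, by simp, ext0_val x y l⟩
  have s2 : ∀ k ≤ r, V M h f (Finset.range n ∪ Finset.Ico n (n + k)) (d + 1) →
      V M h f (Finset.range n) (d + 1) := by
    intro k
    induction k with
    | zero => intro _ h; simpa using h
    | succ k ih =>
      intro hk hV
      refine ih (by omega) ?_
      refine V_remove h f _ (d + 1) (n + k) (by simp) ?_ ?_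
      · intro t
        refine mem_pow_span_of ?_ t
        apply Ideal.le_radical
        rw [fy]
        have h1 := hym k (by omega)
        rw [← hx, ← himg] at h1
        refine Ideal.span_mono ?_ h1
        apply Set.image_mono
        intro i hi
        simp at hi ⊢
        omega
      · convert hV using 1
        ext i
        simp; omega
  have s3 := s2 r le_rfl (s1 n le_rfl)
  set Ω : Finset ℕ → M := lift ξ with hΩ
  have hc : Cyc (fun i => f i ^ t) (Finset.range n) (d + 1) Ω := by
    intro S hS hk
    obtain ⟨s, rfl⟩ := exists_up hS
    have h1 := hξ
    rw [← res_lift ξ, ← ext0_pow x y, kd_res (fun i => ext0 x y i ^ t)] at h1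
    have := congrFun h1 ⟨s, by simpa using hk⟩
    simpa [res] using this
  obtain ⟨c, N, η, hη⟩ := s3 t Ω hc
  have hctr : Cyc (fun i => f i ^ (t + c)) (Finset.range n) (d + 1) (tr f c Ω) := by
    intro s hs hk
    rw [D_tr, tr_apply, hc s hs hk, smul_zero]
  -- comaximality
  obtain ⟨a, b, hb, hab⟩ : ∃ a b : R,
      b ∈ Ideal.span ((fun i => f i ^ (t + c)) '' (Finset.range n : Set ℕ)) ∧
      a * h ^ N + b = 1 := by
    have h1 : Ideal.span {h ^ N} ⊔
        Ideal.span ((fun i => f i ^ (t + c)) '' (Finset.range n : Set ℕ)) = ⊤ := by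
      by_contra hne
      obtain ⟨P, hP, hle⟩ := Ideal.exists_le_maximal _ hne
      have hmP : m ≤ P := by
        rw [← hx, ← himg, Ideal.span_le]
        rintro _ ⟨i, hi, rfl⟩
        apply hP.isPrime.mem_of_pow_mem (t + c)
        apply hle
        exact Ideal.mem_sup_right (Ideal.subset_span ⟨i, hi, rfl⟩)
      have : m = P := Ideal.IsMaximal.eq_of_le inferInstance hP.ne_top hmP
      apply hhm
      rw [this]
      apply hP.isPrime.mem_of_pow_mem N
      exact hle (Ideal.mem_sup_left (Ideal.subset_span rfl))
    have h2 : (1 : R) ∈ Ideal.span {h ^ N} ⊔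
        Ideal.span ((fun i => f i ^ (t + c)) '' (Finset.range n : Set ℕ)) := by rw [h1]; trivial
    obtain ⟨u, hu, b, hb, hub⟩ := Submodule.mem_sup.mp h2
    obtain ⟨a, rfl⟩ := Ideal.mem_span_singleton'.mp hu
    exact ⟨a, b, hb, hub⟩
  obtain ⟨θ, hθ⟩ := torsion _ _ _ _ hctr b hb
  refine ⟨c, res n d (a • η + θ), ?_⟩
  rw [← res_lift ξ, ← ext0_pow x y, kd_res (fun i => ext0 x y i ^ (t + c))]
  conv_lhs => rw [← ext0_comp x y]
  rw [ktr_res]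
  funext s
  have hs1 := up_subset s.1
  have hs2 : (up s.1).card = d + 1 := by simp [s.2]
  have e1 := hη _ hs1 hs2
  have e2 := hθ _ hs1 hs2
  simp only [res, map_add, map_smul, Pi.add_apply, Pi.smul_apply]
  rw [← hf, ← e1, ← e2, smul_smul, ← add_smul, hab, one_smul]

end bridge
end Aux
end FT
namespace FT
namespace Aux

section kdmaps
variable {R : Type*} [CommRing R]

lemma kd_map {M M' : Type*} [AddCommGroup M] [Module R M] [AddCommGroup M'] [Module R M']
    {n : ℕ} (φ ψ : M →+ M') (f f' : Fin n → R) (h : ∀ l m, ψ (f l • m) = f' l • φ m)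
    (k : ℕ) (ω : KC n M k) (s) :
    kd M' f' k (fun s => φ (ω s)) s = ψ (kd M f k ω s) := by
  rw [kd_apply, kd_apply, map_sum]
  refine Finset.sum_congr rfl fun i _ => ?_
  rw [map_zsmul, h]

lemma ktr_apply {M : Type*} [AddCommGroup M] [Module R M] {n : ℕ} (f : Fin n → R) (c k : ℕ)
    (ω : KC n M k) (s) : ktr M f c k ω s = (∏ i ∈ s.1, f i) ^ c • ω s := rfl

lemma ktr_ktr {M : Type*} [AddCommGroup M] [Module R M] {n : ℕ} (f : Fin n → R) (c c' k : ℕ)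
    (ω : KC n M k) : ktr M f c k (ktr M f c' k ω) = ktr M f (c' + c) k ω := by
  funext s
  simp only [ktr_apply, smul_smul]
  congr 1; ring

lemma B_ktr {n : ℕ} (x : Fin n → R) (t c : ℕ) (d : ℕ) (ω : KC n R d)
    (h : ω ∈ koszulB R (fun l => x l ^ t) d) :
    ktr R x c d ω ∈ koszulB R (fun l => x l ^ (t + c)) d := by
  cases d with
  | zero =>
    have : ω = 0 := h
    rw [this, map_zero]; exact Submodule.zero_mem _
  | succ d =>
    obtain ⟨η, rfl⟩ := h
    exact ⟨ktr R x c d η, kd_ktr x t c d η⟩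

def Van {n : ℕ} (x : Fin n → R) (t d : ℕ) (ω : KC n R d) : Prop :=
  ∃ c, ktr R x c d ω ∈ koszulB R (fun l => x l ^ (t + c)) d

lemma Van_zero {n : ℕ} (x : Fin n → R) (t d : ℕ) : Van x t d (0 : KC n R d) :=
  ⟨0, by rw [map_zero]; exact Submodule.zero_mem _⟩

lemma Van_add {n : ℕ} (x : Fin n → R) (t d : ℕ) (ω ω' : KC n R d) (h : Van x t d ω)
    (h' : Van x t d ω') : Van x t d (ω + ω') := by
  obtain ⟨c, hc⟩ := h
  obtain ⟨c', hc'⟩ := h'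
  refine ⟨c + c', ?_⟩
  rw [map_add]
  refine Submodule.add_mem _ ?_ ?_
  · have := B_ktr x (t + c) c' d _ hc
    rwa [ktr_ktr, add_assoc] at this
  · have := B_ktr x (t + c') c d _ hc'
    rwa [ktr_ktr, add_assoc, add_comm c' c] at this

lemma Van_of_ktr {n : ℕ} (x : Fin n → R) (t c d : ℕ) (ω : KC n R d)
    (h : Van x (t + c) d (ktr R x c d ω)) : Van x t d ω := by
  obtain ⟨c', hc'⟩ := h
  refine ⟨c + c', ?_⟩
  rwa [ktr_ktr, add_assoc] at hc'

/-- `r ↦ g * r ^ (p ^ e)` as an additive map. -/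
noncomputable def mf (p e : ℕ) [ExpChar R p] (g : R) : R →+ R :=
  (AddMonoidHom.mulLeft g).comp (iterateFrobenius R p e).toAddMonoidHom

lemma mf_apply (p e : ℕ) [ExpChar R p] (g r : R) : mf p e g r = g * r ^ p ^ e := by
  simp [mf, iterateFrobenius_def]

lemma Van_frob {n : ℕ} (x : Fin n → R) (t d p e : ℕ) [ExpChar R p] (g : R)
    (ω : KC n R d) (h : Van x t d ω) :
    Van x (p ^ e * t) d (fun s => mf p e g (ω s)) := by
  obtain ⟨c, hc⟩ := h
  refine ⟨p ^ e * c, ?_⟩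
  have e1 : ktr R x (p ^ e * c) d (fun s => mf p e g (ω s)) =
      fun s => mf p e g (ktr R x c d ω s) := by
    funext s
    simp only [ktr_apply, mf_apply, smul_eq_mul]
    rw [mul_pow, ← pow_mul, mul_comm c]; ring
  rw [e1, ← mul_add]
  generalize ktr R x c d ω = ω' at hc
  generalize t + c = t' at hc
  cases d with
  | zero =>
    have h0 : ω' = 0 := hc
    have : (fun s => mf p e g (ω' s)) = 0 := by
      funext s; rw [h0]; simp
    rw [this]; exact Submodule.zero_mem _
  | succ d =>
    obtain ⟨η, rfl⟩ := hc
    refine ⟨fun s => mf p e g (η s), ?_⟩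
    funext s
    apply kd_map
    intro l m
    simp only [mf_apply, smul_eq_mul]
    rw [mul_pow, ← pow_mul, mul_comm t']; ring

end kdmaps

section graded
variable {K R : Type*} [Field K] [CommRing R] [Algebra K R]
variable (𝒜 : ℕ → Submodule K R) [GradedAlgebra 𝒜]

noncomputable abbrev pr (i : ℕ) : R →+ R := GradedRing.proj 𝒜 i

lemma pr_same {i : ℕ} {r : R} (h : r ∈ 𝒜 i) : pr 𝒜 i r = r :=
  DirectSum.decompose_of_mem_same _ h

lemma pr_ne {i j : ℕ} {r : R} (h : r ∈ 𝒜 i) (hij : i ≠ j) : pr 𝒜 j r = 0 :=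
  DirectSum.decompose_of_mem_ne _ h hij

lemma pr_mem (i : ℕ) (r : R) : pr 𝒜 i r ∈ 𝒜 i := SetLike.coe_mem _

variable {𝒜}

lemma span_ind (h : IsStandardGraded K R 𝒜) (P : R → Prop) (h0 : P 0)
    (hadd : ∀ a b, P a → P b → P (a + b))
    (hm : ∀ k, ∀ z ∈ 𝒜 k, z ∈ irrIdeal 𝒜 ^ k → P z) (r : R) : P r := by
  have hr : r ∈ Submodule.span K (Submonoid.closure ((𝒜 1 : Submodule K R) : Set R) : Set R) := by
    rw [← Algebra.adjoin_eq_span, h.gen1]; trivial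
  have key : ∀ z ∈ Submonoid.closure ((𝒜 1 : Submodule K R) : Set R),
      ∃ k, z ∈ 𝒜 k ∧ z ∈ irrIdeal 𝒜 ^ k := by
    intro z hz
    induction hz using Submonoid.closure_induction with
    | mem z hz => exact ⟨1, hz, by rw [pow_one]; exact Ideal.subset_span hz⟩
    | one => exact ⟨0, SetLike.one_mem_graded 𝒜, by simp⟩
    | mul a b _ _ ha hb =>
      obtain ⟨k, h1, h2⟩ := ha
      obtain ⟨l, h3, h4⟩ := hb
      exact ⟨k + l, SetLike.mul_mem_graded h1 h3, by rw [pow_add]; exact Ideal.mul_mem_mul h2 h4⟩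
  induction hr using Submodule.closure_induction with
  | zero => exact h0
  | add a b _ _ ha hb => exact hadd a b ha hb
  | smul_mem c z hz =>
    obtain ⟨k, h1, h2⟩ := key z hz
    exact hm k _ (Submodule.smul_mem _ _ h1) (by
      rw [Algebra.smul_def]; exact Ideal.mul_mem_left _ _ h2)

lemma pr_mem_pow (h : IsStandardGraded K R 𝒜) (D : ℕ) (r : R) : pr 𝒜 D r ∈ irrIdeal 𝒜 ^ D := by
  refine span_ind h (fun r => pr 𝒜 D r ∈ irrIdeal 𝒜 ^ D) ?_ ?_ ?_ r
  · simp
  · intro a b ha hb; rw [map_add]; exact Ideal.add_mem _ ha hb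
  · intro k z hz hzk
    by_cases hk : k = D
    · subst hk; rwa [pr_same 𝒜 hz]
    · rw [pr_ne 𝒜 hz hk]; exact Ideal.zero_mem _

lemma sub_pr_zero_mem (h : IsStandardGraded K R 𝒜) (r : R) : r - pr 𝒜 0 r ∈ irrIdeal 𝒜 := by
  refine span_ind h (fun r => r - pr 𝒜 0 r ∈ irrIdeal 𝒜) ?_ ?_ ?_ r
  · simp
  · intro a b ha hb
    have := Ideal.add_mem _ ha hb
    rw [map_add]
    convert this using 1
    ring
  · intro k z hz hzk
    by_cases hk : k = 0
    · subst hk; rw [pr_same 𝒜 hz, sub_self]; exact Ideal.zero_mem _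
    · rw [pr_ne 𝒜 hz hk, sub_zero]; exact Ideal.pow_le_self hk hzk

lemma pr_zero_of_mem {r : R} (hr : r ∈ irrIdeal 𝒜) : pr 𝒜 0 r = 0 := by
  have : irrIdeal 𝒜 ≤ RingHom.ker (GradedRing.projZeroRingHom 𝒜) := by
    rw [irrIdeal, Ideal.span_le]
    intro z hz
    exact pr_ne 𝒜 hz (by norm_num)
  exact this hr

lemma irr_max [Nontrivial R] (h : IsStandardGraded K R 𝒜) : (irrIdeal 𝒜).IsMaximal := by
  rw [Ideal.isMaximal_iff]
  refine ⟨fun h1 => ?_, fun J r hJ hr hrJ => ?_⟩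
  · have := pr_zero_of_mem h1
    rw [pr_same 𝒜 (SetLike.one_mem_graded 𝒜)] at this
    exact one_ne_zero this
  · have h1 := sub_pr_zero_mem h r
    have h2 := pr_mem 𝒜 0 r
    rw [h.deg0] at h2
    obtain ⟨k, hk⟩ := Submodule.mem_one.mp h2
    have hk0 : k ≠ 0 := by
      rintro rfl
      rw [map_zero] at hk
      rw [← hk, sub_zero] at h1
      exact hr h1
    have h3 : algebraMap K R k ∈ J := by
      rw [hk]
      have := J.sub_mem hrJ (hJ h1)
      simpa using this
    have h4 := J.mul_mem_left (algebraMap K R k⁻¹) h3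
    rwa [← map_mul, inv_mul_cancel₀ hk0, map_one] at h4

lemma noeth (h : IsStandardGraded K R 𝒜) : IsNoetherianRing R := by
  obtain ⟨S, hS⟩ := h.fg1
  have : Algebra.FiniteType K R := ⟨⟨S, by
    rw [← h.gen1, ← hS, Algebra.adjoin_span]⟩⟩
  exact Algebra.FiniteType.isNoetherianRing K R

lemma pr_pow (p e : ℕ) [ExpChar R p] (n : ℕ) (r : R) :
    pr 𝒜 n (r ^ p ^ e) = if p ^ e ∣ n then (pr 𝒜 (n / p ^ e) r) ^ p ^ e else 0 := by
  have hq : 0 < p ^ e := pow_pos (expChar_pos R p) e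
  induction r using DirectSum.Decomposition.inductionOn 𝒜 with
  | zero => simp [zero_pow hq.ne']
  | homogeneous a =>
    rename_i i
    have ha : (a : R) ^ p ^ e ∈ 𝒜 (p ^ e * i) := by
      have := SetLike.pow_mem_graded (p ^ e) a.2
      simpa using this
    split_ifs with hd
    · obtain ⟨k, rfl⟩ := hd
      rw [Nat.mul_div_cancel_left _ hq]
      by_cases hk : i = k
      · subst hk; rw [pr_same 𝒜 ha, pr_same 𝒜 a.2]
      · rw [pr_ne 𝒜 a.2 hk, pr_ne 𝒜 ha, zero_pow hq.ne']
        intro h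
        exact hk (Nat.eq_of_mul_eq_mul_left hq h)
    · rw [pr_ne 𝒜 ha]
      rintro rfl
      exact hd ⟨_, rfl⟩
  | add a b ha hb =>
    rw [add_pow_expChar_pow, map_add, ha, hb]
    split_ifs
    · rw [map_add, add_pow_expChar_pow]
    · simp

/-- generators -/
abbrev HG (𝒜 : ℕ → Submodule K R) (ν : ℕ) : Type _ := {g : R // ∃ γ ≤ ν, g ∈ 𝒜 γ}

noncomputable def piF (𝒜 : ℕ → Submodule K R) (ν p e : ℕ) [ExpChar R p] : (HG 𝒜 ν →₀ R) →+ R :=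
  Finsupp.liftAddHom (fun g => mf p e g.1)

lemma piF_apply (ν p e : ℕ) [ExpChar R p] (c : HG 𝒜 ν →₀ R) :
    piF 𝒜 ν p e c = c.sum (fun g r => g.1 * r ^ p ^ e) := by
  rw [piF, Finsupp.liftAddHom_apply]
  exact Finsupp.sum_congr fun g _ => mf_apply _ _ _ _

lemma piF_smul (ν p e : ℕ) [ExpChar R p] (r : R) (c : HG 𝒜 ν →₀ R) :
    piF 𝒜 ν p e (r • c) = r ^ p ^ e * piF 𝒜 ν p e c := by
  have hq : 0 < p ^ e := pow_pos (expChar_pos R p) e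
  rw [piF_apply, piF_apply, Finsupp.sum_smul_index (by simp [zero_pow hq.ne']), Finsupp.mul_sum]
  refine Finsupp.sum_congr fun g _ => ?_
  rw [mul_pow]; ring

lemma frobPow_le (p e : ℕ) [ExpChar R p] : frobeniusPower (irrIdeal 𝒜) (p ^ e) ≤
    Ideal.span ((fun z : R => z ^ p ^ e) '' ((𝒜 1 : Submodule K R) : Set R)) := by
  have hq : 0 < p ^ e := pow_pos (expChar_pos R p) e
  rw [frobeniusPower, Ideal.span_le]
  rintro _ ⟨z, hz', rfl⟩
  have hz : z ∈ Ideal.span ((𝒜 1 : Submodule K R) : Set R) := hz'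
  clear hz'
  simp only [SetLike.mem_coe]
  induction hz using Submodule.span_induction with
  | mem z hz => exact Ideal.subset_span ⟨z, hz, rfl⟩
  | zero => rw [zero_pow hq.ne']; exact Ideal.zero_mem _
  | add a b _ _ ha hb => rw [add_pow_expChar_pow]; exact Ideal.add_mem _ ha hb
  | smul c a _ ha => rw [smul_eq_mul, mul_pow]; exact Ideal.mul_mem_left _ _ ha

lemma piF_surj (h : IsStandardGraded K R 𝒜) (ν p e : ℕ) [ExpChar R p]
    (hν : irrIdeal 𝒜 ^ (ν + 1) ≤ frobeniusPower (irrIdeal 𝒜) (p ^ e)) (r : R) :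
    r ∈ (piF 𝒜 ν p e).range := by
  have hq : 0 < p ^ e := pow_pos (expChar_pos R p) e
  have main : ∀ D, ∀ r, pr 𝒜 D r ∈ (piF 𝒜 ν p e).range := by
    intro D
    induction D using Nat.strong_induction_on with
    | _ D ih =>
      intro r
      by_cases hD : D ≤ ν
      · refine ⟨Finsupp.single ⟨pr 𝒜 D r, D, hD, pr_mem 𝒜 D r⟩ 1, ?_⟩
        rw [piF_apply, Finsupp.sum_single_index (by simp [zero_pow hq.ne'])]
        simp
      · have h1 : pr 𝒜 D r ∈ Ideal.span
            ((fun z : R => z ^ p ^ e) '' ((𝒜 1 : Submodule K R) : Set R)) :=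
          frobPow_le p e (hν (Ideal.pow_le_pow_right (by omega) (pr_mem_pow h D r)))
        have h2 : ∀ w ∈ Ideal.span ((fun z : R => z ^ p ^ e) '' ((𝒜 1 : Submodule K R) : Set R)),
            ∀ u, pr 𝒜 D (u * w) ∈ (piF 𝒜 ν p e).range := by
          intro w hw
          induction hw using Submodule.span_induction with
          | mem w hw =>
            obtain ⟨z, hz, rfl⟩ := hw
            intro u
            have hzq : z ^ p ^ e ∈ 𝒜 (p ^ e) := by
              have := SetLike.pow_mem_graded (p ^ e) hz
              simpa using this
            by_cases hle : p ^ e ≤ D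
            · have e1 : pr 𝒜 D (u * z ^ p ^ e) = pr 𝒜 (D - p ^ e) u * z ^ p ^ e :=
                DirectSum.coe_decompose_mul_of_right_mem_of_le 𝒜 hzq hle
              obtain ⟨c, hc⟩ := ih (D - p ^ e) (by omega) u
              refine ⟨z • c, ?_⟩
              rw [piF_smul, hc, e1, mul_comm]
            · have e1 : pr 𝒜 D (u * z ^ p ^ e) = 0 :=
                DirectSum.coe_decompose_mul_of_right_mem_of_not_le 𝒜 hzq hle
              rw [e1]; exact zero_mem _
          | zero => intro u; simp
          | add a b _ _ ha hb =>
            intro u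
            rw [mul_add, map_add]; exact add_mem (ha u) (hb u)
          | smul c a _ ha =>
            intro u
            rw [smul_eq_mul, ← mul_assoc]; exact ha _
        have h3 := h2 _ h1 1
        rwa [one_mul, pr_same 𝒜 (pr_mem 𝒜 D r)] at h3
  induction r using DirectSum.Decomposition.inductionOn 𝒜 with
  | zero => exact zero_mem _
  | homogeneous a =>
    rename_i i
    have := main i (a : R)
    rwa [pr_same 𝒜 a.2] at this
  | add a b ha hb => exact add_mem ha hb

end graded
end Aux
end FT
namespace FT
namespace Aux

section final
variable {K R : Type*} [Field K] [CommRing R] [Algebra K R]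
variable {𝒜 : ℕ → Submodule K R} [GradedAlgebra 𝒜]

lemma zdeg_mul {i : ℕ} {j : ℤ} {u v : R} (hu : u ∈ 𝒜 i) (hv : v ∈ zdeg 𝒜 j) :
    u * v ∈ zdeg 𝒜 (j + i) := by
  unfold zdeg at hv ⊢
  by_cases hj : 0 ≤ j
  · rw [if_pos hj] at hv
    rw [if_pos (by omega)]
    have := SetLike.mul_mem_graded hu hv
    convert this using 2
    omega
  · rw [if_neg hj] at hv
    rw [(Submodule.mem_bot K).mp hv, mul_zero]
    exact Submodule.zero_mem _

lemma deg_ktr {n : ℕ} (x : Fin n → R) (hx : ∀ l, x l ∈ 𝒜 1) (t c k : ℕ) (j : ℤ)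
    (ω : KC n R k) (h : KCdeg 𝒜 t k j ω) : KCdeg 𝒜 (t + c) k j (ktr R x c k ω) := by
  intro s
  rw [ktr_apply, smul_eq_mul]
  have h1 : ∏ i ∈ s.1, x i ∈ 𝒜 k := by
    have := SetLike.prod_mem_graded (A := 𝒜) (i := fun _ : Fin n => 1) (g := x) (F := s.1) (fun l _ => hx l)
    simpa [s.2] using this
  have h2 : (∏ i ∈ s.1, x i) ^ c ∈ 𝒜 (c * k) := by
    have := SetLike.pow_mem_graded c h1
    simpa using this
  have := zdeg_mul h2 (h s)
  convert this using 2
  push_cast; ring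

/-- component -/
noncomputable def cmp (𝒜 : ℕ → Submodule K R) [GradedAlgebra 𝒜] (q D γ : ℕ) (r : R) : R :=
  if γ ≤ D ∧ q ∣ D - γ then pr 𝒜 ((D - γ) / q) r else 0

lemma pr_mul_pow (p e : ℕ) [ExpChar R p] (D γ : ℕ) (g r : R) (hg : g ∈ 𝒜 γ) :
    pr 𝒜 D (g * r ^ p ^ e) = g * cmp 𝒜 (p ^ e) D γ r ^ p ^ e := by
  have hq : 0 < p ^ e := pow_pos (expChar_pos R p) e
  unfold cmp
  by_cases hle : γ ≤ D
  · have e1 : pr 𝒜 D (g * r ^ p ^ e) = g * pr 𝒜 (D - γ) (r ^ p ^ e) :=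
      DirectSum.coe_decompose_mul_of_left_mem_of_le 𝒜 hg hle
    rw [e1, pr_pow]
    by_cases hd : p ^ e ∣ D - γ
    · simp [hle, hd]
    · simp [hle, hd, zero_pow hq.ne']
  · have e1 : pr 𝒜 D (g * r ^ p ^ e) = 0 :=
      DirectSum.coe_decompose_mul_of_left_mem_of_not_le 𝒜 hg hle
    rw [e1]; simp [hle, zero_pow hq.ne']

lemma key (hSG : IsStandardGraded K R 𝒜) [IsNoetherianRing R] [(irrIdeal 𝒜).IsMaximal]
    (p e : ℕ) [ExpChar R p] (ν : ℕ)
    (hν : irrIdeal 𝒜 ^ (ν + 1) ≤ frobeniusPower (irrIdeal 𝒜) (p ^ e))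
    (d : ℕ) (hd : (irrIdeal 𝒜).height ≤ d) (a : ℤ) (ha : ∀ j, lcNonzero K R 𝒜 d j → j ≤ a)
    {n : ℕ} (x : Fin n → R) (hx : ∀ l, x l ∈ 𝒜 1)
    (hspan : Ideal.span (Set.range x) = irrIdeal 𝒜) (t : ℕ) (ht : 0 < t) (ω : KC n R d)
    (hZ : ω ∈ koszulZ R (fun l => x l ^ t) d) (hdeg : KCdeg 𝒜 t d a ω)
    (hnon : ¬ Van x t d ω) : a ≤ ν + (p : ℤ) ^ e * a := by
  have hq : 0 < p ^ e := pow_pos (expChar_pos R p) e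
  set q := p ^ e with hqdef
  have hqt : t + (q * t - t) = q * t := by
    have : 1 * t ≤ q * t := Nat.mul_le_mul_right t hq
    omega
  set ω1 := ktr R x (q * t - t) d ω with hω1
  have hZ1 : kd R (fun l => x l ^ (q * t)) d ω1 = 0 := by
    rw [← hqt, hω1, kd_ktr, LinearMap.mem_ker.mp hZ, map_zero]
  have hdeg1 : KCdeg 𝒜 (q * t) d a ω1 := by
    rw [← hqt]; exact deg_ktr x hx _ _ _ _ _ hdeg
  have hnon1 : ¬ Van x (q * t) d ω1 := by
    intro h
    rw [← hqt] at h
    exact hnon (Van_of_ktr x _ _ _ _ h)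
  set π := piF 𝒜 ν p e with hπ
  have hsurj : ∀ s, ∃ c, π c = ω1 s := fun s => piF_surj hSG ν p e hν (ω1 s)
  choose ρ hρ using hsurj
  let N : Submodule R (HG 𝒜 ν →₀ R) :=
    { carrier := {c | π c = 0}
      zero_mem' := map_zero π
      add_mem' := by
        intro a b ha hb
        have ha : π a = 0 := ha
        have hb : π b = 0 := hb
        change π (a + b) = 0
        rw [map_add, ha, hb, add_zero]
      smul_mem' := by
        intro r c hc
        have hc : π c = 0 := hc
        change π (r • c) = 0
        rw [hπ, piF_smul, ← hπ, hc, mul_zero] }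
  have hπsm : ∀ (t : ℕ) (l : Fin n) (m : HG 𝒜 ν →₀ R),
      π (x l ^ t • m) = x l ^ (q * t) • π m := by
    intro t l m
    rw [hπ, piF_smul, smul_eq_mul, ← pow_mul, mul_comm t]
  have hξN : ∀ s, kd (HG 𝒜 ν →₀ R) (fun l => x l ^ t) d ρ s ∈ N := by
    intro s
    change π _ = 0
    rw [← kd_map π π (fun l => x l ^ t) (fun l => x l ^ (q * t)) (hπsm t)]
    have : (fun s => π (ρ s)) = ω1 := funext hρ
    rw [this, hZ1]; rfl
  let ξ : KC n N (d + 1) := fun s => ⟨_, hξN s⟩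
  have hξ : kd N (fun l => x l ^ t) (d + 1) ξ = 0 := by
    funext s
    apply Subtype.ext
    have h1 := kd_map (N.subtype.toAddMonoidHom) (N.subtype.toAddMonoidHom)
      (fun l => x l ^ t) (fun l => x l ^ t) (fun l m => rfl) (d + 1) ξ s
    have h2 : (fun s => N.subtype.toAddMonoidHom (ξ s)) =
      kd (HG 𝒜 ν →₀ R) (fun l => x l ^ t) d ρ := rfl
    rw [h2, kd_kd] at h1
    exact h1.symm
  obtain ⟨c, η, hη⟩ := vanish (irrIdeal 𝒜) d hd x hspan t ξ hξ
  set T := t + c with hT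
  let β : KC n (HG 𝒜 ν →₀ R) d := fun s => ktr (HG 𝒜 ν →₀ R) x c d ρ s - (η s : HG 𝒜 ν →₀ R)
  have hβ : kd _ (fun l => x l ^ T) d β = 0 := by
    have h1 : β = ktr (HG 𝒜 ν →₀ R) x c d ρ - (fun s => (η s : HG 𝒜 ν →₀ R)) := rfl
    rw [h1, map_sub, kd_ktr, sub_eq_zero]
    funext s
    have h2 := kd_map (N.subtype.toAddMonoidHom) (N.subtype.toAddMonoidHom)
      (fun l => x l ^ T) (fun l => x l ^ T) (fun l m => rfl) d η s
    rw [← hη] at h2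
    exact h2.symm
  set ω2 := ktr R x (q * c) d ω1 with hω2
  have hqT : q * t + q * c = q * T := by rw [hT, mul_add]
  have hdeg2 : KCdeg 𝒜 (q * T) d a ω2 := by
    rw [← hqT]; exact deg_ktr x hx _ _ _ _ _ hdeg1
  have hnon2 : ¬ Van x (q * T) d ω2 := by
    intro h
    rw [← hqT] at h
    exact hnon1 (Van_of_ktr x _ _ _ _ h)
  have hω2β : ∀ s, ω2 s = π (β s) := by
    intro s
    have h1 : π (η s : HG 𝒜 ν →₀ R) = 0 := (η s).2
    change _ = π (_ - _)
    rw [map_sub, h1, sub_zero, ktr_apply, hπ, piF_smul, ← hπ, hρ, hω2, ktr_apply, ← pow_mul,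
      mul_comm c, smul_eq_mul]
  -- degree
  have hpos : 0 ≤ a + (q * T : ℕ) * d := by
    by_contra hneg
    apply hnon2
    have : ω2 = 0 := by
      funext s
      have := hdeg2 s
      rw [zdeg, if_neg hneg] at this
      exact (Submodule.mem_bot K).mp this
    rw [this]; exact Van_zero _ _ _
  obtain ⟨D0, hD0⟩ := Int.eq_ofNat_of_zero_le hpos
  have hmem : ∀ s, ω2 s ∈ 𝒜 D0 := by
    intro s
    have := hdeg2 s
    rw [zdeg, if_pos hpos, hD0] at this
    simpa using this
  have hγ : ∀ g : HG 𝒜 ν, ∃ γ ≤ ν, g.1 ∈ 𝒜 γ := fun g => g.2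
  choose γ hγ1 hγ2 using hγ
  let β' : HG 𝒜 ν → KC n R d := fun g s => cmp 𝒜 q D0 (γ g) (β s g)
  classical
  let supp : Finset (HG 𝒜 ν) := Finset.univ.biUnion (fun s => (β s).support)
  have hsum : ω2 = ∑ g ∈ supp, (fun s => mf p e g.1 (β' g s)) := by
    funext s
    rw [Finset.sum_apply, ← pr_same 𝒜 (hmem s), hω2β s, hπ, piF_apply,
      Finsupp.sum_of_support_subset (s := supp) _ _ _ (by intro g _; have h0 : p ^ e ≠ 0 := hq.ne'; simp [zero_pow h0]), map_sum]
    · refine Finset.sum_congr rfl fun g _ => ?_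
      rw [pr_mul_pow p e D0 (γ g) g.1 _ (hγ2 g), mf_apply]
    · exact Finset.subset_biUnion_of_mem (fun s => (β s).support) (Finset.mem_univ s)
  obtain ⟨g, hg⟩ : ∃ g, ¬ Van x T d (β' g) := by
    by_contra hall
    push Not at hall
    apply hnon2
    rw [hsum]
    exact Finset.sum_induction _ (Van x (q * T) d) (Van_add x _ _) (Van_zero _ _ _)
      (fun g _ => Van_frob x T d p e g.1 _ (hall g))
  have hcond : γ g ≤ D0 ∧ q ∣ D0 - γ g := by
    by_contra hc
    apply hg
    have : β' g = 0 := by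
      funext s
      simp only [β', cmp, if_neg hc]; rfl
    rw [this]; exact Van_zero _ _ _
  obtain ⟨hle, E, hE⟩ := hcond
  have hβ'eq : β' g = fun s => pr 𝒜 E (β s g) := by
    funext s
    simp only [β', cmp]
    rw [if_pos ⟨hle, E, hE⟩, hE, Nat.mul_div_cancel_left _ hq]
  have hlc : lcNonzero K R 𝒜 d ((E : ℤ) - T * d) := by
    refine ⟨n, x, hx, hspan, T, β' g, by omega, ?_, ?_, ?_⟩
    · rw [koszulZ, LinearMap.mem_ker, hβ'eq]
      funext s
      have h1 := kd_map ((pr 𝒜 E).comp (Finsupp.applyAddHom g))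
        ((pr 𝒜 (T + E)).comp (Finsupp.applyAddHom g))
        (fun l => x l ^ T) (fun l => x l ^ T) (by
          intro l m
          have hxT : x l ^ T ∈ 𝒜 T := by
            have := SetLike.pow_mem_graded T (hx l)
            simpa using this
          exact DirectSum.coe_decompose_mul_add_of_left_mem 𝒜 hxT) d β s
      rw [hβ] at h1
      rw [Pi.zero_apply, map_zero] at h1
      exact h1
    · intro s
      rw [hβ'eq]
      have : (E : ℤ) - T * d + T * d = E := by ring
      rw [this, zdeg, if_pos (by omega)]
      exact pr_mem 𝒜 E _
    · intro c hc
      exact hg ⟨c, hc⟩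
  have hj := ha _ hlc
  have hγν := hγ1 g
  have e1 : (D0 : ℤ) = γ g + q * E := by
    have : D0 = γ g + q * E := by omega
    exact_mod_cast this
  have e2 : a = γ g + (q : ℤ) * ((E : ℤ) - T * d) := by
    have : (D0 : ℤ) = a + (q * T : ℕ) * d := hD0.symm
    push_cast at this
    linear_combination e1 - this
  have e3 : (q : ℤ) * ((E : ℤ) - T * d) ≤ q * a :=
    mul_le_mul_of_nonneg_left hj (by positivity)
  have e4 : ((p : ℤ) ^ e) = q := by rw [hqdef]; push_cast; rfl
  rw [e4]
  have : (γ g : ℤ) ≤ ν := by exact_mod_cast hγν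
  linarith

lemma span_pow_le {ι : Type*} (x : ι → R) (q : ℕ) (S : Finset ι) :
    Ideal.span (x '' (S : Set ι)) ^ (S.card * q + 1) ≤
      Ideal.span ((fun i => x i ^ q) '' (S : Set ι)) := by
  classical
  induction S using Finset.induction_on with
  | empty => simp
  | insert i S hi ih =>
    rw [Finset.card_insert_of_notMem hi, Finset.coe_insert, Set.image_insert_eq,
      Set.image_insert_eq, Ideal.span_insert, Ideal.span_insert, sup_comm]
    have : (S.card + 1) * q + 1 = (S.card * q + 1) + q := by ring
    rw [this]
    refine Ideal.sup_pow_add_le_pow_sup_pow.trans ?_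
    rw [sup_comm, Ideal.span_singleton_pow]
    exact sup_le_sup le_rfl ih

lemma nu_set_bound {n : ℕ} (x : Fin n → R) (m : Ideal R)
    (hspan : Ideal.span (Set.range x) = m) (q r : ℕ)
    (hr : ¬ m ^ r ≤ frobeniusPower m q) : r ≤ n * q := by
  by_contra hlt
  apply hr
  have h1 := span_pow_le x q Finset.univ
  simp only [Finset.coe_univ, Set.image_univ, Finset.card_univ, Fintype.card_fin, hspan] at h1
  refine (Ideal.pow_le_pow_right (by omega)).trans (h1.trans ?_)
  rw [Ideal.span_le]
  rintro _ ⟨l, rfl⟩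
  exact Ideal.subset_span ⟨x l, by rw [← hspan]; exact Ideal.subset_span ⟨l, rfl⟩, rfl⟩

end final
end Aux
end FT

open FT Filter in
/-- Let `(R, m, K)` be an `F`-finite standard graded `K`-algebra of
prime characteristic `p` and dimension `d`.  Then `-a_d(R) ≤ c^m_-(R)`, where
`c^m_-(R) = liminf_{e→∞} ν_m(p^e)/p^e`, `ν_m(p^e) = max{r | m^r ⊄ m^{[p^e]}}`, and
`a_d(R) = max{j | H^d_m(R)_j ≠ 0}`. -/
theorem neg_aInv_le_cminus
    (K R : Type*) [Field K] [CommRing R] [Algebra K R]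
    (𝒜 : ℕ → Submodule K R) (hSG : IsStandardGraded K R 𝒜)
    (p : ℕ) (hp : p.Prime) [CharP R p]
    (hFF : IsFFinite R p)
    (d : ℕ) (hd : ringKrullDim R = (d : WithBot ℕ∞))
    (a : ℤ) (ha : IsGreatest {j : ℤ | lcNonzero K R 𝒜 d j} a) :
    (-a : ℝ) ≤
      liminf (fun e : ℕ => (nu (irrIdeal 𝒜) (irrIdeal 𝒜) (p ^ e) : ℝ) / (p : ℝ) ^ e)
        atTop := by
  haveI : Fact p.Prime := ⟨hp⟩
  haveI : ExpChar R p := ExpChar.prime hp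
  haveI : Nontrivial R := by
    by_contra hnt
    rw [not_nontrivial_iff_subsingleton] at hnt
    rw [ringKrullDim_eq_bot_of_subsingleton] at hd
    exact absurd hd (by simp)
  haveI : SetLike.GradedMonoid 𝒜 :=
    { one_mem := by
        rw [hSG.deg0]; exact Submodule.one_le.mp le_rfl
      mul_mem := fun i j a b ha hb => hSG.mul_le i j (Submodule.mul_mem_mul ha hb) }
  letI : GradedAlgebra 𝒜 := DirectSum.IsInternal.gradedAlgebra hSG.internal
  haveI := Aux.noeth hSG
  haveI := Aux.irr_max hSG
  have hht : (irrIdeal 𝒜).height ≤ d := by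
    have h1 := Ideal.height_le_ringKrullDim_of_ne_top (I := irrIdeal 𝒜) (Ideal.IsPrime.ne_top')
    rw [hd] at h1
    exact_mod_cast h1
  obtain ⟨⟨n, x, hx, hspan, t, ω, ht, hZ, hdeg, hnon⟩, hub⟩ := ha
  have hbdd : ∀ e : ℕ, ∀ r ∈ {r : ℕ | ¬ irrIdeal 𝒜 ^ r ≤ frobeniusPower (irrIdeal 𝒜) (p ^ e)},
      r ≤ n * p ^ e := fun e r hr => Aux.nu_set_bound x _ hspan _ r hr
  have hkey : ∀ e : ℕ, a ≤ nu (irrIdeal 𝒜) (irrIdeal 𝒜) (p ^ e) + (p : ℤ) ^ e * a := by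
    intro e
    refine Aux.key hSG p e _ ?_ d hht a (fun j hj => hub hj) x hx hspan t ht ω hZ hdeg
      (fun ⟨c, hc⟩ => hnon c hc)
    by_contra hne
    have : nu (irrIdeal 𝒜) (irrIdeal 𝒜) (p ^ e) + 1 ≤ nu (irrIdeal 𝒜) (irrIdeal 𝒜) (p ^ e) :=
      le_csSup ⟨_, hbdd e⟩ hne
    omega
  have hnu : ∀ e : ℕ, nu (irrIdeal 𝒜) (irrIdeal 𝒜) (p ^ e) ≤ n * p ^ e := by
    intro e
    rcases Set.eq_empty_or_nonempty
      {r : ℕ | ¬ irrIdeal 𝒜 ^ r ≤ frobeniusPower (irrIdeal 𝒜) (p ^ e)} with h | h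
    · rw [nu, h]; simp
    · exact csSup_le h (hbdd e)
  have hp0 : (0 : ℝ) < p := by exact_mod_cast hp.pos
  have hp1 : (1 : ℝ) < p := by exact_mod_cast hp.one_lt
  have hlim : Tendsto (fun e : ℕ => -(a : ℝ) + (a : ℝ) * ((p : ℝ)⁻¹) ^ e) atTop
      (nhds (-(a : ℝ))) := by
    have h1 := tendsto_pow_atTop_nhds_zero_of_lt_one (inv_nonneg.mpr hp0.le) (inv_lt_one_of_one_lt₀ hp1)
    have h2 := (h1.const_mul (a : ℝ)).const_add (-(a : ℝ))
    simpa using h2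
  rw [← hlim.liminf_eq]
  refine liminf_le_liminf ?_ ?_ ?_
  · refine Eventually.of_forall fun e => ?_
    have hk : (a : ℝ) ≤ nu (irrIdeal 𝒜) (irrIdeal 𝒜) (p ^ e) + (p : ℝ) ^ e * a := by
      exact_mod_cast hkey e
    have hpe : (0 : ℝ) < (p : ℝ) ^ e := pow_pos hp0 e
    rw [le_div_iff₀ hpe, inv_pow, add_mul, mul_assoc, inv_mul_cancel₀ hpe.ne']
    linarith
  · exact hlim.isBoundedUnder_ge
  · apply IsBoundedUnder.isCoboundedUnder_ge
    refine ⟨n, ?_⟩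
    rw [eventually_map]
    refine Eventually.of_forall fun e => ?_
    show (nu (irrIdeal 𝒜) (irrIdeal 𝒜) (p ^ e) : ℝ) / (p : ℝ) ^ e ≤ (n : ℝ)
    rw [div_le_iff₀ (pow_pos hp0 e)]
    exact_mod_cast hnu e
end

section
/- Let (R,m,K) be an F-finite and F-pure standard graded K-algebra of characteristic p > 0. Then for every natural number i with H^i_m(R) ≠ 0, one has -a_i(R) ≤ c^m(R), where c^m(R) = lim_{e→∞} ν_m(p^e)/p^e is the diagonal F-threshold (this limit exists since R is F-pure) and ν_m(p^e) = max{r ∈ N : m^r ⊄ m^{[p^e]}}. -/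
/-!
Core definitions: standard graded algebras, Koszul-colimit model of graded local
cohomology nonvanishing, Frobenius splittings, F-purity, F-thresholds.
-/

open Filter

namespace FTaux

open Finset

section Koszul

variable {A M : Type*} [CommRing A] [AddCommGroup M] [Module A M] {n : ℕ}

/-- sign -/
def eps (s : Finset (Fin n)) (i : Fin n) : ℤ := (-1) ^ (s.filter (fun j => j < i)).card

lemma eps_mul_self (s : Finset (Fin n)) (i : Fin n) : eps s i * eps s i = 1 := by
  unfold eps
  rw [← mul_pow]; simp

lemma eps_erase_gt (s : Finset (Fin n)) {i j : Fin n} (h : i < j) :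
    eps (s.erase j) i = eps s i := by
  unfold eps
  congr 2
  ext k
  simp only [mem_filter, mem_erase]
  constructor
  · rintro ⟨⟨_, h2⟩, h3⟩; exact ⟨h2, h3⟩
  · rintro ⟨h2, h3⟩; exact ⟨⟨(h3.trans h).ne, h2⟩, h3⟩

lemma eps_erase_lt (s : Finset (Fin n)) {i j : Fin n} (h : i < j) (hi : i ∈ s) :
    eps (s.erase i) j = - eps s j := by
  unfold eps
  have : s.filter (fun k => k < j) = insert i ((s.erase i).filter (fun k => k < j)) := by
    ext k
    simp only [mem_filter, mem_erase, mem_insert]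
    constructor
    · rintro ⟨h1, h2⟩
      by_cases hk : k = i
      · exact Or.inl hk
      · exact Or.inr ⟨⟨hk, h1⟩, h2⟩
    · rintro (rfl | ⟨⟨_, h1⟩, h2⟩)
      · exact ⟨hi, h⟩
      · exact ⟨h1, h2⟩
  rw [this, card_insert_of_notMem (by simp), pow_succ]
  ring

lemma eps_swap (s : Finset (Fin n)) {i j : Fin n} (h : i ≠ j) (hi : i ∈ s) (hj : j ∈ s) :
    eps s i * eps (s.erase i) j = - (eps s j * eps (s.erase j) i) := by
  rcases lt_or_gt_of_ne h with h | h
  · rw [eps_erase_lt s h hi, eps_erase_gt s h]; ring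
  · rw [eps_erase_lt s h hj, eps_erase_gt s h]; ring

/-- total Koszul differential -/
def D (f : Fin n → A) : (Finset (Fin n) → M) →ₗ[A] (Finset (Fin n) → M) where
  toFun ω s := ∑ i ∈ s, eps s i • (f i • ω (s.erase i))
  map_add' a b := by
    funext s
    simp [smul_add, Finset.sum_add_distrib]
  map_smul' r a := by
    funext s
    simp only [Pi.smul_apply, RingHom.id_apply, Finset.smul_sum]
    refine Finset.sum_congr rfl fun i _ => ?_
    rw [smul_comm (f i) r, smul_comm (eps s i) r]

lemma D_apply (f : Fin n → A) (ω : Finset (Fin n) → M) (s) :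
    D f ω s = ∑ i ∈ s, eps s i • (f i • ω (s.erase i)) := rfl

/-- transition -/
def tr (x : Fin n → A) (c : ℕ) : (Finset (Fin n) → M) →ₗ[A] (Finset (Fin n) → M) where
  toFun ω s := (∏ i ∈ s, x i) ^ c • ω s
  map_add' a b := by funext s; simp
  map_smul' r a := by
    funext s
    simp only [Pi.smul_apply, RingHom.id_apply]
    rw [smul_comm]

lemma tr_apply (x : Fin n → A) (c : ℕ) (ω : Finset (Fin n) → M) (s) :
    tr x c ω s = (∏ i ∈ s, x i) ^ c • ω s := rfl

lemma tr_tr (x : Fin n → A) (c d : ℕ) (ω : Finset (Fin n) → M) :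
    tr x c (tr x d ω) = tr x (d + c) ω := by
  funext s
  simp only [tr_apply, smul_smul, ← pow_add, add_comm c d]

lemma tr_zero (x : Fin n → A) (ω : Finset (Fin n) → M) : tr x 0 ω = ω := by
  funext s
  simp [tr_apply]

/-- powers -/
def pw (x : Fin n → A) (t : ℕ) : Fin n → A := fun l => x l ^ t

lemma D_tr (x : Fin n → A) (t c : ℕ) (ω : Finset (Fin n) → M) :
    D (pw x (t + c)) (tr x c ω) = tr x c (D (pw x t) ω) := by
  funext s
  simp only [D_apply, tr_apply, Finset.smul_sum]
  refine Finset.sum_congr rfl fun i hi => ?_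
  rw [smul_comm _ (eps s i), smul_smul, smul_smul, ← Finset.mul_prod_erase s x hi]
  congr 2
  simp only [pw, pow_add, mul_pow]; ring

lemma D_D (f : Fin n → A) (ω : Finset (Fin n) → M) : D f (D f ω) = 0 := by
  funext s
  simp only [D_apply, Finset.smul_sum, Pi.zero_apply]
  rw [Finset.sum_sigma']
  refine Finset.sum_involution (fun a _ => ⟨a.2, a.1⟩) ?_ ?_ ?_ ?_
  · rintro ⟨i, j⟩ h
    simp only [mem_sigma, mem_erase] at h
    obtain ⟨hi, hji, hj⟩ := h
    simp only
    rw [Finset.erase_right_comm (a := j) (b := i)]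
    rw [smul_comm (f i) (eps _ j), smul_comm (f j) (eps _ i), smul_smul,
      smul_smul (eps s j), eps_swap s (Ne.symm hji) hi hj, smul_comm (f i) (f j), neg_smul, neg_add_cancel]
  · rintro ⟨i, j⟩ h _ h2
    simp only [mem_sigma, mem_erase] at h
    simp only [Sigma.mk.injEq, heq_eq_eq] at h2
    exact h.2.1 h2.1
  · rintro ⟨i, j⟩ h
    simp only [mem_sigma, mem_erase] at h ⊢
    exact ⟨h.2.2, Ne.symm h.2.1, h.1⟩
  · rintro ⟨i, j⟩ h
    rfl

/-- concentrated in degree `i` -/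
def Hm (i : ℕ) (ω : Finset (Fin n) → M) : Prop := ∀ s, s.card ≠ i → ω s = 0

lemma Hm.D {i : ℕ} {ω : Finset (Fin n) → M} (h : Hm i ω) (f : Fin n → A) :
    Hm (i + 1) (D f ω) := by
  intro s hs
  rw [D_apply]
  refine Finset.sum_eq_zero fun l hl => ?_
  rw [h _ (by rw [card_erase_of_mem hl]; have := card_pos.2 ⟨l, hl⟩; omega)]
  simp

lemma Hm.tr {i : ℕ} {ω : Finset (Fin n) → M} (h : Hm i ω) (f : Fin n → A) (c : ℕ) :
    Hm i (tr f c ω) := by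
  intro s hs
  rw [tr_apply, h s hs, smul_zero]

/-- projection to degree `i` -/
def prj (i : ℕ) (ω : Finset (Fin n) → M) : Finset (Fin n) → M :=
  fun s => if s.card = i then ω s else 0

lemma prj_Hm (i : ℕ) (ω : Finset (Fin n) → M) : Hm i (prj i ω) := by
  intro s hs
  simp [prj, hs]

lemma Hm.prj_eq {i : ℕ} {ω : Finset (Fin n) → M} (h : Hm i ω) : prj i ω = ω := by
  funext s
  unfold prj
  split_ifs with h1
  · rfl
  · exact (h s h1).symm

lemma D_prj (f : Fin n → A) (i : ℕ) (ω : Finset (Fin n) → M) :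
    D f (prj i ω) = prj (i + 1) (D f ω) := by
  funext s
  simp only [D_apply, prj]
  split_ifs with h
  · refine Finset.sum_congr rfl fun l hl => ?_
    rw [if_pos (by rw [card_erase_of_mem hl]; omega)]
  · refine Finset.sum_eq_zero fun l hl => ?_
    rw [if_neg (by rw [card_erase_of_mem hl]; have := card_pos.2 ⟨l, hl⟩; omega)]
    simp

/-- the class of `ω` at stage `t` vanishes in the limit -/
def Dies (x : Fin n → A) (t : ℕ) (ω : Finset (Fin n) → M) : Prop :=
  ∃ c β, tr x c ω = D (pw x (t + c)) β

lemma dies_add_stage {x : Fin n → A} {t : ℕ} {ω β : Finset (Fin n) → M} {c : ℕ}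
    (h : tr x c ω = D (pw x (t + c)) β) (d : ℕ) :
    tr x (c + d) ω = D (pw x (t + (c + d))) (tr x d β) := by
  rw [← tr_tr, h, ← add_assoc, D_tr]

lemma Dies.add {x : Fin n → A} {t : ℕ} {ω ω' : Finset (Fin n) → M}
    (h : Dies x t ω) (h' : Dies x t ω') : Dies x t (ω + ω') := by
  obtain ⟨c, β, h⟩ := h
  obtain ⟨c', β', h'⟩ := h'
  have h1 := dies_add_stage h c'
  have h2 := dies_add_stage h' c
  rw [add_comm c' c] at h2
  exact ⟨c + c', _, by rw [map_add, h1, h2, ← map_add]⟩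

lemma Dies.smul {x : Fin n → A} {t : ℕ} {ω : Finset (Fin n) → M}
    (h : Dies x t ω) (r : A) : Dies x t (r • ω) := by
  obtain ⟨c, β, h⟩ := h
  exact ⟨c, r • β, by rw [map_smul, h, map_smul]⟩

lemma dies_zero (x : Fin n → A) (t : ℕ) : Dies x t (0 : Finset (Fin n) → M) :=
  ⟨0, 0, by simp⟩

lemma dies_tr_iff {x : Fin n → A} {t d : ℕ} {ω : Finset (Fin n) → M} :
    Dies x (t + d) (tr x d ω) ↔ Dies x t ω := by
  constructor
  · rintro ⟨c, β, h⟩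
    refine ⟨d + c, β, ?_⟩
    rw [← tr_tr, h, add_assoc]
  · rintro ⟨c, β, h⟩
    refine ⟨c, tr x d β, ?_⟩
    have := dies_add_stage h d
    rw [tr_tr, add_comm d c, this, show t + (c + d) = t + d + c by omega]

/-- naturality -/
lemma D_map {M' : Type*} [AddCommGroup M'] [Module A M'] (g : M →ₗ[A] M') (f : Fin n → A)
    (ω : Finset (Fin n) → M) : D f (fun s => g (ω s)) = fun s => g (D f ω s) := by
  funext s
  simp [D_apply, map_sum]

lemma tr_map {M' : Type*} [AddCommGroup M'] [Module A M'] (g : M →ₗ[A] M') (f : Fin n → A)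
    (c : ℕ) (ω : Finset (Fin n) → M) : tr f c (fun s => g (ω s)) = fun s => g (tr f c ω s) := by
  funext s
  simp [tr_apply]

/-- exactness in degrees below `n`. -/
lemma koszul_exact (f : Fin n → A) (q : Fin n → M →+ M)
    (hq : ∀ l u, q l (f l • u) = u) (hq' : ∀ l k u, k ≠ l → q l (f k • u) = f k • q l u)
    {i : ℕ} (hi : i < n) {ω : Finset (Fin n) → M} (hω : Hm i ω) (hc : D f ω = 0) :
    ∃ β, ω = D f β := by
  suffices H : ∀ L : Finset (Fin n), ∃ β ω', ω = D f β + ω' ∧ Hm i ω' ∧ D f ω' = 0 ∧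
      ∀ s, ¬ L ⊆ s → ω' s = 0 by
    obtain ⟨β, ω', h1, h2, _, h4⟩ := H univ
    refine ⟨β, ?_⟩
    have : ω' = 0 := by
      funext s
      by_cases hs : s = univ
      · subst hs
        exact h2 _ (by simp; omega)
      · exact h4 s (by rwa [univ_subset_iff])
    rw [h1, this, add_zero]
  intro L
  induction L using Finset.induction_on with
  | empty => exact ⟨0, ω, by simp, hω, hc, by simp⟩
  | insert l L hl ih =>
    obtain ⟨β, ω', h1, h2, h3, h4⟩ := ih
    let h : Finset (Fin n) → M := fun s => if l ∈ s then 0 else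
      eps (insert l s) l • q l (ω' (insert l s))
    have key1 : ∀ s, l ∉ s → D f h s = ω' s := by
      intro s hs
      have h5 := congrFun h3 (insert l s)
      rw [D_apply, sum_insert hs, erase_insert hs] at h5
      have h6 := congrArg (fun z => eps (insert l s) l • q l z) h5
      simp only [map_add, map_sum, map_zsmul, Pi.zero_apply, map_zero, smul_zero, hq,
        smul_add, smul_smul, eps_mul_self, one_smul, Finset.smul_sum] at h6
      rw [← sub_eq_zero, ← neg_eq_zero, neg_sub, sub_eq_add_neg, ← h6, D_apply, ← sum_neg_distrib]
      congr 1
      refine sum_congr rfl fun k hk => ?_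
      have hkl : k ≠ l := fun e => hs (e ▸ hk)
      rw [hq' _ _ _ hkl]
      simp only [h]
      rw [if_neg (fun e => hs (mem_of_mem_erase e)), smul_comm (f k), smul_smul,
        ← neg_smul]
      have e1 : insert l (s.erase k) = (insert l s).erase k := by
        rw [erase_insert_of_ne (Ne.symm hkl)]
      rw [e1]
      congr 1
      have e2 : eps s k = eps ((insert l s).erase l) k := by rw [erase_insert hs]
      rw [e2]
      have := eps_swap (insert l s) hkl (mem_insert_of_mem hk) (mem_insert_self l s)
      have a2 := eps_mul_self (insert l s) l
      have a3 := eps_mul_self ((insert l s).erase k) l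
      linear_combination (-eps (insert l s) l * eps ((insert l s).erase k) l) * this + (eps (insert l s) l * eps (insert l s) k) * a3 + (eps ((insert l s).erase k) l * eps ((insert l s).erase l) k) * a2
    have key2 : ∀ s, l ∈ s → D f h s = f l • q l (ω' s) := by
      intro s hs
      rw [D_apply, sum_eq_single_of_mem l hs]
      · simp only [h]
        rw [if_neg (by simp), insert_erase hs, smul_comm (f l), smul_smul, eps_mul_self, one_smul]
      · intro k _ hkl
        simp only [h]
        rw [if_pos (mem_erase.2 ⟨Ne.symm hkl, hs⟩)]
        simp
    refine ⟨β + h, ω' - D f h, by rw [h1, map_add]; abel, ?_, by rw [map_sub, h3, D_D, sub_zero], ?_⟩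
    · intro s hs
      rw [Pi.sub_apply]
      by_cases hls : l ∈ s
      · rw [key2 s hls, h2 s hs]; simp
      · rw [key1 s hls, sub_self]
    · intro s hs
      rw [Pi.sub_apply]
      by_cases hls : l ∈ s
      · rw [key2 s hls, h4 s (fun e => hs (insert_subset hls e))]; simp
      · rw [key1 s hls, sub_self]

end Koszul

end FTaux

set_option linter.unusedSectionVars false

namespace FTaux

open Finset

section Poly

variable {K : Type*} [Field K] {n : ℕ} {M : Type*} [AddCommGroup M]
  [Module (MvPolynomial (Fin n) K) M] [Module K M] [IsScalarTower K (MvPolynomial (Fin n) K) M]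

/-- constant exponent -/
noncomputable def cst (n t : ℕ) : Fin n →₀ ℕ := Finsupp.equivFunOnFinite.symm (fun _ => t)

@[simp] lemma cst_apply (t : ℕ) (l : Fin n) : cst n t l = t := rfl

/-- variables -/
noncomputable abbrev XX (K : Type*) [Field K] (n : ℕ) : Fin n → MvPolynomial (Fin n) K :=
  fun l => MvPolynomial.X l

lemma prod_X_pow (c : ℕ) :
    (∏ l : Fin n, (MvPolynomial.X l : MvPolynomial (Fin n) K)) ^ c =
      MvPolynomial.monomial (cst n c) 1 := by
  rw [← Finset.prod_pow, MvPolynomial.monomial_eq, Finsupp.prod_fintype _ _ (by simp)]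
  simp

/-- `∑ X_l^T M` -/
noncomputable def IM (K : Type*) [Field K] (n : ℕ) (M : Type*) [AddCommGroup M]
    [Module (MvPolynomial (Fin n) K) M] (T : ℕ) : Submodule (MvPolynomial (Fin n) K) M :=
  LinearMap.range (∑ l : Fin n,
    (LinearMap.lsmul (MvPolynomial (Fin n) K) M (MvPolynomial.X l ^ T)).comp
      (LinearMap.proj (R := MvPolynomial (Fin n) K) (φ := fun _ : Fin n => M) l))

lemma mem_IM {T : ℕ} {m : M} : m ∈ IM K n M T ↔
    ∃ β : Fin n → M, ∑ l, (MvPolynomial.X l ^ T : MvPolynomial (Fin n) K) • β l = m := by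
  simp [IM]

lemma X_pow_smul_mem_IM (T : ℕ) (l : Fin n) (m : M) :
    (MvPolynomial.X l ^ T : MvPolynomial (Fin n) K) • m ∈ IM K n M T := by
  rw [mem_IM]
  refine ⟨Pi.single l m, ?_⟩
  rw [Finset.sum_eq_single l]
  · simp
  · intro k _ hk; simp [hk]
  · simp

/-- relations -/
def relSet (K : Type*) [Field K] (n : ℕ) (M : Type*) [AddCommGroup M]
    [Module (MvPolynomial (Fin n) K) M] : Set ((Fin n →₀ ℕ) →₀ M) :=
  {e | ∃ α l m, e = Finsupp.single (α + Finsupp.single l 1)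
        ((MvPolynomial.X l : MvPolynomial (Fin n) K) • m) - Finsupp.single α m} ∪
  {e | ∃ (α : Fin n →₀ ℕ) (l : Fin n) (m : M), α l = 0 ∧
    e = Finsupp.single α ((MvPolynomial.X l : MvPolynomial (Fin n) K) • m)}

/-- stage `T` -/
noncomputable def Psi (K : Type*) [Field K] (n : ℕ) (M : Type*) [AddCommGroup M]
    [Module (MvPolynomial (Fin n) K) M] [Module K M] [IsScalarTower K (MvPolynomial (Fin n) K) M]
    (T : ℕ) : ((Fin n →₀ ℕ) →₀ M) →ₗ[K] M :=
  Finsupp.lsum K (fun α => (LinearMap.lsmul (MvPolynomial (Fin n) K) M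
    (MvPolynomial.monomial (cst n (T - 1) - α) 1)).restrictScalars K)

lemma Psi_single (T : ℕ) (α : Fin n →₀ ℕ) (m : M) :
    Psi K n M T (Finsupp.single α m) =
      (MvPolynomial.monomial (cst n (T - 1) - α) 1 : MvPolynomial (Fin n) K) • m := by
  simp [Psi]

lemma Psi_rel {e : (Fin n →₀ ℕ) →₀ M} (he : e ∈ Submodule.span K (relSet K n M)) :
    ∃ T₀, ∀ T ≥ T₀, Psi K n M T e ∈ IM K n M T := by
  induction he using Submodule.span_induction with
  | zero => exact ⟨0, by simp⟩
  | add a b _ _ ha hb =>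
    obtain ⟨T, hT⟩ := ha
    obtain ⟨T', hT'⟩ := hb
    exact ⟨max T T', fun U hU => by
      rw [map_add]
      exact Submodule.add_mem _ (hT U (le_trans (le_max_left _ _) hU))
        (hT' U (le_trans (le_max_right _ _) hU))⟩
  | smul c a _ ha =>
    obtain ⟨T, hT⟩ := ha
    refine ⟨T, fun U hU => ?_⟩
    rw [map_smul, ← algebraMap_smul (MvPolynomial (Fin n) K) c]
    exact Submodule.smul_mem _ _ (hT U hU)
  | mem e he =>
    rcases he with ⟨α, l, m, rfl⟩ | ⟨α, l, m, hα, rfl⟩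
    · refine ⟨α l + 2, fun T hT => ?_⟩
      rw [map_sub, Psi_single, Psi_single, smul_smul, MvPolynomial.X,
        MvPolynomial.monomial_mul, mul_one]
      have : cst n (T - 1) - (α + Finsupp.single l 1) + Finsupp.single l 1 = cst n (T - 1) - α := by
        ext k
        by_cases hk : k = l
        · subst hk; simp; omega
        · simp [Ne.symm hk]
      rw [this, sub_self]
      exact Submodule.zero_mem _
    · refine ⟨1, fun T hT => ?_⟩
      rw [Psi_single, smul_smul, MvPolynomial.X, MvPolynomial.monomial_mul, mul_one]
      have : cst n (T - 1) - α + Finsupp.single l 1 =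
          (cst n (T - 1) - α + Finsupp.single l 1 - Finsupp.single l T) + Finsupp.single l T := by
        ext k
        by_cases hk : k = l
        · subst hk; simp [hα]; omega
        · simp [Ne.symm hk]
      rw [this, ← mul_one (1 : K), ← MvPolynomial.monomial_mul, ← smul_smul,
        ← MvPolynomial.X_pow_eq_monomial]
      exact Submodule.smul_mem _ _ (X_pow_smul_mem_IM _ _ _)

/-- Macaulay duality: separate a nonvanishing class -/
lemma exists_functional (t : ℕ) (z : M)
    (hz : ∀ c, (∏ l : Fin n, (MvPolynomial.X l : MvPolynomial (Fin n) K)) ^ c • z ∉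
      IM K n M (t + c)) (ht : 0 < t) :
    ∃ g : M →ₗ[MvPolynomial (Fin n) K] MvPowerSeries (Fin n) K,
      MvPowerSeries.coeff (cst n (t - 1)) (g z) ≠ 0 := by
  have h1 : Finsupp.single (cst n (t - 1)) z ∉ Submodule.span K (relSet K n M) := by
    intro h
    obtain ⟨T₀, hT⟩ := Psi_rel h
    have := hT (t + T₀) (by omega)
    rw [Psi_single] at this
    apply hz T₀
    rw [prod_X_pow]
    have e : cst n T₀ = cst n (t + T₀ - 1) - cst n (t - 1) := by
      ext k; simp; omega
    rwa [e]
  obtain ⟨lam, hlam, hlam'⟩ := Submodule.exists_le_ker_of_notMem h1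
  let g0 : M →ₗ[K] MvPowerSeries (Fin n) K :=
    LinearMap.pi (fun α => lam.comp (Finsupp.lsingle α))
  have hg0 : ∀ α m, MvPowerSeries.coeff α (g0 m) = lam (Finsupp.single α m) := fun _ _ => rfl
  have hX : ∀ l m, g0 ((MvPolynomial.X l : MvPolynomial (Fin n) K) • m) =
      MvPowerSeries.X l * g0 m := by
    intro l m
    ext α
    rw [hg0, MvPowerSeries.X, MvPowerSeries.coeff_monomial_mul, one_mul, hg0]
    split_ifs with h
    · have h2 := hlam' (Submodule.subset_span (Or.inl ⟨α - Finsupp.single l 1, l, m, rfl⟩))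
      rw [LinearMap.mem_ker, map_sub, tsub_add_cancel_of_le h, sub_eq_zero] at h2
      exact h2
    · have h2 := hlam' (Submodule.subset_span (Or.inr ⟨α, l, m, by
        by_contra h3; apply h
        rw [Finsupp.single_le_iff]; omega, rfl⟩))
      exact h2
  refine ⟨{ toFun := g0, map_add' := g0.map_add, map_smul' := ?_ }, ?_⟩
  · intro f m
    simp only [RingHom.id_apply]
    induction f using MvPolynomial.induction_on generalizing m with
    | C a =>
      rw [← MvPolynomial.algebraMap_eq, algebraMap_smul, algebraMap_smul, map_smul]
    | add f f' hf hf' => rw [add_smul, map_add, hf, hf', add_smul]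
    | mul_X f l hf =>
      rw [mul_smul, hf, hX, mul_smul]
      congr 1
      rw [Algebra.smul_def]
      congr 1
      simp [MvPowerSeries.algebraMap_apply']
  · exact hlam

lemma coeff_eq_zero_of_dies (t : ℕ) (ht : 0 < t) (y : M) (c : ℕ)
    (h : (∏ l : Fin n, (MvPolynomial.X l : MvPolynomial (Fin n) K)) ^ c • y ∈ IM K n M (t + c))
    (g : M →ₗ[MvPolynomial (Fin n) K] MvPowerSeries (Fin n) K) :
    MvPowerSeries.coeff (cst n (t - 1)) (g y) = 0 := by
  have h1 : MvPowerSeries.coeff (cst n (t + c - 1)) (g ((∏ l : Fin n, (MvPolynomial.X l : MvPolynomial (Fin n) K)) ^ c • y)) = MvPowerSeries.coeff (cst n (t - 1)) (g y) := by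
    rw [prod_X_pow, map_smul, Algebra.smul_def]
    have : cst n (t + c - 1) = cst n c + cst n (t - 1) := by ext k; simp; omega
    rw [this, MvPowerSeries.algebraMap_apply', MvPolynomial.coe_monomial, MvPowerSeries.map_monomial, map_one, MvPowerSeries.coeff_add_monomial_mul, one_mul]
  rw [← h1]
  obtain ⟨β, hβ⟩ := mem_IM.1 h
  rw [← hβ, map_sum, map_sum]
  refine Finset.sum_eq_zero fun l _ => ?_
  rw [map_smul, Algebra.smul_def, MvPowerSeries.algebraMap_apply', MvPolynomial.X_pow_eq_monomial, MvPolynomial.coe_monomial, MvPowerSeries.map_monomial, map_one, MvPowerSeries.coeff_monomial_mul, if_neg]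
  rw [Finsupp.single_le_iff]; simp; omega

end Poly

end FTaux

namespace FTaux

open Finset

section Soc

variable {K : Type*} [Field K] {n : ℕ} {M : Type*} [AddCommGroup M]
  [Module (MvPolynomial (Fin n) K) M] [Module K M] [IsScalarTower K (MvPolynomial (Fin n) K) M]

/-- The socle of the limit is finite dimensional. -/
def SocBound (K : Type*) [Field K] (n : ℕ) (M : Type*) [AddCommGroup M]
    [Module (MvPolynomial (Fin n) K) M] [Module K M] (i : ℕ) : Prop :=
  ∃ N : ℕ, ∀ t : ℕ, 0 < t → ∀ ω : Fin N → (Finset (Fin n) → M),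
    (∀ k, Hm i (ω k)) → (∀ k, D (pw (XX K n) t) (ω k) = 0) →
    (∀ k l, Dies (XX K n) t (XX K n l • ω k)) →
    ∃ c : Fin N → K, c ≠ 0 ∧ Dies (XX K n) t (∑ k, c k • ω k)

lemma dies_top (t : ℕ) {ω : Finset (Fin n) → M} (h : Hm n ω) :
    Dies (XX K n) t ω ↔ ∃ c, (∏ l : Fin n, (MvPolynomial.X l : MvPolynomial (Fin n) K)) ^ c •
      ω univ ∈ IM K n M (t + c) := by
  constructor
  · rintro ⟨c, β, hβ⟩
    refine ⟨c, mem_IM.2 ⟨fun l => eps univ l • β (univ.erase l), ?_⟩⟩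
    have := congrFun hβ univ
    rw [tr_apply, D_apply] at this
    rw [this]
    refine Finset.sum_congr rfl fun l _ => ?_
    rw [smul_comm (eps univ l)]; rfl
  · rintro ⟨c, hc⟩
    obtain ⟨β, hβ⟩ := mem_IM.1 hc
    let b : Finset (Fin n) → M := fun s => ∑ l ∈ univ \ s, eps univ l • β l
    have hb : D (pw (XX K n) (t + c)) b univ = tr (XX K n) c ω univ := by
      rw [tr_apply, D_apply, ← hβ]
      refine Finset.sum_congr rfl fun l _ => ?_
      have : univ \ univ.erase l = {l} := by ext; simp
      simp only [b]
      rw [this, sum_singleton, smul_comm _ (eps univ l), smul_smul, eps_mul_self, one_smul]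
      rfl
    have hb' : tr (XX K n) c ω = prj n (D (pw (XX K n) (t + c)) b) := by
      rw [← (h.tr (XX K n) c).prj_eq]
      funext s
      unfold prj
      split_ifs with hs
      · have : s = univ := by rw [← Finset.card_eq_iff_eq_univ, hs]; simp
        rw [this, hb]
      · rfl
    rcases Nat.eq_zero_or_pos n with h0 | h0
    · refine ⟨c, 0, ?_⟩
      rw [map_zero]
      funext s
      have hs : s = univ := by subst h0; exact Subsingleton.elim _ _
      rw [hs, ← hb, D_apply]
      subst h0
      simp
    · refine ⟨c, prj (n - 1) b, ?_⟩
      rw [D_prj, Nat.sub_add_cancel h0, hb']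

lemma isNoetherian_hom [Module.Finite (MvPolynomial (Fin n) K) M] :
    IsNoetherian (MvPowerSeries (Fin n) K)
      (M →ₗ[MvPolynomial (Fin n) K] MvPowerSeries (Fin n) K) := by
  obtain ⟨r, e, he⟩ := Module.Finite.exists_fin (R := MvPolynomial (Fin n) K) (M := M)
  let ev : (M →ₗ[MvPolynomial (Fin n) K] MvPowerSeries (Fin n) K) →ₗ[MvPowerSeries (Fin n) K]
      (Fin r → MvPowerSeries (Fin n) K) :=
    { toFun := fun g j => g (e j)
      map_add' := fun _ _ => rfl
      map_smul' := fun _ _ => rfl }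
  refine isNoetherian_of_injective ev ?_
  intro g g' h
  refine LinearMap.ext_on he ?_
  rintro _ ⟨j, rfl⟩
  exact congrFun h j

lemma coeff_smul_of_soc (τ : Fin n →₀ ℕ) (z : M)
    (hz : ∀ (g : M →ₗ[MvPolynomial (Fin n) K] MvPowerSeries (Fin n) K) (l : Fin n),
      MvPowerSeries.coeff τ (g ((MvPolynomial.X l : MvPolynomial (Fin n) K) • z)) = 0)
    (s : MvPowerSeries (Fin n) K)
    (g : M →ₗ[MvPolynomial (Fin n) K] MvPowerSeries (Fin n) K) :
    MvPowerSeries.coeff τ ((s • g) z) =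
      MvPowerSeries.coeff 0 s * MvPowerSeries.coeff τ (g z) := by
  rw [LinearMap.smul_apply, smul_eq_mul, MvPowerSeries.coeff_mul]
  rw [Finset.sum_eq_single (0, τ)]
  · rintro ⟨a, b⟩ hab hne
    rw [Finset.HasAntidiagonal.mem_antidiagonal] at hab
    simp only at hab ⊢
    have ha : a ≠ 0 := by
      rintro rfl
      apply hne
      rw [zero_add] at hab
      rw [hab]
    obtain ⟨l, hl⟩ := Finsupp.ne_iff.1 ha
    have hl' : Finsupp.single l 1 ≤ a := by
      rw [Finsupp.single_le_iff]
      have : a l ≠ 0 := hl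
      omega
    have h1 := hz ((MvPowerSeries.monomial (a - Finsupp.single l 1) (1 : K)) • g) l
    rw [map_smul, LinearMap.smul_apply, Algebra.smul_def, MvPowerSeries.algebraMap_apply',
      MvPolynomial.X, MvPolynomial.coe_monomial, MvPowerSeries.map_monomial, map_one, smul_eq_mul,
      ← mul_assoc, MvPowerSeries.monomial_mul_monomial, add_tsub_cancel_of_le hl', mul_one, ← hab,
      MvPowerSeries.coeff_add_monomial_mul, one_mul] at h1
    rw [h1, mul_zero]
  · intro h
    exact absurd (by simp) h

lemma socBound_top [Module.Finite (MvPolynomial (Fin n) K) M] : SocBound K n M n := by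
  have := isNoetherian_hom (K := K) (n := n) (M := M)
  obtain ⟨r, g, hg⟩ := Module.Finite.exists_fin (R := MvPowerSeries (Fin n) K)
    (M := M →ₗ[MvPolynomial (Fin n) K] MvPowerSeries (Fin n) K)
  refine ⟨r + 1, fun t ht ω hω _ hx => ?_⟩
  let Φ : (Fin (r + 1) → K) →ₗ[K] (Fin r → K) :=
    { toFun := fun c j => ∑ k, c k * MvPowerSeries.coeff (cst n (t - 1)) (g j (ω k univ))
      map_add' := fun a b => by
        funext j; simp [add_mul, Finset.sum_add_distrib]
      map_smul' := fun a b => by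
        funext j; simp [Finset.mul_sum, mul_assoc] }
  have hker : LinearMap.ker Φ ≠ ⊥ := LinearMap.ker_ne_bot_of_finrank_lt (by simp)
  obtain ⟨c, hc, hc0⟩ := (Submodule.ne_bot_iff _).1 hker
  refine ⟨c, hc0, ?_⟩
  have hHm : Hm n (∑ k, c k • ω k) := by
    intro s hs
    rw [Finset.sum_apply]
    exact Finset.sum_eq_zero fun k _ => by rw [Pi.smul_apply, hω k s hs, smul_zero]
  rw [dies_top t hHm]
  by_contra hcon
  push Not at hcon
  obtain ⟨G, hG⟩ := exists_functional t _ hcon ht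
  apply hG
  have hgl : ∀ (g : M →ₗ[MvPolynomial (Fin n) K] MvPowerSeries (Fin n) K) (a : K) (m : M),
      g (a • m) = a • g m := by
    intro g a m
    rw [← algebraMap_smul (MvPolynomial (Fin n) K) a, map_smul, algebraMap_smul]
  have hz : ∀ (g : M →ₗ[MvPolynomial (Fin n) K] MvPowerSeries (Fin n) K) (l : Fin n),
      MvPowerSeries.coeff (cst n (t - 1)) (g ((MvPolynomial.X l : MvPolynomial (Fin n) K) •
        (∑ k, c k • ω k) univ)) = 0 := by
    intro g l
    rw [Finset.sum_apply, Finset.smul_sum, map_sum, map_sum]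
    refine Finset.sum_eq_zero fun k _ => ?_
    rw [Pi.smul_apply, smul_comm, hgl, map_smul]
    have h1 : Hm n (XX K n l • ω k) := fun s hs => by rw [Pi.smul_apply, hω k s hs, smul_zero]
    obtain ⟨c', hc'⟩ := (dies_top t h1).1 (hx k l)
    have := coeff_eq_zero_of_dies t ht _ c' hc' g
    rw [Pi.smul_apply] at this
    rw [this, smul_zero]
  have hGm : G ∈ Submodule.span (MvPowerSeries (Fin n) K) (Set.range g) := hg ▸ Submodule.mem_top
  obtain ⟨s, hs⟩ := (Submodule.mem_span_range_iff_exists_fun _).1 hGm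
  rw [← hs, LinearMap.sum_apply, map_sum]
  refine Finset.sum_eq_zero fun j _ => ?_
  rw [coeff_smul_of_soc _ _ hz]
  have h2 := congrFun (LinearMap.mem_ker.1 hc) j
  have h3 : MvPowerSeries.coeff (cst n (t - 1)) (g j ((∑ k, c k • ω k) univ)) = 0 := by
    rw [Finset.sum_apply, map_sum, map_sum]
    rw [← show Φ c j = 0 from h2]
    refine Finset.sum_congr rfl fun k _ => ?_
    rw [Pi.smul_apply, hgl, map_smul, smul_eq_mul]
  rw [h3, mul_zero]

lemma poly_exact (r t : ℕ) {i : ℕ} (hi : i < n)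
    {ω : Finset (Fin n) → (Fin r → MvPolynomial (Fin n) K)} (hω : Hm i ω)
    (hc : D (pw (XX K n) t) ω = 0) : ∃ β, ω = D (pw (XX K n) t) β := by
  refine koszul_exact (pw (XX K n) t) (fun l =>
    { toFun := fun v j => (v j).divMonomial (Finsupp.single l t)
      map_zero' := by funext j; simp
      map_add' := fun a b => by funext j; exact MvPolynomial.add_divMonomial _ _ _ }) ?_ ?_ hi hω hc
  · intro l u
    funext j
    simp [pw, XX, MvPolynomial.X_pow_eq_monomial]
  · intro l k u hk
    funext j
    simp only [pw, XX, AddMonoidHom.coe_mk, ZeroHom.coe_mk, Pi.smul_apply, smul_eq_mul,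
      MvPolynomial.X_pow_eq_monomial]
    ext m
    simp only [MvPolynomial.coeff_divMonomial, MvPolynomial.coeff_monomial_mul', one_mul,
      Finsupp.single_le_iff]
    simp only [Finsupp.add_apply, Finsupp.single_apply, if_neg (Ne.symm hk), zero_add]
    split_ifs with h
    · congr 1
      rw [add_tsub_assoc_of_le]
      rwa [Finsupp.single_le_iff]
    · rfl

lemma socBound_step {r : ℕ} (π : (Fin r → MvPolynomial (Fin n) K) →ₗ[MvPolynomial (Fin n) K] M)
    (hπ : Function.Surjective π) {i : ℕ} (hi : i < n)
    (h : SocBound K n (LinearMap.ker π) (i + 1)) : SocBound K n M i := by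
  obtain ⟨N, hN⟩ := h
  refine ⟨N, fun t ht ω hω hd hx => ?_⟩
  have hlift : ∀ ω : Finset (Fin n) → M, ∃ ω' : Finset (Fin n) → (Fin r → MvPolynomial (Fin n) K),
      (fun s => π (ω' s)) = ω := by
    intro ω
    choose f hf using hπ
    exact ⟨fun s => f (ω s), funext fun s => hf _⟩
  have hlift' : ∀ k, ∃ ω' : Finset (Fin n) → (Fin r → MvPolynomial (Fin n) K),
      Hm i ω' ∧ (fun s => π (ω' s)) = ω k := by
    intro k
    obtain ⟨w, hw⟩ := hlift (ω k)
    refine ⟨prj i w, prj_Hm _ _, ?_⟩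
    rw [← (hω k).prj_eq, ← hw]
    funext s
    unfold prj
    split_ifs <;> simp
  choose w hwH hw using hlift'
  -- lifting to the kernel
  have hker : ∀ v : Finset (Fin n) → (Fin r → MvPolynomial (Fin n) K), (fun s => π (v s)) = 0 →
      ∃ v' : Finset (Fin n) → LinearMap.ker π, (fun s => (LinearMap.ker π).subtype (v' s)) = v := by
    intro v hv
    exact ⟨fun s => ⟨v s, congrFun hv s⟩, rfl⟩
  have hinj : ∀ v v' : Finset (Fin n) → LinearMap.ker π,
      (fun s => (LinearMap.ker π).subtype (v s)) = (fun s => (LinearMap.ker π).subtype (v' s)) →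
      v = v' := by
    intro v v' h
    funext s
    exact Subtype.ext (congrFun h s)
  have hη : ∀ k, ∃ η : Finset (Fin n) → LinearMap.ker π,
      (fun s => (LinearMap.ker π).subtype (η s)) = D (pw (XX K n) t) (w k) := by
    intro k
    apply hker
    rw [← D_map, hw, hd]
  choose η hη using hη
  have hdies : ∀ k l, Dies (XX K n) t (XX K n l • η k) := by
    intro k l
    obtain ⟨c, β, hβ⟩ := hx k l
    obtain ⟨b, hb⟩ := hlift β
    obtain ⟨τ, hτ⟩ := hker (tr (XX K n) c (XX K n l • w k) - D (pw (XX K n) (t + c)) b) (by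
      have e1 := tr_map π (XX K n) c (XX K n l • w k)
      have e2 := D_map π (pw (XX K n) (t + c)) b
      rw [hb, ← hβ] at e2
      have e3 : (fun s => π ((XX K n l • w k) s)) = XX K n l • ω k := by
        rw [← hw k]; funext s; simp
      rw [e3] at e1
      funext s
      have e1' := congrFun e1 s
      have e2' := congrFun e2 s
      simp only [Pi.sub_apply, map_sub, ← e1', ← e2', sub_self, Pi.zero_apply])
    refine ⟨c, τ, ?_⟩
    apply hinj
    rw [← tr_map, ← D_map, hτ, map_sub, D_D, sub_zero, D_tr]
    congr 1
    rw [map_smul, ← hη k]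
    funext s
    simp
  obtain ⟨c, hc0, d, τ, hcd⟩ := hN t ht η (fun k s hs => by
      have := congrFun (hη k) s
      rw [(hwH k).D _ s hs] at this
      exact Subtype.ext this) (fun k => by
      apply hinj
      rw [← D_map, hη, D_D]; rfl) hdies
  refine ⟨c, hc0, ?_⟩
  let W := ∑ k, c k • w k
  have hWH : Hm i W := by
    intro s hs
    simp only [W]
    rw [Finset.sum_apply]
    exact Finset.sum_eq_zero fun k _ => by rw [Pi.smul_apply, hwH k s hs, smul_zero]
  have hksm : ∀ (a : K) (v : Finset (Fin n) → (Fin r → MvPolynomial (Fin n) K)),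
      D (pw (XX K n) t) (a • v) = a • D (pw (XX K n) t) v := by
    intro a v
    rw [← algebraMap_smul (MvPolynomial (Fin n) K) a, map_smul, algebraMap_smul]
  have hDW : (fun s => (LinearMap.ker π).subtype ((∑ k, c k • η k) s)) = D (pw (XX K n) t) W := by
    simp only [W]
    rw [map_sum]
    funext s
    rw [Finset.sum_apply, Finset.sum_apply, map_sum]
    refine Finset.sum_congr rfl fun k _ => ?_
    rw [hksm, ← hη k]
    rfl
  have hDW' : D (pw (XX K n) (t + d)) (tr (XX K n) d W) =
      D (pw (XX K n) (t + d)) (prj i (fun s => (LinearMap.ker π).subtype (τ s))) := by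
    rw [D_prj, D_map, ← hcd, ← tr_map, hDW, D_tr, (((hWH.D _).tr _ _)).prj_eq]
  obtain ⟨β, hβ⟩ := poly_exact r (t + d) hi
    (ω := tr (XX K n) d W - prj i (fun s => (LinearMap.ker π).subtype (τ s)))
    (fun s hs => by rw [Pi.sub_apply, hWH.tr _ _ s hs, prj_Hm i _ s hs, sub_zero])
    (by rw [map_sub, hDW', sub_self])
  refine ⟨d, fun s => π (β s), ?_⟩
  rw [D_map, ← hβ]
  have e4 : (fun s => π (W s)) = ∑ k, c k • ω k := by
    funext s
    simp only [W]
    rw [Finset.sum_apply, Finset.sum_apply, map_sum]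
    refine Finset.sum_congr rfl fun k _ => ?_
    rw [Pi.smul_apply, Pi.smul_apply, ← hw k, ← algebraMap_smul (MvPolynomial (Fin n) K) (c k),
      map_smul, algebraMap_smul]
  rw [← e4, tr_map]
  funext s
  rw [Pi.sub_apply, map_sub]
  have : π (prj i (fun s => (LinearMap.ker π).subtype (τ s)) s) = 0 := by
    unfold prj
    split_ifs
    · exact (τ s).2
    · simp
  rw [this, sub_zero]

end Soc

universe u

lemma socBound_aux {K : Type u} [Field K] {n : ℕ} (j : ℕ) : ∀ (i : ℕ) (_ : i + j = n) (M : Type u)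
    [AddCommGroup M] [Module (MvPolynomial (Fin n) K) M] [Module K M]
    [IsScalarTower K (MvPolynomial (Fin n) K) M] [Module.Finite (MvPolynomial (Fin n) K) M],
    SocBound K n M i := by
  induction j with
  | zero =>
    intro i hi M _ _ _ _ _
    obtain rfl : i = n := by omega
    exact socBound_top
  | succ j ih =>
    intro i hi M _ _ _ _ _
    obtain ⟨r, π, hπ⟩ := Module.Finite.exists_fin' (MvPolynomial (Fin n) K) M
    exact socBound_step π hπ (by omega) (ih (i + 1) (by omega) _)

lemma socBound {K : Type u} [Field K] {n : ℕ} {i : ℕ} (hi : i ≤ n) (M : Type*)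
    [AddCommGroup M] [Module (MvPolynomial (Fin n) K) M] [Module K M]
    [IsScalarTower K (MvPolynomial (Fin n) K) M] [Module.Finite (MvPolynomial (Fin n) K) M] :
    SocBound K n M i := by
  rcases hi.eq_or_lt with rfl | hi
  · exact socBound_top
  · obtain ⟨r, π, hπ⟩ := Module.Finite.exists_fin' (MvPolynomial (Fin n) K) M
    exact socBound_step π hπ hi (socBound_aux (n - (i + 1)) (i + 1) (by omega) _)

end FTaux

namespace FTaux

open Finset FT

section Transfer

variable {R : Type*} [CommRing R] {n : ℕ}

/-- extension by zero -/
def ex {i : ℕ} (ω : KC n R i) : Finset (Fin n) → R :=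
  fun s => if h : s.card = i then ω ⟨s, h⟩ else 0

/-- restriction -/
def rs (i : ℕ) (ω : Finset (Fin n) → R) : KC n R i := fun s => ω s.1

lemma ex_apply {i : ℕ} (ω : KC n R i) (s) (h : s.card = i) : ex ω s = ω ⟨s, h⟩ := dif_pos h

lemma ex_Hm {i : ℕ} (ω : KC n R i) : Hm i (ex ω) := fun _ h => dif_neg h

lemma rs_ex {i : ℕ} (ω : KC n R i) : rs i (ex ω) = ω := by
  funext s
  exact ex_apply ω s.1 s.2

lemma ex_inj {i : ℕ} {ω ω' : KC n R i} (h : ex ω = ex ω') : ω = ω' := by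
  rw [← rs_ex ω, h, rs_ex]

lemma kd_rs (f : Fin n → R) (i : ℕ) (β : Finset (Fin n) → R) :
    kd R f i (rs i β) = rs (i + 1) (D f β) := by
  funext s
  change ∑ l ∈ s.1.attach, _ = ∑ l ∈ s.1, _
  rw [← Finset.sum_attach s.1]
  rfl

lemma ex_kd (f : Fin n → R) (i : ℕ) (ω : KC n R i) : ex (kd R f i ω) = D f (ex ω) := by
  conv_lhs => rw [← rs_ex ω, kd_rs]
  funext s
  by_cases h : s.card = i + 1
  · rw [ex_apply _ _ h]; rfl
  · rw [ex_Hm _ s h, (ex_Hm ω).D f s h]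

lemma rs_tr (x : Fin n → R) (c i : ℕ) (ω : KC n R i) :
    ktr R x c i ω = rs i (tr x c (ex ω)) := by
  funext s
  change _ = (∏ l ∈ s.1, x l) ^ c • ex ω s.1
  rw [ex_apply _ _ s.2]; rfl

lemma ex_ktr (x : Fin n → R) (c i : ℕ) (ω : KC n R i) :
    ex (ktr R x c i ω) = tr x c (ex ω) := by
  funext s
  by_cases h : s.card = i
  · rw [ex_apply _ _ h, rs_tr]; rfl
  · rw [ex_Hm _ s h, (ex_Hm ω).tr x c s h]

lemma mem_koszulB_iff (x f : Fin n → R) (c i : ℕ) (ω : KC n R i) :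
    ktr R x c i ω ∈ koszulB R f i ↔ ∃ β, tr x c (ex ω) = D f β := by
  constructor
  · intro h
    cases i with
    | zero =>
      have h0 : ktr R x c 0 ω = 0 := h
      refine ⟨0, ?_⟩
      rw [← ex_ktr, h0, map_zero]
      funext s
      by_cases hs : s.card = 0
      · rw [ex_apply _ _ hs]; rfl
      · exact ex_Hm _ s hs
    | succ i =>
      obtain ⟨β, hβ⟩ := h
      exact ⟨ex β, by rw [← ex_ktr, ← hβ, ex_kd]⟩
  · rintro ⟨β, h⟩
    cases i with
    | zero =>
      change ktr R x c 0 ω = 0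
      rw [rs_tr, h]
      funext s
      change D f β s.1 = 0
      rw [D_apply, Finset.card_eq_zero.1 s.2, Finset.sum_empty]
    | succ i =>
      exact ⟨rs i β, by rw [kd_rs, ← h, rs_tr]⟩

lemma not_dies_iff (x : Fin n → R) (t i : ℕ) (ω : KC n R i) :
    (∀ c : ℕ, ktr R x c i ω ∉ koszulB R (fun l => x l ^ (t + c)) i) ↔ ¬ Dies x t (ex ω) := by
  unfold Dies
  push Not
  refine forall_congr' fun c => ?_
  rw [mem_koszulB_iff]
  push Not
  rfl

lemma mem_koszulZ_iff (f : Fin n → R) (i : ℕ) (ω : KC n R i) :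
    ω ∈ koszulZ R f i ↔ D f (ex ω) = 0 := by
  unfold koszulZ
  rw [LinearMap.mem_ker, ← ex_kd]
  constructor
  · intro h
    rw [h]
    funext s
    by_cases hs : s.card = i + 1
    · rw [ex_apply _ _ hs]; rfl
    · exact ex_Hm _ s hs
  · intro h
    rw [← rs_ex (kd R f i ω), h]; rfl

end Transfer

section Frob

variable {R : Type*} [CommRing R] {n : ℕ} (p : ℕ) [hp : Fact p.Prime] [CharP R p]

lemma D_frob (x : Fin n → R) (t e : ℕ) (ω : Finset (Fin n) → R) :
    D (pw x (t * p ^ e)) (fun s => ω s ^ p ^ e) = fun s => (D (pw x t) ω s) ^ p ^ e := by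
  funext s
  change _ = iterateFrobenius R p e _
  rw [D_apply, D_apply, map_sum]
  refine Finset.sum_congr rfl fun l _ => ?_
  rw [map_zsmul, smul_eq_mul, smul_eq_mul, map_mul, iterateFrobenius_def, iterateFrobenius_def]
  simp only [pw, pow_mul]

lemma tr_frob (x : Fin n → R) (c e : ℕ) (ω : Finset (Fin n) → R) :
    tr x (c * p ^ e) (fun s => ω s ^ p ^ e) = fun s => (tr x c ω s) ^ p ^ e := by
  funext s
  simp only [tr_apply, smul_eq_mul, mul_pow, pow_mul]

lemma dies_frob {x : Fin n → R} {t : ℕ} {ω : Finset (Fin n) → R} (e : ℕ) (h : Dies x t ω) :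
    Dies x (t * p ^ e) (fun s => ω s ^ p ^ e) := by
  obtain ⟨c, β, h⟩ := h
  refine ⟨c * p ^ e, fun s => β s ^ p ^ e, ?_⟩
  rw [tr_frob, h, ← add_mul, D_frob]

lemma exists_split (hFP : IsFPureRing R p) (e : ℕ) :
    ∃ φ : R →+ R, (∀ r x : R, φ (r ^ p ^ e * x) = r * φ x) ∧ φ 1 = 1 := by
  obtain ⟨ψ, h1, h2⟩ := hFP
  rw [pow_one] at h1
  induction e with
  | zero => exact ⟨AddMonoidHom.id R, by simp, rfl⟩
  | succ e ih =>
    obtain ⟨φ, h3, h4⟩ := ih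
    refine ⟨φ.comp ψ, fun r x => ?_, by simp [h2, h4]⟩
    rw [pow_succ, pow_mul]
    simp only [AddMonoidHom.coe_comp, Function.comp_apply]
    rw [h1, h3]

lemma dies_of_frob (hFP : IsFPureRing R p) {x : Fin n → R} {t : ℕ} {ω : Finset (Fin n) → R} (e : ℕ)
    (h : Dies x (t * p ^ e) (fun s => ω s ^ p ^ e)) : Dies x t ω := by
  obtain ⟨φ, h1, h2⟩ := exists_split p hFP e
  obtain ⟨c, β, h⟩ := h
  have hq : 1 ≤ p ^ e := Nat.one_le_pow _ _ hp.out.pos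
  obtain ⟨d, hd⟩ : ∃ d, c * p ^ e = c + d := ⟨c * p ^ e - c, by
    have := Nat.le_mul_of_pos_right c hq
    omega⟩
  have h' := dies_add_stage h d
  rw [← hd, tr_frob, ← add_mul] at h'
  refine ⟨c, fun s => φ (tr x d β s), ?_⟩
  funext s
  have h3 := congrArg φ (congrFun h' s)
  have h4 := h1 (tr x c ω s) 1
  rw [mul_one, h2, mul_one] at h4
  rw [h4] at h3
  rw [h3, D_apply, D_apply, map_sum]
  refine Finset.sum_congr rfl fun l _ => ?_
  rw [map_zsmul, smul_eq_mul, smul_eq_mul]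
  simp only [pw]
  rw [pow_mul, h1]

end Frob

section Nu

variable {R : Type*} [CommRing R]

lemma span_pow_le_frob (s : Finset R) (J : Ideal R) (hs : ∀ y ∈ s, y ∈ J) (q : ℕ) :
    Ideal.span (s : Set R) ^ (s.card * q + 1) ≤ frobeniusPower J q := by
  classical
  induction s using Finset.induction_on with
  | empty => simp
  | insert a s ha ih =>
    rw [card_insert_of_notMem ha, Finset.coe_insert, Ideal.span_insert,
      show (s.card + 1) * q + 1 = q + (s.card * q + 1) by ring]
    refine Ideal.sup_pow_add_le_pow_sup_pow.trans (sup_le ?_ ?_)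
    · rw [Ideal.span_singleton_pow, Ideal.span_singleton_le_iff_mem]
      exact Ideal.subset_span ⟨a, hs a (mem_insert_self _ _), rfl⟩
    · exact ih fun y hy => hs y (mem_insert_of_mem hy)

lemma nu_bound {J : Ideal R} (hJ : J.FG) :
    ∃ C : ℕ, ∀ q r, ¬ J ^ r ≤ frobeniusPower J q → r ≤ C * q := by
  obtain ⟨s, rfl⟩ := hJ
  refine ⟨s.card, fun q r h => ?_⟩
  by_contra hr
  apply h
  refine (Ideal.pow_le_pow_right ?_).trans (span_pow_le_frob s _ (fun y hy => Ideal.subset_span hy) q)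
  omega

lemma nu_bdd {J : Ideal R} (hJ : J.FG) (q : ℕ) :
    BddAbove {r : ℕ | ¬ J ^ r ≤ frobeniusPower J q} := by
  obtain ⟨C, hC⟩ := nu_bound hJ
  exact ⟨C * q, fun r hr => hC q r hr⟩

lemma nu_mul (p : ℕ) (hFP : IsFPureRing R p) {J : Ideal R} (hJ : J.FG) (e : ℕ) :
    p * nu J J (p ^ e) ≤ nu J J (p ^ (e + 1)) := by
  rcases Set.eq_empty_or_nonempty {r : ℕ | ¬ J ^ r ≤ frobeniusPower J (p ^ e)} with h | h
  · have : nu J J (p ^ e) = 0 := by unfold nu; rw [h]; simp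
    rw [this]; simp
  · have h1 : ¬ J ^ nu J J (p ^ e) ≤ frobeniusPower J (p ^ e) := Nat.sSup_mem h (nu_bdd hJ _)
    refine le_csSup (nu_bdd hJ _) ?_
    intro h2
    apply h1
    intro f hf
    obtain ⟨φ, h3, h4⟩ := hFP
    rw [pow_one] at h3
    have h5 : f ^ p ∈ frobeniusPower J (p ^ (e + 1)) := by
      apply h2
      rw [mul_comm, pow_mul]
      exact Ideal.pow_mem_pow hf p
    have h6 : ∀ y ∈ frobeniusPower J (p ^ (e + 1)), φ y ∈ frobeniusPower J (p ^ e) := by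
      intro y hy
      refine Submodule.span_induction (p := fun y _ => ∀ a, φ (a * y) ∈ frobeniusPower J (p ^ e))
        ?_ ?_ ?_ ?_ hy 1 |> fun h => by simpa using h
      · rintro _ ⟨z, hz, rfl⟩ a
        simp only
        rw [pow_succ, pow_mul, mul_comm, h3, mul_comm]
        exact Ideal.mul_mem_left _ _ (Ideal.subset_span ⟨z, hz, rfl⟩)
      · intro a; simp
      · intro y z _ _ hy hz a
        rw [mul_add, map_add]; exact Ideal.add_mem _ (hy a) (hz a)
      · intro b y _ hy a
        rw [smul_eq_mul, ← mul_assoc]; exact hy _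
    have h7 := h6 _ h5
    have h8 := h3 f 1
    rw [mul_one, h4, mul_one] at h8
    rwa [h8] at h7

lemma nu_tendsto (p : ℕ) (hp : p.Prime) (hFP : IsFPureRing R p) {J : Ideal R} (hJ : J.FG) :
    ∃ c : ℝ, Filter.Tendsto (fun e : ℕ => (nu J J (p ^ e) : ℝ) / (p : ℝ) ^ e)
      Filter.atTop (nhds c) := by
  have hp0 : (0 : ℝ) < p := by exact_mod_cast hp.pos
  refine ⟨_, tendsto_atTop_ciSup (monotone_nat_of_le_succ fun e => ?_) ?_⟩
  · rw [div_le_div_iff₀ (by positivity) (by positivity), pow_succ]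
    have := nu_mul p hFP hJ e
    have h : (p : ℝ) * nu J J (p ^ e) ≤ nu J J (p ^ (e + 1)) := by exact_mod_cast this
    have h' := mul_le_mul_of_nonneg_right h (pow_pos hp0 e).le
    linarith
  · obtain ⟨C, hC⟩ := nu_bound hJ
    refine ⟨C, ?_⟩
    rintro _ ⟨e, rfl⟩
    simp only
    rw [div_le_iff₀ (by positivity)]
    have : nu J J (p ^ e) ≤ C * p ^ e := by
      rcases Set.eq_empty_or_nonempty {r : ℕ | ¬ J ^ r ≤ frobeniusPower J (p ^ e)} with h | h
      · unfold nu; rw [h]; simp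
      · exact csSup_le h fun r hr => hC _ _ hr
    exact_mod_cast this

end Nu

end FTaux

namespace FTaux

open Finset FT

section Gr

variable {K R : Type*} [Field K] [CommRing R] [Algebra K R] {𝒜 : ℕ → Submodule K R}

lemma gradedMonoid (h : IsStandardGraded K R 𝒜) : SetLike.GradedMonoid 𝒜 where
  one_mem := by rw [h.deg0]; exact Submodule.one_le.1 le_rfl
  mul_mem i j _ _ hx hy := h.mul_le i j (Submodule.mul_mem_mul hx hy)

lemma exists_pr (h : IsStandardGraded K R 𝒜) : ∃ pr : ℤ → R →+ R,
    (∀ d z, z ∈ zdeg 𝒜 d → pr d z = z) ∧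
    (∀ d d' z, d' ≠ d → z ∈ zdeg 𝒜 d' → pr d z = 0) ∧
    (∀ (d : ℤ) (T : ℕ) y z, y ∈ 𝒜 T → pr (d + T) (y * z) = y * pr d z) ∧
    (∀ d z, pr d z ∈ zdeg 𝒜 d) := by
  classical
  haveI := gradedMonoid h
  letI := h.internal.chooseDecomposition
  letI : GradedRing 𝒜 := {}
  refine ⟨fun d => if 0 ≤ d then GradedRing.proj 𝒜 d.toNat else 0, ?_, ?_, ?_, ?_⟩
  · intro d z hz
    unfold zdeg at hz
    split_ifs at hz with hd
    · simp only [hd, if_true, GradedRing.proj_apply]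
      exact DirectSum.decompose_of_mem_same 𝒜 hz
    · rw [(Submodule.mem_bot K).1 hz, map_zero]
  · intro d d' z hdd hz
    unfold zdeg at hz
    split_ifs at hz with hd'
    · by_cases hd : 0 ≤ d
      · simp only [hd, if_true, GradedRing.proj_apply]
        exact DirectSum.decompose_of_mem_ne 𝒜 hz (by omega)
      · simp only [hd, if_false, AddMonoidHom.zero_apply]
    · rw [(Submodule.mem_bot K).1 hz, map_zero]
  · intro d T y z hy
    by_cases hd : 0 ≤ d
    · have h1 : 0 ≤ d + (T : ℤ) := by omega
      have h2 : (d + (T : ℤ)).toNat = T + d.toNat := by omega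
      simp only [hd, h1, if_true, GradedRing.proj_apply, h2]
      exact DirectSum.coe_decompose_mul_add_of_left_mem 𝒜 hy
    · by_cases h1 : 0 ≤ d + (T : ℤ)
      · simp only [hd, h1, if_true, if_false, GradedRing.proj_apply, AddMonoidHom.zero_apply,
          mul_zero]
        exact DirectSum.coe_decompose_mul_of_left_mem_of_not_le 𝒜 hy (by omega)
      · simp only [hd, h1, if_false, AddMonoidHom.zero_apply, mul_zero]
  · intro d z
    unfold zdeg
    by_cases hd : 0 ≤ d
    · simp only [hd, if_true, GradedRing.proj_apply]
      exact SetLike.coe_mem _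
    · simp only [hd, if_false, AddMonoidHom.zero_apply]
      exact Submodule.zero_mem _

lemma mul_mem_zdeg (h : IsStandardGraded K R 𝒜) {T : ℕ} {d : ℤ} {y z : R} (hy : y ∈ 𝒜 T)
    (hz : z ∈ zdeg 𝒜 d) : y * z ∈ zdeg 𝒜 (d + T) := by
  haveI := gradedMonoid h
  unfold zdeg at *
  split_ifs at hz with hd
  · rw [if_pos (by omega), show (d + (T : ℤ)).toNat = T + d.toNat by omega]
    exact SetLike.mul_mem_graded hy hz
  · rw [(Submodule.mem_bot K).1 hz, mul_zero]; exact Submodule.zero_mem _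

lemma pow_mem_zdeg (h : IsStandardGraded K R 𝒜) {d : ℤ} {z : R} (q : ℕ) (hq : q ≠ 0)
    (hz : z ∈ zdeg 𝒜 d) : z ^ q ∈ zdeg 𝒜 (d * q) := by
  haveI := gradedMonoid h
  unfold zdeg at *
  split_ifs at hz with hd
  · rw [if_pos (by positivity), show (d * (q : ℤ)).toNat = q • d.toNat by
      obtain ⟨m, rfl⟩ := Int.eq_ofNat_of_zero_le hd
      rw [smul_eq_mul, mul_comm q]
      exact_mod_cast Int.toNat_natCast (m * q)]
    exact SetLike.pow_mem_graded q hz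
  · rw [(Submodule.mem_bot K).1 hz, zero_pow hq]; exact Submodule.zero_mem _

lemma prod_mem (h : IsStandardGraded K R 𝒜) {n : ℕ} {x : Fin n → R} (hx : ∀ l, x l ∈ 𝒜 1)
    (s : Finset (Fin n)) (c : ℕ) : (∏ l ∈ s, x l) ^ c ∈ 𝒜 (s.card * c) := by
  haveI := gradedMonoid h
  have h1 : ∏ l ∈ s, x l ∈ 𝒜 s.card := by
    have := SetLike.prod_mem_graded (A := 𝒜) (fun _ => 1) x (F := s) (fun l _ => hx l)
    simpa using this
  have := SetLike.pow_mem_graded c h1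
  rwa [smul_eq_mul, mul_comm] at this

lemma zdeg_one : zdeg 𝒜 1 = 𝒜 1 := by
  unfold zdeg; simp

lemma zdeg_zero : zdeg 𝒜 0 = 𝒜 0 := by
  unfold zdeg; simp

lemma adjoin_top (h : IsStandardGraded K R 𝒜) {n : ℕ} {x : Fin n → R} (hx : ∀ l, x l ∈ 𝒜 1)
    (hs : Ideal.span (Set.range x) = Ideal.span ((𝒜 1 : Submodule K R) : Set R)) :
    Algebra.adjoin K (Set.range x) = ⊤ := by
  rw [eq_top_iff, ← h.gen1]
  refine Algebra.adjoin_le fun y hy => ?_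
  obtain ⟨pr, h1, h2, h3, h4⟩ := exists_pr h
  have hy' : y ∈ Ideal.span (Set.range x) := hs ▸ Ideal.subset_span hy
  obtain ⟨r, hr⟩ := (Ideal.mem_span_range_iff_exists_fun).1 hy'
  have h5 : pr 1 y = y := h1 1 y (by rw [zdeg_one]; exact hy)
  rw [← h5, ← hr, map_sum]
  refine Subalgebra.sum_mem _ fun l _ => ?_
  have := h3 0 1 (x l) (r l) (hx l)
  rw [mul_comm, show (1 : ℤ) = 0 + (1 : ℕ) by norm_num, this]
  refine Subalgebra.mul_mem _ (Algebra.subset_adjoin ⟨l, rfl⟩) ?_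
  have h6 := h4 0 (r l)
  rw [zdeg_zero, h.deg0] at h6
  obtain ⟨k, hk⟩ := Submodule.mem_one.1 h6
  rw [← hk]
  exact Subalgebra.algebraMap_mem _ k

lemma irr_fg (h : IsStandardGraded K R 𝒜) : (irrIdeal 𝒜).FG := by
  obtain ⟨s, hs⟩ := h.fg1
  refine ⟨s, le_antisymm (Ideal.span_mono ?_) (Ideal.span_le.2 ?_)⟩
  · rw [← hs]; exact Submodule.subset_span
  · rw [← hs]
    exact Submodule.span_le_restrictScalars K R (s : Set R)

end Gr

section SocR

variable {K R : Type*} [Field K] [CommRing R] [Algebra K R]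

lemma socR {n i : ℕ} (hi : i ≤ n) {x : Fin n → R} (hx : Algebra.adjoin K (Set.range x) = ⊤) :
    ∃ N : ℕ, ∀ t : ℕ, 0 < t → ∀ ω : Fin N → (Finset (Fin n) → R),
    (∀ k, Hm i (ω k)) → (∀ k, D (pw x t) (ω k) = 0) →
    (∀ k l, Dies x t (x l • ω k)) →
    ∃ c : Fin N → K, c ≠ 0 ∧ Dies x t (∑ k, c k • ω k) := by
  letI : Algebra (MvPolynomial (Fin n) K) R := (MvPolynomial.aeval x).toAlgebra
  have hal : ∀ r : MvPolynomial (Fin n) K, algebraMap (MvPolynomial (Fin n) K) R r =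
    MvPolynomial.aeval x r := fun r => rfl
  haveI : IsScalarTower K (MvPolynomial (Fin n) K) R := IsScalarTower.of_algebraMap_eq fun k => by
    rw [hal]; simp
  have hsurj : Function.Surjective (algebraMap (MvPolynomial (Fin n) K) R) := by
    have : (MvPolynomial.aeval x : MvPolynomial (Fin n) K →ₐ[K] R).range = ⊤ := by
      rw [← hx, Algebra.adjoin_range_eq_range_aeval]
    exact AlgHom.range_eq_top _ |>.1 this
  haveI : Module.Finite (MvPolynomial (Fin n) K) R := Module.Finite.of_surjective
    (Algebra.linearMap (MvPolynomial (Fin n) K) R) hsurj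
  have hX : ∀ l (z : R), XX K n l • z = x l * z := fun l z => by
    rw [Algebra.smul_def, hal]; simp
  have hXp : ∀ l t (z : R), XX K n l ^ t • z = x l ^ t * z := fun l t z => by
    rw [Algebra.smul_def, hal]; simp
  have hD : ∀ t (ω : Finset (Fin n) → R), D (pw (XX K n) t) ω = D (pw x t) ω := by
    intro t ω
    funext s
    rw [D_apply, D_apply]
    refine Finset.sum_congr rfl fun l _ => ?_
    simp only [pw]
    rw [hXp, smul_eq_mul]
  have hT : ∀ c (ω : Finset (Fin n) → R), tr (XX K n) c ω = tr x c ω := by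
    intro t ω
    funext s
    rw [tr_apply, tr_apply, Algebra.smul_def, hal]; simp
  have hdies : ∀ t (ω : Finset (Fin n) → R), Dies (XX K n) t ω ↔ Dies x t ω := by
    intro t ω
    unfold Dies
    simp only [hD, hT]
  obtain ⟨N, hN⟩ := socBound (K := K) hi R
  refine ⟨N, fun t ht ω h1 h2 h3 => ?_⟩
  simp only [hD, hdies] at hN
  refine hN t ht ω h1 h2 fun k l => ?_
  have : XX K n l • ω k = x l • ω k := by
    funext s
    exact hX l _
  rw [this]
  exact h3 k l

end SocR

end FTaux

namespace FTaux

open Finset FT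

section Main

variable {K R : Type*} [Field K] [CommRing R] [Algebra K R] {𝒜 : ℕ → Submodule K R}

/-- degrees of homogeneous socle classes -/
def socDeg (𝒜 : ℕ → Submodule K R) {n : ℕ} (x : Fin n → R) (i : ℕ) : Set ℤ :=
  {d | ∃ (t : ℕ) (ξ : Finset (Fin n) → R), 0 < t ∧ Hm i ξ ∧ D (pw x t) ξ = 0 ∧
    (∀ s, ξ s ∈ zdeg 𝒜 (d + t * i)) ∧ ¬ Dies x t ξ ∧ ∀ l, Dies x t (x l • ξ)}

lemma tr_mem (h : IsStandardGraded K R 𝒜) {n : ℕ} {x : Fin n → R} (hx : ∀ l, x l ∈ 𝒜 1)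
    {i : ℕ} {ξ : Finset (Fin n) → R} (h1 : Hm i ξ) {d : ℤ} (h2 : ∀ s, ξ s ∈ zdeg 𝒜 d) (c : ℕ) (s) :
    tr x c ξ s ∈ zdeg 𝒜 (d + c * i) := by
  rw [tr_apply]
  by_cases hs : s.card = i
  · have := mul_mem_zdeg h (prod_mem h hx s c) (h2 s)
    rw [hs] at this
    rw [smul_eq_mul]
    convert this using 2
    push_cast; ring
  · rw [h1 s hs, smul_zero]; exact Submodule.zero_mem _

lemma socDeg_finite (h : IsStandardGraded K R 𝒜) {n i : ℕ} (hi : i ≤ n) {x : Fin n → R}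
    (hx : ∀ l, x l ∈ 𝒜 1)
    (hs : Ideal.span (Set.range x) = Ideal.span ((𝒜 1 : Submodule K R) : Set R)) :
    (socDeg 𝒜 x i).Finite := by
  by_contra hinf
  obtain ⟨N, hN⟩ := socR hi (adjoin_top h hx hs)
  let f := Set.Infinite.natEmbedding _ hinf
  let d : Fin N → ℤ := fun k => (f k : ℤ)
  have hd : Function.Injective d := fun k k' hk => Fin.ext (f.injective (Subtype.ext hk))
  have hdm : ∀ k, d k ∈ socDeg 𝒜 x i := fun k => (f k).2
  choose t ξ ht h1 h2 h3 h4 h5 using hdm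
  obtain ⟨T, hT, hTk⟩ : ∃ T, 0 < T ∧ ∀ k, ∃ u, T = t k + u := by
    refine ⟨∑ k, t k + 1, by omega, fun k => ?_⟩
    have := Finset.single_le_sum (f := t) (fun _ _ => Nat.zero_le _) (Finset.mem_univ k)
    exact ⟨∑ k, t k + 1 - t k, by omega⟩
  choose u hu using hTk
  obtain ⟨c, hc, c', β, hβ⟩ := hN T hT (fun k => tr x (u k) (ξ k)) (fun k => (h1 k).tr x _)
    (fun k => by rw [hu k, D_tr, h2 k, map_zero])
    (fun k l => by
      rw [← map_smul, hu k, dies_tr_iff]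
      exact h5 k l)
  obtain ⟨k0, hk0⟩ := Function.ne_iff.1 hc
  rw [Pi.zero_apply] at hk0
  obtain ⟨pr, p1, p2, p3, p4⟩ := exists_pr h
  set dg : ℤ := d k0 + T * i + c' * i with hdg
  have key : tr x c' (c k0 • tr x (u k0) (ξ k0)) =
      D (pw x (T + c')) (fun s => pr (dg - (T + c' : ℕ)) (β s)) := by
    funext s
    have hs := congrArg (pr dg) (congrFun hβ s)
    have e1 : pr dg (tr x c' (∑ k, c k • tr x (u k) (ξ k)) s) =
        tr x c' (c k0 • tr x (u k0) (ξ k0)) s := by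
      have hsm : ∀ k, tr x c' (c k • tr x (u k) (ξ k)) s = c k • tr x c' (tr x (u k) (ξ k)) s := by
        intro k
        rw [tr_apply, tr_apply, Pi.smul_apply, smul_comm]
      have hmem : ∀ k, tr x c' (c k • tr x (u k) (ξ k)) s ∈ zdeg 𝒜 (d k + T * i + c' * i) := by
        intro k
        rw [hsm]
        refine Submodule.smul_mem _ _ ?_
        refine tr_mem h hx ((h1 k).tr x _) (fun s => ?_) c' s
        have := tr_mem h hx (h1 k) (h3 k) (u k) s
        convert this using 2
        rw [hu k]; push_cast; ring
      rw [map_sum, Finset.sum_apply, map_sum, Finset.sum_eq_single k0]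
      · exact p1 _ _ (hmem k0)
      · intro k _ hk
        refine p2 _ _ _ ?_ (hmem k)
        have := hd.ne hk
        omega
      · simp
    rw [e1] at hs
    rw [hs, D_apply, D_apply, map_sum]
    refine Finset.sum_congr rfl fun l _ => ?_
    rw [map_zsmul, smul_eq_mul, smul_eq_mul]
    congr 1
    have hxl : pw x (T + c') l ∈ 𝒜 (T + c') := by
      have := prod_mem h hx {l} (T + c')
      simpa [pw] using this
    have := p3 (dg - (T + c' : ℕ)) (T + c') _ (β (s.erase l)) hxl
    rw [sub_add_cancel] at this
    exact this
  have hdie : Dies x T (c k0 • tr x (u k0) (ξ k0)) := ⟨c', _, key⟩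
  have hdie2 : Dies x T (tr x (u k0) (ξ k0)) := by
    have := hdie.smul (algebraMap K R (c k0)⁻¹)
    rwa [algebraMap_smul, smul_smul, inv_mul_cancel₀ hk0, one_smul] at this
  rw [hu k0, dies_tr_iff] at hdie2
  exact h4 k0 hdie2

lemma dies_ideal {n : ℕ} {x : Fin n → R} {t : ℕ} {ω : Finset (Fin n) → R} (S : Set R)
    (hS : ∀ y ∈ S, Dies x t (y • ω)) {y : R} (hy : y ∈ Ideal.span S) : Dies x t (y • ω) := by
  refine Submodule.span_induction (p := fun y _ => Dies x t (y • ω)) hS ?_ ?_ ?_ hy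
  · rw [zero_smul]; exact dies_zero _ _
  · intro y z _ _ h1 h2
    rw [add_smul]; exact h1.add h2
  · intro a y _ h1
    rw [smul_eq_mul, mul_smul]; exact h1.smul a

open Pointwise in
lemma span_pow_set (r : ℕ) : (Ideal.span ((𝒜 1 : Submodule K R) : Set R)) ^ r =
    Ideal.span (((𝒜 1 : Submodule K R) : Set R) ^ r) :=
  Submodule.span_pow _ r

open Pointwise in
lemma mem_of_mem_pow (h : IsStandardGraded K R 𝒜) (r : ℕ) {y : R}
    (hy : y ∈ ((𝒜 1 : Submodule K R) : Set R) ^ r) : y ∈ 𝒜 r := by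
  have := gradedMonoid h
  induction r generalizing y with
  | zero =>
    rw [pow_zero, Set.mem_one] at hy
    rw [hy]; exact SetLike.one_mem_graded 𝒜
  | succ r ih =>
    rw [pow_succ] at hy
    obtain ⟨z, hz, w, hw, rfl⟩ := Set.mem_mul.1 hy
    exact SetLike.mul_mem_graded (ih hz) hw

lemma main_bound (h : IsStandardGraded K R 𝒜) (p : ℕ) [hp : Fact p.Prime] [CharP R p]
    (hFP : IsFPureRing R p) {n i : ℕ} {x : Fin n → R}
    (hx : ∀ l, x l ∈ 𝒜 1)
    (hs : Ideal.span (Set.range x) = Ideal.span ((𝒜 1 : Submodule K R) : Set R))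
    {t : ℕ} (ht : 0 < t) {ω : Finset (Fin n) → R} {a : ℤ} (h1 : Hm i ω) (h2 : D (pw x t) ω = 0)
    (h3 : ∀ s, ω s ∈ zdeg 𝒜 (a + t * i)) (h4 : ¬ Dies x t ω) (h5 : ∀ l, Dies x t (x l • ω)) :
    ∃ B : ℤ, ∀ e : ℕ, B ≤ nu (irrIdeal 𝒜) (irrIdeal 𝒜) (p ^ e) + a * p ^ e := by
  have hi : i ≤ n := by
    by_contra hi
    apply h4
    have : ω = 0 := by
      funext s
      refine h1 s ?_
      have := s.card_le_univ
      rw [Fintype.card_fin] at this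
      omega
    rw [this]; exact dies_zero _ _
  have hm : irrIdeal 𝒜 = Ideal.span (Set.range x) := hs.symm
  obtain ⟨B, hB⟩ := (socDeg_finite h hi hx hs).bddBelow
  refine ⟨B, fun e => ?_⟩
  have hq : p ^ e ≠ 0 := pow_ne_zero _ hp.out.ne_zero
  set m := irrIdeal 𝒜 with hmdef
  set q := p ^ e with hqdef
  set ωq : Finset (Fin n) → R := fun s => ω s ^ q with hωq
  have g1 : ∀ y ∈ m, Dies x t (y • ω) := fun y hy => by
    rw [hm] at hy
    refine dies_ideal _ ?_ hy
    rintro _ ⟨l, rfl⟩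
    exact h5 l
  have g2 : ∀ y ∈ frobeniusPower m q, Dies x (t * q) (y • ωq) := fun y hy => by
    refine dies_ideal _ ?_ hy
    rintro _ ⟨z, hz, rfl⟩
    have := dies_frob p e (g1 z hz)
    convert this using 1
    funext s
    simp [hωq, mul_pow, hqdef]
  let A : Set ℕ := {r | ∃ u ∈ m ^ r, ¬ Dies x (t * q) (u • ωq)}
  have hA0 : A.Nonempty := ⟨0, 1, by simp, fun hh => h4 (dies_of_frob p hFP e (by
    rwa [one_smul] at hh))⟩
  have hAs : A ⊆ {r : ℕ | ¬ m ^ r ≤ frobeniusPower m q} := by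
    rintro r ⟨u, hu, hu'⟩ hle
    exact hu' (g2 u (hle hu))
  have hfg : m.FG := irr_fg h
  have hbd := nu_bdd hfg q
  have hAb : BddAbove A := hbd.mono hAs
  obtain ⟨u, hu, hu'⟩ := Nat.sSup_mem hA0 hAb
  have hle : sSup A ≤ nu m m q := csSup_le_csSup hbd hA0 hAs
  set r := sSup A with hr
  have hgen : ∃ v ∈ 𝒜 r, v ∈ m ^ r ∧ ¬ Dies x (t * q) (v • ωq) := by
    by_contra hcon
    push Not at hcon
    apply hu'
    have hpow := span_pow_set (𝒜 := 𝒜) r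
    have hu2 := hu
    rw [hmdef, irrIdeal, hpow] at hu2
    refine dies_ideal _ (fun y hy => ?_) hu2
    exact hcon y (mem_of_mem_pow h r hy) (by
      rw [hmdef, irrIdeal, hpow]; exact Ideal.subset_span hy)
  obtain ⟨v, hv1, hv2, hv3⟩ := hgen
  have hmem : (r : ℤ) + a * q ∈ socDeg 𝒜 x i := by
    refine ⟨t * q, v • ωq, Nat.mul_pos ht (Nat.pos_of_ne_zero hq), ?_, ?_, ?_, hv3, ?_⟩
    · intro s hs'
      simp [hωq, h1 s hs', hq]
    · rw [map_smul]
      have := D_frob p x t e ω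
      rw [h2] at this
      rw [hωq, hqdef, this]
      funext s
      simp [hp.out.ne_zero]
    · intro s
      have := mul_mem_zdeg h hv1 (pow_mem_zdeg h q hq (h3 s))
      rw [Pi.smul_apply, smul_eq_mul]
      convert this using 2
      push_cast; ring
    · intro l
      rw [smul_smul]
      by_contra hcon
      have : r + 1 ∈ A := ⟨x l * v, by
        rw [pow_succ, mul_comm (x l)]
        exact Ideal.mul_mem_mul hv2 (by rw [hm]; exact Ideal.subset_span ⟨l, rfl⟩), hcon⟩
      have := le_csSup hAb this
      omega
  have := hB hmem
  have h6 : (r : ℤ) ≤ nu m m q := by exact_mod_cast hle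
  push_cast [hqdef] at this
  linarith

end Main

end FTaux

open FT Filter in
/-- Let `(R, m, K)` be an `F`-finite and `F`-pure standard graded
`K`-algebra of prime characteristic `p`.  Then the diagonal `F`-threshold
`c^m(R) = lim_{e→∞} ν_m(p^e)/p^e` exists (since `R` is `F`-pure), where
`ν_m(p^e) = max{r | m^r ⊄ m^{[p^e]}}`, and for every `i` with `H^i_m(R) ≠ 0` one has
`-a_i(R) ≤ c^m(R)`. -/
theorem neg_aInv_le_diagonal_Fthreshold
    (K R : Type*) [Field K] [CommRing R] [Algebra K R]
    (𝒜 : ℕ → Submodule K R) (hSG : IsStandardGraded K R 𝒜)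
    (p : ℕ) (hp : p.Prime) [CharP R p]
    (hFF : IsFFinite R p) (hFP : IsFPureRing R p) :
    ∃ c : ℝ,
      Tendsto (fun e : ℕ => (nu (irrIdeal 𝒜) (irrIdeal 𝒜) (p ^ e) : ℝ) / (p : ℝ) ^ e)
        atTop (nhds c) ∧
      ∀ (i : ℕ) (a : ℤ), IsGreatest {j : ℤ | lcNonzero K R 𝒜 i j} a → (-a : ℝ) ≤ c := by
  have := Fact.mk hp
  obtain ⟨c, hc⟩ := FTaux.nu_tendsto p hp hFP (FTaux.irr_fg hSG)
  refine ⟨c, hc, fun i a ha => ?_⟩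
  obtain ⟨n, x, hx, hs, t, ω, ht, hz, hdeg, hnb⟩ := ha.1
  rw [FTaux.not_dies_iff] at hnb
  have hz' := (FTaux.mem_koszulZ_iff _ _ _).1 hz
  have hdeg' : ∀ s, FTaux.ex ω s ∈ zdeg 𝒜 (a + t * i) := by
    intro s
    by_cases h : s.card = i
    · rw [FTaux.ex_apply _ _ h]; exact hdeg _
    · rw [FTaux.ex_Hm ω s h]; exact Submodule.zero_mem _
  have hsoc : ∀ l, FTaux.Dies x t (x l • FTaux.ex ω) := by
    intro l
    by_contra hcon
    have hex : FTaux.ex (x l • ω) = x l • FTaux.ex ω := by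
      funext s
      rw [Pi.smul_apply]
      by_cases h : s.card = i
      · rw [FTaux.ex_apply _ _ h, FTaux.ex_apply _ _ h]; rfl
      · rw [FTaux.ex_Hm _ s h, FTaux.ex_Hm _ s h, smul_zero]
    have hmem : lcNonzero K R 𝒜 i (a + 1) := by
      refine ⟨n, x, hx, hs, t, x l • ω, ht, Submodule.smul_mem _ _ hz, fun s => ?_, ?_⟩
      · have := FTaux.mul_mem_zdeg hSG (hx l) (hdeg s)
        rw [Pi.smul_apply, smul_eq_mul]
        convert this using 2
        push_cast; ring
      · rw [FTaux.not_dies_iff, hex]; exact hcon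
    have := ha.2 hmem
    omega
  obtain ⟨B, hB⟩ := FTaux.main_bound hSG p hFP hx hs ht (FTaux.ex_Hm ω) hz' hdeg' hnb hsoc
  have hp1 : (1 : ℝ) < p := by exact_mod_cast hp.one_lt
  have hlim : Tendsto (fun e : ℕ => -(a : ℝ) + (B : ℝ) / (p : ℝ) ^ e) atTop
      (nhds (-(a : ℝ) + 0)) :=
    tendsto_const_nhds.add (tendsto_const_nhds.div_atTop (tendsto_pow_atTop_atTop_of_one_lt hp1))
  rw [add_zero] at hlim
  refine le_of_tendsto_of_tendsto' hlim hc fun e => ?_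
  have hpe : (0 : ℝ) < (p : ℝ) ^ e := by positivity
  have h1 : (B : ℝ) ≤ nu (irrIdeal 𝒜) (irrIdeal 𝒜) (p ^ e) + a * (p : ℝ) ^ e := by
    exact_mod_cast hB e
  rw [le_div_iff₀ hpe, add_mul, div_mul_cancel₀ _ hpe.ne']
  linarith
end
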